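/- Let n ≥ 2 and k ≥ 4 be integers and let A ∈ ℝ^{n×(n+k)} have columns a_1,…,a_{n+k} ∈ ℝⁿ that do not all lie in a single affine hyperplane. Then there is an open dense subset U ⊆ ℝ^{n+k} such that for every c ∈ U, the zero set Z_ℝ(g_c) has at most (n+k)(n+k−1)/2 + ⌊(S(n+2, k−2) + S(n+1, k−4))/2⌋ connected components. -/

import Mathlib

/-- The exponential sum `g_c(y) = ∑_j c_j · exp(a_j · y)`. -/
noncomputable def expSum {n N : ℕ} (a : Fin N → Fin n → ℝ) (c : Fin N → ℝ)
    (y : Fin n → ℝ) : ℝ :=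
  ∑ j, c j * Real.exp (∑ i, a j i * y i)

/-- The columns `a_1, …, a_N` do not all lie in a single affine hyperplane of ℝⁿ. -/
def NotAllInAffineHyperplane {n N : ℕ} (a : Fin N → Fin n → ℝ) : Prop :=
  ¬ ∃ (w : Fin n → ℝ) (b : ℝ), w ≠ 0 ∧ ∀ j, (∑ i, w i * a j i) = b

/-- The fewnomial-type bound `S(m,j)`: `S(m,0) = 1`, `S(m,1) = m+1`, and
`S(m,j) = ((e²+3)/4)·2^{j(j−1)/2}·mʲ` for `j ≥ 2`. -/
noncomputable def S (m j : ℕ) : ℝ :=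
  if j = 0 then 1
  else if j = 1 then (m : ℝ) + 1
  else ((Real.exp 1) ^ 2 + 3) / 4 * (2 : ℝ) ^ (j * (j - 1) / 2) * (m : ℝ) ^ j


set_option linter.all false

open Set Filter Topology

namespace Fewn

section Persist
variable {P E : Type*} [NormedAddCommGroup P] [NormedSpace ℝ P] [CompleteSpace P]
  [NormedAddCommGroup E] [NormedSpace ℝ E] [FiniteDimensional ℝ E]

lemma fderiv_slice {F : P × E → E} {t : P} {x : E} (h : DifferentiableAt ℝ F (t, x)) :
    fderiv ℝ (fun y => F (t, y)) x = (fderiv ℝ F (t, x)) ∘L .inr ℝ P E := by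
  have h1 : HasFDerivAt (fun y : E => (t, y)) (ContinuousLinearMap.inr ℝ P E) x :=
    hasFDerivAt_prodMk_right t x
  exact (h.hasFDerivAt.comp x h1).fderiv

lemma isInvertible_of_det_ne_zero {L : E →L[ℝ] E} (h : L.det ≠ 0) : L.IsInvertible := by
  refine ⟨ContinuousLinearMap.toContinuousLinearEquivOfDetNeZero L h, ?_⟩
  exact ContinuousLinearMap.coe_toContinuousLinearEquivOfDetNeZero L h

lemma persist_one (F : P × E → E) (t0 : P) (x : E) (O : Set (P × E)) (hO : O ∈ 𝓝 (t0, x))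
    (hF : ContDiffAt ℝ 1 F (t0, x)) (hz : F (t0, x) = 0)
    (hd : (fderiv ℝ (fun y => F (t0, y)) x).det ≠ 0) :
    ∃ φ : P → E, Tendsto φ (𝓝 t0) (𝓝 x) ∧ ∀ᶠ t in 𝓝 t0, (t, φ t) ∈ O ∧ F (t, φ t) = 0 ∧
      (fderiv ℝ (fun y => F (t, y)) (φ t)).det ≠ 0 := by
  have hs := hF.hasStrictFDerivAt (by norm_num)
  have hinv : ((fderiv ℝ F (t0, x)) ∘L .inr ℝ P E).IsInvertible := by
    apply isInvertible_of_det_ne_zero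
    rwa [← fderiv_slice hs.differentiableAt]
  have ht := hs.tendsto_implicitFunctionOfProdDomain hinv
  refine ⟨hs.implicitFunctionOfProdDomain hinv, ht, ?_⟩
  have h2 : Tendsto (fun t => (t, hs.implicitFunctionOfProdDomain hinv t)) (𝓝 t0) (𝓝 (t0, x)) :=
    by rw [nhds_prod_eq]; exact tendsto_id.prodMk ht
  have h3 : ∀ᶠ q in 𝓝 (t0, x), ContDiffAt ℝ 1 F q := hF.eventually (by norm_num)
  have h4 : ContinuousAt (fun q => ((fderiv ℝ F q) ∘L .inr ℝ P E).det) (t0, x) := by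
    have : ContinuousAt (fderiv ℝ F) (t0, x) := (hF.fderiv_right (m := 0) (by norm_num)).continuousAt
    have h5 : Continuous (fun L : P × E →L[ℝ] E => (L ∘L .inr ℝ P E).det) :=
      ContinuousLinearMap.continuous_det.comp
        ((ContinuousLinearMap.compL ℝ E (P × E) E).flip (.inr ℝ P E)).continuous
    exact h5.continuousAt.comp this
  have h5 : ∀ᶠ q in 𝓝 (t0, x), ((fderiv ℝ F q) ∘L .inr ℝ P E).det ≠ 0 := by
    apply h4.eventually_ne
    rwa [← fderiv_slice hs.differentiableAt]
  filter_upwards [h2.eventually hO, h2.eventually h3, h2.eventually h5,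
    hs.eventually_apply_implicitFunctionOfProdDomain hinv] with t a1 a2 a3 a4
  refine ⟨a1, a4.trans hz, ?_⟩
  rwa [fderiv_slice (a2.differentiableAt (by norm_num))]

/-- Nondegenerate zeros persist under perturbation. -/
lemma persist (F : P × E → E) (t0 : P) (S : Finset E) (O : Set (P × E))
    (hO : ∀ x ∈ S, O ∈ 𝓝 (t0, x))
    (hF : ∀ x ∈ S, ContDiffAt ℝ 1 F (t0, x)) (hz : ∀ x ∈ S, F (t0, x) = 0)
    (hd : ∀ x ∈ S, (fderiv ℝ (fun y => F (t0, y)) x).det ≠ 0) :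
    ∀ᶠ t in 𝓝 t0, ∃ S' : Finset E, S'.card = S.card ∧ ∀ x ∈ S', (t, x) ∈ O ∧ F (t, x) = 0 ∧
      (fderiv ℝ (fun y => F (t, y)) x).det ≠ 0 := by
  classical
  have H : ∀ x : S, ∃ φ : P → E, Tendsto φ (𝓝 t0) (𝓝 x) ∧ ∀ᶠ t in 𝓝 t0, (t, φ t) ∈ O ∧
      F (t, φ t) = 0 ∧ (fderiv ℝ (fun y => F (t, y)) (φ t)).det ≠ 0 := fun x =>
    persist_one F t0 x O (hO x x.2) (hF x x.2) (hz x x.2) (hd x x.2)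
  choose φ h1 h2 using H
  have h3 : ∀ᶠ t in 𝓝 t0, ∀ x : S, (t, φ x t) ∈ O ∧
      F (t, φ x t) = 0 ∧ (fderiv ℝ (fun y => F (t, y)) (φ x t)).det ≠ 0 := by
    rw [eventually_all]; exact h2
  have h4 : ∀ᶠ t in 𝓝 t0, ∀ x y : S, x ≠ y → φ x t ≠ φ y t := by
    simp only [eventually_all]
    intro x y hxy
    have hne : (x : E) ≠ y := fun h => hxy (Subtype.ext h)
    obtain ⟨u, v, hu, hv, hxu, hyv, huv⟩ := t2_separation hne
    filter_upwards [(h1 x).eventually (hu.mem_nhds hxu), (h1 y).eventually (hv.mem_nhds hyv)]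
      with t a b hab
    exact Set.disjoint_left.mp huv a (hab ▸ b)
  filter_upwards [h3, h4] with t a b
  refine ⟨Finset.univ.image (fun x : S => φ x t), ?_, ?_⟩
  · rw [Finset.card_image_of_injective]
    · simp
    · intro x y h
      by_contra hne
      exact b x y hne h
  · intro x hx
    obtain ⟨y, -, rfl⟩ := Finset.mem_image.mp hx
    exact a y

end Persist
end Fewn

open Set Filter Topology

namespace Fewn

section Bezout
open MvPolynomial
variable {l : ℕ}

/-- perturbed polynomial monomials -/
noncomputable def bzV {R : Type*} [CommRing R] (d : Fin l → ℕ) (g : Fin l → MvPolynomial (Fin l) R)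
    (γ : Fin l →₀ ℕ) : MvPolynomial (Fin l) R :=
  ∏ i, (X i ^ (γ i % d i) * g i ^ (γ i / d i))

lemma bzV_map {R R' : Type*} [CommRing R] [CommRing R'] (f : R →+* R') (d : Fin l → ℕ)
    (g : Fin l → MvPolynomial (Fin l) R) (γ : Fin l →₀ ℕ) :
    map f (bzV d g γ) = bzV d (fun i => map f (g i)) γ := by
  simp [bzV, map_prod]

lemma bzV_deg (d : Fin l → ℕ) (g : Fin l → MvPolynomial (Fin l) ℝ)
    (hg : ∀ i, (g i).totalDegree ≤ d i) (γ : Fin l →₀ ℕ) :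
    (bzV d g γ).totalDegree ≤ γ.degree := by
  refine (totalDegree_finsetProd _ _).trans ?_
  rw [Finsupp.degree_eq_sum]
  refine Finset.sum_le_sum fun i _ => ?_
  refine (totalDegree_mul _ _).trans ?_
  have h1 : (X i ^ (γ i % d i) : MvPolynomial (Fin l) ℝ).totalDegree ≤ γ i % d i := by
    refine (totalDegree_pow _ _).trans ?_
    simp
  have h2 : (g i ^ (γ i / d i)).totalDegree ≤ (γ i / d i) * d i :=
    (totalDegree_pow _ _).trans (Nat.mul_le_mul_left _ (hg i))
  have h3 := Nat.mod_add_div' (γ i) (d i)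
  omega

lemma bzV_pow (d : Fin l → ℕ) (γ : Fin l →₀ ℕ) :
    bzV d (fun i => (X i ^ d i : MvPolynomial (Fin l) ℝ)) γ = monomial γ 1 := by
  rw [monomial_eq, bzV]
  simp only [map_one, one_mul]
  rw [Finsupp.prod_fintype _ _ (by simp)]
  refine Finset.prod_congr rfl fun i _ => ?_
  rw [← pow_mul, ← pow_add, Nat.mod_add_div]

lemma exists_separating (S : Finset (Fin l → ℝ)) (s0 : Fin l → ℝ) (hs : s0 ∈ S) :
    ∃ q : MvPolynomial (Fin l) ℝ, q.totalDegree + 1 ≤ S.card ∧ eval s0 q ≠ 0 ∧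
      ∀ s ∈ S, s ≠ s0 → eval s q = 0 := by
  classical
  have H : ∀ s : Fin l → ℝ, s ≠ s0 → ∃ i, s i ≠ s0 i := fun s h => Function.ne_iff.mp h
  by_cases hl : Nonempty (Fin l)
  swap
  · have : ∀ s ∈ S, s = s0 := by
      intro s _
      funext i
      exact absurd ⟨i⟩ hl
    refine ⟨1, ?_, by simp, fun s hs hne => absurd (this s hs) hne⟩
    have := Finset.card_pos.mpr ⟨s0, hs⟩
    simpa using this
  choose! c hc using H
  refine ⟨∏ s ∈ S.erase s0, (X (c s) - C (s (c s))), ?_, ?_, ?_⟩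
  · have h1 : (∏ s ∈ S.erase s0, (X (c s) - C (s (c s)) : MvPolynomial (Fin l) ℝ)).totalDegree
        ≤ (S.erase s0).card := by
      refine (totalDegree_finsetProd _ _).trans ?_
      rw [Finset.card_eq_sum_ones]
      refine Finset.sum_le_sum fun s _ => ?_
      refine (totalDegree_sub_C_le _ _).trans ?_
      simp
    have := Finset.card_erase_add_one hs
    omega
  · rw [map_prod]
    refine Finset.prod_ne_zero_iff.mpr fun s h => ?_
    simp only [map_sub, eval_X, eval_C]
    exact sub_ne_zero.mpr (hc s (Finset.ne_of_mem_erase h)).symm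
  · intro s h hne
    rw [map_prod]
    refine Finset.prod_eq_zero (Finset.mem_erase.mpr ⟨hne, h⟩) (by simp)

lemma bezout_core (p : Fin l → MvPolynomial (Fin l) ℝ) (d : Fin l → ℕ) (hd : ∀ i, 0 < d i)
    (hp : ∀ i, (p i).totalDegree ≤ d i) (D : ℕ) :
    ∃ Q : Polynomial ℝ, Q ≠ 0 ∧ ∀ τ, Q.eval τ ≠ 0 → ∀ S : Finset (Fin l → ℝ), S.card ≤ D + 1 →
      (∀ s ∈ S, ∀ i, s i ^ d i + τ * eval s (p i) = 0) → S.card ≤ ∏ i, d i := by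
  classical
  let Γ := {γ : Fin l →₀ ℕ // γ.degree ≤ D}
  have : Fintype Γ := (Finsupp.finite_of_degree_le (σ := Fin l) D).fintype
  let G : Fin l → MvPolynomial (Fin l) (Polynomial ℝ) := fun i =>
    X i ^ d i + C Polynomial.X * map Polynomial.C (p i)
  let g : ℝ → Fin l → MvPolynomial (Fin l) ℝ := fun τ i => X i ^ d i + C τ * p i
  let M : Matrix Γ Γ (Polynomial ℝ) := fun γ δ => coeff δ.1 (bzV d G γ.1)
  have hG : ∀ τ i, map (Polynomial.evalRingHom τ) (G i) = g τ i := by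
    intro τ i
    simp only [G, g, map_add, map_mul, map_pow, map_X, map_C]
    congr 2
    · simp
    · have : (Polynomial.evalRingHom τ).comp Polynomial.C = RingHom.id ℝ := by ext; simp
      rw [MvPolynomial.map_map, this, MvPolynomial.map_id]
  have hM : ∀ τ, (Polynomial.evalRingHom τ).mapMatrix M =
      Matrix.of fun γ δ : Γ => coeff δ.1 (bzV d (g τ) γ.1) := by
    intro τ
    ext γ δ
    rw [RingHom.mapMatrix_apply, Matrix.map_apply, Matrix.of_apply]
    change Polynomial.evalRingHom τ (coeff δ.1 (bzV d G γ.1)) = _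
    rw [← coeff_map, bzV_map]
    simp only [hG]
  refine ⟨M.det, ?_, ?_⟩
  · intro h
    have h1 := congrArg (Polynomial.evalRingHom 0) h
    rw [RingHom.map_det, hM, map_zero] at h1
    have h2 : (Matrix.of fun γ δ : Γ => coeff δ.1 (bzV d (g 0) γ.1)) = 1 := by
      ext γ δ
      have : g 0 = fun i => X i ^ d i := by ext1 i; simp [g]
      rw [Matrix.of_apply, this, bzV_pow, coeff_monomial, Matrix.one_apply]
      by_cases hh : γ = δ
      · simp [hh]
      · rw [if_neg hh, if_neg (fun h => hh (Subtype.ext h))]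
    rw [h2, Matrix.det_one] at h1
    exact one_ne_zero h1
  · intro τ hτ S hS hz
    by_contra hlt
    push Not at hlt
    -- functional
    let f : (S → ℝ) →ₗ[ℝ] ((∀ i, Fin (d i)) → ℝ) :=
      { toFun := fun c α => ∑ s, c s * ∏ i, (s.1 i) ^ (α i : ℕ)
        map_add' := by intro c c'; ext α; simp [add_mul, Finset.sum_add_distrib]
        map_smul' := by intro c c'; ext α; simp [Finset.mul_sum, mul_assoc] }
    have hker : LinearMap.ker f ≠ ⊥ := by
      apply LinearMap.ker_ne_bot_of_finrank_lt
      simpa using hlt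
    obtain ⟨c, hc, hc0⟩ := (Submodule.ne_bot_iff _).mp hker
    let L : MvPolynomial (Fin l) ℝ →ₗ[ℝ] ℝ := ∑ s : S, c s • (aeval s.1).toLinearMap
    have hL : ∀ q, L q = ∑ s : S, c s * eval s.1 q := by
      intro q; simp [L, aeval_eq_eval]
    have hv : ∀ γ : Γ, L (bzV d (g τ) γ.1) = 0 := by
      intro γ
      rw [hL]
      by_cases hγ : ∀ i, γ.1 i / d i = 0
      · have := congrFun (LinearMap.mem_ker.mp hc) (fun i => ⟨γ.1 i % d i, Nat.mod_lt _ (hd i)⟩)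
        simp only [f, LinearMap.coe_mk, AddHom.coe_mk, Pi.zero_apply] at this
        rw [← this]
        refine Finset.sum_congr rfl fun s _ => ?_
        simp [bzV, map_prod, hγ]
      · push Not at hγ
        obtain ⟨i, hi⟩ := hγ
        refine Finset.sum_eq_zero fun s _ => ?_
        rw [bzV, map_prod, Finset.prod_eq_zero (Finset.mem_univ i), mul_zero]
        have : eval s.1 (g τ i) = 0 := by simpa [g] using hz s.1 s.2 i
        rw [map_mul, map_pow (eval s.1) (g τ i), this, zero_pow hi, mul_zero]
    have hexp : ∀ q : MvPolynomial (Fin l) ℝ, q.totalDegree ≤ D →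
        q = ∑ δ : Γ, coeff δ.1 q • monomial δ.1 1 := by
      intro q hq
      ext m
      simp only [coeff_sum, coeff_smul, coeff_monomial, smul_eq_mul, mul_ite, mul_one, mul_zero]
      by_cases hm : m.degree ≤ D
      · rw [Finset.sum_eq_single (⟨m, hm⟩ : Γ)]
        · simp
        · intro b _ hb; rw [if_neg]; intro h; exact hb (Subtype.ext h)
        · simp
      · rw [Finset.sum_eq_zero]
        · by_contra h
          exact hm ((le_totalDegree (mem_support_iff.mpr h)).trans hq)
        · intro δ _; rw [if_neg]; rintro rfl; exact hm δ.2
    have hgdeg : ∀ i, (g τ i).totalDegree ≤ d i := by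
      intro i
      refine (totalDegree_add _ _).trans (max_le ?_ ?_)
      · refine (totalDegree_pow _ _).trans (by simp)
      · refine (totalDegree_mul _ _).trans (by simpa using hp i)
    have hdet : (Matrix.of fun γ δ : Γ => coeff δ.1 (bzV d (g τ) γ.1)).det ≠ 0 := by
      rw [← hM, ← RingHom.map_det]; exact hτ
    have hw : (fun δ : Γ => L (monomial δ.1 1)) = 0 := by
      by_contra hne
      apply hdet
      refine Matrix.exists_mulVec_eq_zero_iff.mp ⟨_, hne, ?_⟩
      ext γ
      rw [Pi.zero_apply, ← hv γ]
      conv_rhs => rw [hexp _ ((bzV_deg d _ hgdeg γ.1).trans γ.2)]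
      simp [Matrix.mulVec, dotProduct, map_sum]
    have hall : ∀ q : MvPolynomial (Fin l) ℝ, q.totalDegree ≤ D → L q = 0 := by
      intro q hq
      rw [hexp q hq, map_sum]
      refine Finset.sum_eq_zero fun δ _ => ?_
      rw [map_smul, congrFun hw δ]; simp
    apply hc0
    ext s0
    obtain ⟨q, hq1, hq2, hq3⟩ := exists_separating S s0.1 s0.2
    have := hall q (by omega)
    rw [hL, Finset.sum_eq_single s0] at this
    · simpa [hq2] using this
    · intro s _ hs; rw [hq3 s.1 s.2 (fun h => hs (Subtype.ext h)), mul_zero]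
    · simp

lemma contDiff_eval (q : MvPolynomial (Fin l) ℝ) {m : WithTop ℕ∞} :
    ContDiff ℝ m (fun x : Fin l → ℝ => eval x q) := by
  induction q using MvPolynomial.induction_on with
  | C a => simpa using contDiff_const
  | add p q hp hq => simpa using hp.add hq
  | mul_X p i hp => simpa using hp.mul (contDiff_apply ℝ ℝ i)

/-- Bezout bound for nondegenerate real zeros. -/
theorem bezout (p : Fin l → MvPolynomial (Fin l) ℝ) (d : Fin l → ℕ)
    (hp : ∀ i, (p i).totalDegree ≤ d i) (S : Finset (Fin l → ℝ))
    (hz : ∀ x ∈ S, ∀ i, eval x (p i) = 0)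
    (hnd : ∀ x ∈ S, (fderiv ℝ (fun y i => eval y (p i)) x).det ≠ 0) :
    S.card ≤ ∏ i, d i := by
  by_cases hd : ∀ i, 0 < d i
  · let F : ℝ × (Fin l → ℝ) → (Fin l → ℝ) := fun q i => eval q.2 (p i) + q.1 * q.2 i ^ d i
    have hF : ContDiff ℝ 1 F := by
      rw [contDiff_pi]
      intro i
      refine ((contDiff_eval (p i)).comp contDiff_snd).add (contDiff_fst.mul ?_)
      exact ((contDiff_apply ℝ ℝ i).comp contDiff_snd).pow _
    have hF0 : (fun y => F (0, y)) = fun y i => eval y (p i) := by ext y i; simp [F]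
    have h1 := persist F 0 S univ (fun _ _ => univ_mem) (fun x _ => hF.contDiffAt)
      (fun x hx => by ext i; simpa [F] using hz x hx i) (by rw [hF0]; exact hnd)
    obtain ⟨Q, hQ, hQ'⟩ := bezout_core p d hd hp S.card
    have h2 : ∀ᶠ σ in 𝓝[≠] (0:ℝ), Q.eval σ⁻¹ ≠ 0 := by
      have hfin : {σ : ℝ | Q.eval σ⁻¹ = 0}.Finite := by
        have : {τ : ℝ | Q.eval τ = 0}.Finite := by
          simpa [Polynomial.IsRoot] using Polynomial.finite_setOfPred_isRoot hQ
        exact this.preimage (inv_injective.injOn)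
      have hx : ({σ : ℝ | Q.eval σ⁻¹ = 0} \ {0})ᶜ ∈ 𝓝 (0:ℝ) :=
        (hfin.subset sdiff_subset).isClosed.isOpen_compl.mem_nhds (by simp)
      filter_upwards [mem_nhdsWithin_of_mem_nhds hx, self_mem_nhdsWithin] with σ a b
      intro h; exact a ⟨h, b⟩
    obtain ⟨σ, ⟨⟨S', hc, hS'⟩, hσ⟩, hne⟩ :=
      (((h1.filter_mono nhdsWithin_le_nhds).and h2).and self_mem_nhdsWithin).exists
    rw [← hc]
    refine hQ' σ⁻¹ hσ S' (by omega) fun s hs i => ?_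
    have := congrFun (hS' s hs).2.1 i
    simp only [F, Pi.zero_apply] at this
    have hne' : σ ≠ 0 := hne
    field_simp
    linarith
  · push Not at hd
    obtain ⟨i, hi⟩ := hd
    have hS : S = ∅ := by
      rw [Finset.eq_empty_iff_forall_notMem]
      intro x hx
      apply hnd x hx
      have hdeg : (p i).totalDegree = 0 := by have := hp i; omega
      rw [totalDegree_eq_zero_iff_eq_C] at hdeg
      have hdiff : DifferentiableAt ℝ (fun y i => eval y (p i)) x := by
        rw [differentiableAt_pi]
        exact fun i => (contDiff_eval (p i) (m := 1)).differentiable (by norm_num) x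
      have hr : ∀ v, (fderiv ℝ (fun y i => eval y (p i)) x) v i = 0 := by
        intro v
        have : (fderiv ℝ (fun y i => eval y (p i)) x) v i
            = fderiv ℝ (fun y => eval y (p i)) x v := by
          have h := hasFDerivAt_pi'.mp hdiff.hasFDerivAt i
          rw [h.fderiv]; rfl
        rw [this, hdeg]; simp
      by_contra hne
      obtain ⟨e, he⟩ := isInvertible_of_det_ne_zero hne
      have := hr (e.symm (fun _ => 1))
      rw [← he] at this
      simp at this
    simp [hS]

end Bezout
end Fewn

open Set Filter Topology

namespace Fewn

section Path
variable {E : Type*} [MetricSpace E]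

structure IsSec (C : Set E) (f : E → ℝ) (τ : ℝ) (t : ℝ) (x : ℝ → E) : Prop where
  cont : ContinuousOn x (Icc 0 t)
  mem : ∀ s ∈ Icc 0 t, x s ∈ C
  val : ∀ s ∈ Icc 0 t, f (x s) = τ * s

structure HasLocSec (C : Set E) (f : E → ℝ) (y : E) (ε : ℝ) (q : ℝ → E) : Prop where
  pos : 0 < ε
  cont : ContinuousOn q (Metric.ball (f y) ε)
  mem : ∀ t ∈ Metric.ball (f y) ε, q t ∈ C
  val : ∀ t ∈ Metric.ball (f y) ε, f (q t) = t
  at_y : q (f y) = y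
  ev : ∀ᶠ x in 𝓝[C] y, q (f x) = x

lemma IsSec.mono {C : Set E} {f : E → ℝ} {τ t t' : ℝ} {x : ℝ → E} (h : IsSec C f τ t x)
    (ht : t' ≤ t) : IsSec C f τ t' x :=
  ⟨h.cont.mono (Icc_subset_Icc_right ht), fun s hs => h.mem s (Icc_subset_Icc_right ht hs),
    fun s hs => h.val s (Icc_subset_Icc_right ht hs)⟩

lemma IsSec.uniq {C : Set E} {f : E → ℝ} {τ t : ℝ} {x x' : ℝ → E}
    (H1 : ∀ y ∈ C, ∃ ε q, HasLocSec C f y ε q)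
    (h : IsSec C f τ t x) (h' : IsSec C f τ t x') {s1 : ℝ} (hs1 : s1 ∈ Icc 0 t)
    (he : x s1 = x' s1) : ∀ s ∈ Icc 0 t, x s = x' s := by
  have hpc : PreconnectedSpace (Icc (0:ℝ) t) := Subtype.preconnectedSpace isPreconnected_Icc
  have c1 : Continuous (fun s : Icc (0:ℝ) t => x s) := continuousOn_iff_continuous_restrict.mp h.cont
  have c2 : Continuous (fun s : Icc (0:ℝ) t => x' s) :=
    continuousOn_iff_continuous_restrict.mp h'.cont
  have hcl : IsClosed {s : Icc (0:ℝ) t | x s = x' s} := isClosed_eq c1 c2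
  have hop : IsOpen {s : Icc (0:ℝ) t | x s = x' s} := by
    rw [isOpen_iff_mem_nhds]
    intro s hs
    simp only [mem_setOf_eq] at hs
    obtain ⟨ε, q, hq⟩ := H1 (x s) (h.mem s s.2)
    have t1 : Tendsto (fun r : Icc (0:ℝ) t => x r) (𝓝 s) (𝓝[C] (x s)) :=
      tendsto_nhdsWithin_iff.mpr ⟨c1.continuousAt, Eventually.of_forall fun r => h.mem r r.2⟩
    have t2 : Tendsto (fun r : Icc (0:ℝ) t => x' r) (𝓝 s) (𝓝[C] (x s)) := by
      rw [hs]
      exact tendsto_nhdsWithin_iff.mpr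
        ⟨c2.continuousAt, Eventually.of_forall fun r => h'.mem r r.2⟩
    filter_upwards [t1.eventually hq.ev, t2.eventually hq.ev] with r a b
    rw [h.val r r.2] at a
    rw [h'.val r r.2] at b
    exact a.symm.trans b
  have := IsClopen.eq_univ ⟨hcl, hop⟩ ⟨⟨s1, hs1⟩, he⟩
  intro s hs
  have h3 : (⟨s, hs⟩ : Icc (0:ℝ) t) ∈ {s : Icc (0:ℝ) t | x s = x' s} := this ▸ mem_univ _
  exact h3

lemma IsSec.glue {C : Set E} {f : E → ℝ} {τ t t' : ℝ} {x : ℝ → E} (h : IsSec C f τ t x)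
    (ht0 : 0 ≤ t) (htt : t ≤ t') {y : E} {ε : ℝ} {q : ℝ → E} (hq : HasLocSec C f y ε q)
    (hb : ∀ s ∈ Icc t t', τ * s ∈ Metric.ball (f y) ε) (hqt : q (τ * t) = x t) :
    ∃ x', IsSec C f τ t' x' ∧ x' 0 = x 0 := by
  classical
  refine ⟨fun s => if s ≤ t then x s else q (τ * s), ⟨?_, ?_, ?_⟩, by simp [ht0]⟩
  · rw [← Icc_union_Icc_eq_Icc ht0 htt]
    refine ContinuousOn.union_of_isClosed ?_ ?_ isClosed_Icc isClosed_Icc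
    · refine h.cont.congr fun s hs => ?_
      simp [hs.2]
    · have : ContinuousOn (fun s => q (τ * s)) (Icc t t') :=
        hq.cont.comp (by fun_prop) hb
      refine this.congr fun s hs => ?_
      by_cases hst : s ≤ t
      · have : s = t := le_antisymm hst hs.1
        subst this
        simp [hqt]
      · simp [hst]
  · intro s hs
    by_cases hst : s ≤ t
    · simpa [hst] using h.mem s ⟨hs.1, hst⟩
    · simpa [hst] using hq.mem _ (hb s ⟨by linarith, hs.2⟩)
  · intro s hs
    by_cases hst : s ≤ t
    · simpa [hst] using h.val s ⟨hs.1, hst⟩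
    · simpa [hst] using hq.val _ (hb s ⟨by linarith, hs.2⟩)

/-- A maximal half path converges to a point of the limit set `L`. -/
lemma exists_half_path {C L K : Set E} {f : E → ℝ} {B : ℝ} (hK : IsCompact K) (hCK : C ⊆ K)
    (hL : L.Finite) (hcl : closure C ⊆ C ∪ L) (hf : ContinuousOn f C) (hB : ∀ x ∈ C, |f x| ≤ B)
    (H1 : ∀ y ∈ C, ∃ ε q, HasLocSec C f y ε q) {p : E} (hp : p ∈ C) (hfp : f p = 0)
    {τ : ℝ} (hτ : |τ| = 1) :
    ∃ (T : ℝ) (X : ℝ → E) (y : E), 0 < T ∧ X 0 = p ∧ (∀ t < T, IsSec C f τ t X) ∧ y ∈ L ∧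
      Tendsto X (𝓝[<] T) (𝓝 y) := by
  classical
  let R : Set ℝ := {t | 0 ≤ t ∧ ∃ x, IsSec C f τ t x ∧ x 0 = p}
  have habs : ∀ a b : ℝ, |τ * a - τ * b| = |a - b| := by
    intro a b; rw [← mul_sub, abs_mul, hτ, one_mul]
  have hR0 : (0:ℝ) ∈ R := by
    refine ⟨le_rfl, fun _ => p, ⟨continuousOn_const, fun _ _ => hp, ?_⟩, rfl⟩
    intro s hs
    have : s = 0 := le_antisymm hs.2 hs.1
    simp [this, hfp]
  have hRB : ∀ t ∈ R, t ≤ B := by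
    rintro t ⟨h0, x, hx, -⟩
    have h1 := hB _ (hx.mem t ⟨h0, le_rfl⟩)
    rw [hx.val t ⟨h0, le_rfl⟩, abs_mul, hτ, one_mul, abs_of_nonneg h0] at h1
    exact h1
  have hbdd : BddAbove R := ⟨B, hRB⟩
  have hext : ∀ t ∈ R, ∃ t' ∈ R, t < t' := by
    rintro t ⟨h0, x, hx, hx0⟩
    obtain ⟨ε, q, hq⟩ := H1 (x t) (hx.mem t ⟨h0, le_rfl⟩)
    have hε := hq.pos
    have hft := hx.val t ⟨h0, le_rfl⟩
    obtain ⟨x', hx', hx'0⟩ := hx.glue (t' := t + ε / 2) h0 (by linarith) hq (by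
      intro s hs
      rw [Metric.mem_ball, Real.dist_eq, hft, habs, abs_lt]
      constructor <;> linarith [hs.1, hs.2]) (by rw [← hft]; exact hq.at_y)
    exact ⟨t + ε / 2, ⟨by linarith, x', hx', hx'0.trans hx0⟩, by linarith⟩
  set T := sSup R with hT
  have hTnot : T ∉ R := by
    intro h
    obtain ⟨t', ht', hlt⟩ := hext T h
    exact absurd (le_csSup hbdd ht') (not_le.mpr hlt)
  have hT0 : 0 < T := by
    obtain ⟨t', ht', hlt⟩ := hext 0 hR0
    exact hlt.trans_le (le_csSup hbdd ht')
  have hlt : ∀ t, 0 ≤ t → t < T → t ∈ R := by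
    intro t h0 h
    obtain ⟨t', ⟨-, x, hx, hx0⟩, h2⟩ := exists_lt_of_lt_csSup ⟨0, hR0⟩ h
    exact ⟨h0, x, hx.mono h2.le, hx0⟩
  have : Nonempty (ℝ → E) := ⟨fun _ => p⟩
  choose! x hx using fun (t : ℝ) (h : t ∈ R) => h.2
  let X : ℝ → E := fun s => x ((s + T) / 2) s
  have hagree : ∀ t, 0 ≤ t → t < T → ∀ s ∈ Icc 0 t, X s = x t s := by
    intro t h0 h s hs
    have hs2 : (s + T) / 2 ∈ R := hlt _ (by linarith [hs.1]) (by linarith [hs.2])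
    have ht := hlt t h0 h
    rcases le_total ((s + T) / 2) t with hle | hle
    · exact IsSec.uniq H1 (hx _ hs2).1 ((hx _ ht).1.mono hle) (s1 := 0)
        ⟨le_rfl, by linarith [hs.1]⟩ ((hx _ hs2).2.trans (hx _ ht).2.symm) s
        ⟨hs.1, by linarith [hs.2]⟩
    · exact IsSec.uniq H1 ((hx _ hs2).1.mono hle) (hx _ ht).1 (s1 := 0)
        ⟨le_rfl, h0⟩ ((hx _ hs2).2.trans (hx _ ht).2.symm) s hs
  have hXsec : ∀ t < T, IsSec C f τ t X := by
    intro t h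
    by_cases h0 : 0 ≤ t
    · have ht := (hx t (hlt t h0 h)).1
      refine ⟨ht.cont.congr (hagree t h0 h), fun s hs => ?_, fun s hs => ?_⟩
      · rw [hagree t h0 h s hs]; exact ht.mem s hs
      · rw [hagree t h0 h s hs]; exact ht.val s hs
    · have he : Icc 0 t = ∅ := Icc_eq_empty h0
      exact ⟨by rw [he]; exact continuousOn_empty _, by simp [he], by simp [he]⟩
  have hX0 : X 0 = p := by
    rw [hagree 0 le_rfl hT0 0 ⟨le_rfl, le_rfl⟩]; exact (hx 0 hR0).2
  have hXmem : ∀ s, 0 ≤ s → s < T → X s ∈ C := fun s h0 h => (hXsec s h).mem s ⟨h0, le_rfl⟩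
  have hXval : ∀ s, 0 ≤ s → s < T → f (X s) = τ * s := fun s h0 h => (hXsec s h).val s ⟨h0, le_rfl⟩
  have hXcont : ContinuousOn X (Ico 0 T) := by
    intro s hs
    have hs' : s < (s + T) / 2 := by linarith [hs.2]
    have h1 := (hXsec ((s + T) / 2) (by linarith [hs.2])).cont s ⟨hs.1, hs'.le⟩
    refine h1.mono_of_mem_nhdsWithin ?_
    have : Iio ((s + T) / 2) ∈ 𝓝[Ico 0 T] s := mem_nhdsWithin_of_mem_nhds (Iio_mem_nhds hs')
    filter_upwards [this, self_mem_nhdsWithin] with r a b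
    exact ⟨b.1, le_of_lt a⟩
  -- eventually in C
  have hev0 : ∀ᶠ s in 𝓝[<] T, 0 ≤ s ∧ s < T := by
    filter_upwards [self_mem_nhdsWithin, mem_nhdsWithin_of_mem_nhds (Ioi_mem_nhds hT0)] with s a b
    exact ⟨le_of_lt b, a⟩
  have hevC : ∀ᶠ s in 𝓝[<] T, X s ∈ C := hev0.mono fun s h => hXmem s h.1 h.2
  have hclus : ∀ y, MapClusterPt y (𝓝[<] T) X → y ∈ L := by
    intro y hy
    have hyc : y ∈ closure C := by
      rw [mem_closure_iff_clusterPt]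
      exact hy.clusterPt.mono (le_principal_iff.mpr hevC)
    rcases hcl hyc with hyC | hyL
    swap
    · exact hyL
    exfalso
    obtain ⟨ε, q, hq⟩ := H1 y hyC
    -- f y = τ T
    have hfr : ∀ U ∈ 𝓝[C] y, ∃ᶠ s in 𝓝[<] T, X s ∈ U := by
      intro U hU
      obtain ⟨V, hV, hVU⟩ := mem_nhdsWithin_iff_exists_mem_nhds_inter.mp hU
      exact ((mapClusterPt_iff_frequently.mp hy V hV).and_eventually hevC).mono
        fun s h => hVU h
    have hfy : f y = τ * T := by
      by_contra hne
      have hpos : 0 < |f y - τ * T| := abs_pos.mpr (sub_ne_zero.mpr hne)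
      have h1 : {z | |f z - f y| < |f y - τ * T| / 2} ∈ 𝓝[C] y := by
        have := (hf y hyC).eventually (Metric.ball_mem_nhds _ (half_pos hpos))
        filter_upwards [this] with z hz
        simpa [Real.dist_eq] using hz
      have h2 : ∀ᶠ s in 𝓝[<] T, |s - T| < |f y - τ * T| / 2 := by
        have := Metric.ball_mem_nhds T (half_pos hpos)
        filter_upwards [mem_nhdsWithin_of_mem_nhds this] with s hs
        simpa [Real.dist_eq] using hs
      obtain ⟨s, ha, hb, hc⟩ := ((hfr _ h1).and_eventually (h2.and hev0)).exists
      simp only [mem_setOf_eq] at ha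
      rw [hXval s hc.1 hc.2] at ha
      rw [← habs] at hb
      have := abs_sub_le (f y) (τ * s) (τ * T)
      rw [abs_sub_comm (f y) (τ * s)] at this
      linarith
    have h2 : ∀ᶠ s in 𝓝[<] T, |s - T| < ε := by
      have := Metric.ball_mem_nhds T hq.pos
      filter_upwards [mem_nhdsWithin_of_mem_nhds this] with s hs
      simpa [Real.dist_eq] using hs
    obtain ⟨s, ha, hb, hc⟩ := ((hfr _ hq.ev).and_eventually (h2.and hev0)).exists
    simp only [mem_setOf_eq] at ha
    rw [hXval s hc.1 hc.2] at ha
    obtain ⟨x', hx', hx'0⟩ := (hXsec s hc.2).glue (t' := T) hc.1 hc.2.le hq (by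
      intro r hr
      rw [Metric.mem_ball, Real.dist_eq, hfy, habs, abs_lt]
      rw [abs_lt] at hb
      constructor <;> linarith [hr.1, hr.2]) ha
    exact hTnot ⟨hT0.le, x', hx', hx'0.trans hX0⟩
  have hne : (𝓝[<] T).NeBot := inferInstance
  obtain ⟨y, hyK, hy⟩ := hK.exists_mapClusterPt (u := X) (f := 𝓝[<] T)
    (le_principal_iff.mpr (hevC.mono fun s h => hCK h))
  refine ⟨T, X, y, hT0, hX0, hXsec, hclus y hy, ?_⟩
  rw [Metric.tendsto_nhds]
  intro r hr
  -- choose radius avoiding L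
  have : ∃ ρ ∈ Ioo 0 r, ρ ∉ (fun z => dist z y) '' L := by
    have hinf : (Ioo 0 r).Infinite := Ioo_infinite hr
    obtain ⟨ρ, h1, h2⟩ := hinf.exists_notMem_finite (hL.image (fun z => dist z y))
    exact ⟨ρ, h1, h2⟩
  obtain ⟨ρ, hρ, hρL⟩ := this
  have hnoS : ∀ᶠ s in 𝓝[<] T, dist (X s) y ≠ ρ := by
    by_contra hcon
    rw [not_eventually] at hcon
    push Not at hcon
    have hl : (𝓝[<] T ⊓ 𝓟 {s | dist (X s) y = ρ}).NeBot := frequently_iff_neBot.mp hcon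
    obtain ⟨z, hz, hzc⟩ := (hK.inter_right (Metric.isClosed_sphere (x := y) (ε := ρ))).exists_mapClusterPt
      (u := X) (f := 𝓝[<] T ⊓ 𝓟 {s | dist (X s) y = ρ}) (le_principal_iff.mpr (by
        rw [mem_map]
        have h1 : ∀ᶠ s in 𝓝[<] T ⊓ 𝓟 {s | dist (X s) y = ρ}, X s ∈ C := hevC.filter_mono inf_le_left
        have h2 : ∀ᶠ s in 𝓝[<] T ⊓ 𝓟 {s | dist (X s) y = ρ}, dist (X s) y = ρ :=
          mem_inf_of_right (mem_principal_self _)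
        filter_upwards [h1, h2] with s a b
        exact ⟨hCK a, b⟩))
    exact hρL ⟨z, hclus z (hzc.mono inf_le_left), hz.2⟩
  obtain ⟨s0, hs0, hs0'⟩ : ∃ s0 < T, ∀ s ∈ Ioo s0 T, dist (X s) y ≠ ρ ∧ 0 ≤ s := by
    have := hnoS.and (hev0.mono fun s h => h.1)
    rw [Filter.Eventually, mem_nhdsLT_iff_exists_Ioo_subset] at this
    obtain ⟨s0, h1, h2⟩ := this
    exact ⟨s0, h1, fun s hs => h2 hs⟩
  have hfr : ∃ᶠ s in 𝓝[<] T, dist (X s) y < ρ :=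
    mapClusterPt_iff_frequently.mp hy _ (Metric.ball_mem_nhds y hρ.1)
  have hIoo : ∀ᶠ s in 𝓝[<] T, s ∈ Ioo s0 T := Ioo_mem_nhdsLT hs0
  obtain ⟨s1, h1, h1'⟩ := (hfr.and_eventually hIoo).exists
  filter_upwards [hIoo] with s hs
  refine lt_trans ?_ hρ.2
  by_contra hge
  have hge' : ρ < dist (X s) y := lt_of_le_of_ne (not_lt.mp hge) (hs0' s hs).1.symm
  have hconn := (isPreconnected_Ioo (a := s0) (b := T)).image (fun s => dist (X s) y) (by
    exact (continuous_id.dist continuous_const).comp_continuousOn (hXcont.mono fun r hr => ⟨(hs0' r hr).2, hr.2⟩))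
  have := hconn.ordConnected.out (mem_image_of_mem _ h1') (mem_image_of_mem _ hs)
    ⟨h1.le, hge'.le⟩
  obtain ⟨s2, h2, h2'⟩ := this
  exact (hs0' s2 h2).1 h2'

structure HalfPath (C : Set E) (f : E → ℝ) (p : E) (τ : ℝ) (y : E) (T : ℝ) (X : ℝ → E) : Prop where
  pos : 0 < T
  zero : X 0 = p
  sec : ∀ t < T, IsSec C f τ t X
  lim : Tendsto X (𝓝[<] T) (𝓝 y)

lemma HalfPath.limC {C : Set E} {f : E → ℝ} {p y : E} {τ T : ℝ} {X : ℝ → E}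
    (h : HalfPath C f p τ y T X) : Tendsto X (𝓝[<] T) (𝓝[C] y) := by
  refine tendsto_nhdsWithin_iff.mpr ⟨h.lim, ?_⟩
  filter_upwards [Ioo_mem_nhdsLT h.pos] with s hs
  exact (h.sec s hs.2).mem s ⟨hs.1.le, le_rfl⟩

lemma HalfPath.meet {C : Set E} {f : E → ℝ} {p p' y : E} {τ T τ' T' : ℝ} {X X' : ℝ → E}
    (H1 : ∀ y ∈ C, ∃ ε q, HasLocSec C f y ε q)
    (h : HalfPath C f p τ y T X) (h' : HalfPath C f p' τ' y T' X')
    (hτ : τ = 1 ∨ τ = -1) (hτ' : τ' = 1 ∨ τ' = -1) {s s' : ℝ} (hs : s ∈ Ioo 0 T)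
    (hs' : s' ∈ Ioo 0 T') (he : X s = X' s') : p = p' ∧ τ = τ' := by
  have e1 := (h.sec s hs.2).val s ⟨hs.1.le, le_rfl⟩
  have e2 := (h'.sec s' hs'.2).val s' ⟨hs'.1.le, le_rfl⟩
  rw [he, e2] at e1
  have p1 := hs.1
  have p2 := hs'.1
  have hττ : τ = τ' := by
    rcases hτ with rfl | rfl <;> rcases hτ' with rfl | rfl <;> first | rfl | (exfalso; linarith)
  subst hττ
  have hss : s' = s := by
    rcases hτ with rfl | rfl <;> linarith
  subst hss
  have := IsSec.uniq H1 (h.sec s' hs.2) (h'.sec s' hs'.2) ⟨hs.1.le, le_rfl⟩ he 0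
    ⟨le_rfl, hs.1.le⟩
  rw [h.zero, h'.zero] at this
  exact ⟨this, rfl⟩

lemma HalfPath.ivt {C : Set E} {f : E → ℝ} {p p' y : E} {τ T τ' T' : ℝ} {X X' : ℝ → E}
    (h' : HalfPath C f p' τ' y T' X') {u : E → ℝ}
    (hu0 : Tendsto u (𝓝[C] y) (𝓝 0)) (hup : ∀ x ∈ C, 0 < u x) (huc : ContinuousOn u C)
    {N : Set E} {s0' v : ℝ} (h0 : 0 < s0') (h0T : s0' < T')
    (hN : ∀ s ∈ Ico s0' T', X' s ∈ N) (hv : 0 < v) (hvle : v ≤ u (X' s0')) :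
    ∃ s' ∈ Ioo 0 T', X' s' ∈ N ∧ u (X' s') = v := by
  have h1 : ∀ᶠ s in 𝓝[<] T', u (X' s) < v := (hu0.comp h'.limC).eventually (Iio_mem_nhds hv)
  obtain ⟨s1, a1, a2⟩ := (h1.and (Ioo_mem_nhdsLT h0T)).exists
  have hc : ContinuousOn (fun s => u (X' s)) (Icc s0' s1) := by
    refine huc.comp ((h'.sec s1 a2.2).cont.mono (Icc_subset_Icc_left h0.le)) ?_
    intro s hs
    exact (h'.sec s1 a2.2).mem s ⟨h0.le.trans hs.1, hs.2⟩
  obtain ⟨s', b1, b2⟩ := intermediate_value_Icc' a2.1.le hc ⟨a1.le, hvle⟩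
  exact ⟨s', ⟨h0.trans_le b1.1, b1.2.trans_lt a2.2⟩, hN s' ⟨b1.1, b1.2.trans_lt a2.2⟩, b2⟩

theorem path_count {C L K : Set E} {f : E → ℝ} {B : ℝ} (hK : IsCompact K) (hCK : C ⊆ K)
    (hL : L.Finite) (hcl : closure C ⊆ C ∪ L) (hf : ContinuousOn f C) (hB : ∀ x ∈ C, |f x| ≤ B)
    (H1 : ∀ y ∈ C, ∃ ε q, HasLocSec C f y ε q)
    (H4 : ∀ y ∈ L,
      (Tendsto f (𝓝[C] y) (𝓝 (f y)) ∧ ∃ N ∈ 𝓝[C] y, InjOn f N) ∨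
      (∃ u : E → ℝ, Tendsto u (𝓝[C] y) (𝓝 0) ∧ (∀ x ∈ C, 0 < u x) ∧ ContinuousOn u C ∧
        ∃ N ∈ 𝓝[C] y, InjOn u N))
    (S : Finset E) (hS : ∀ p ∈ S, p ∈ C ∧ f p = 0) : 2 * S.card ≤ L.ncard := by
  classical
  have hex : ∀ q : S × Bool, ∃ (T : ℝ) (X : ℝ → E) (y : E), y ∈ L ∧
      HalfPath C f q.1.1 (if q.2 then 1 else -1) y T X := by
    intro q
    obtain ⟨T, X, y, a, b, c, d, e⟩ := exists_half_path hK hCK hL hcl hf hB H1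
      (hS q.1.1 q.1.2).1 (hS q.1.1 q.1.2).2 (τ := if q.2 then 1 else -1)
      (by cases q.2 <;> simp)
    exact ⟨T, X, y, d, a, b, c, e⟩
  choose T X y hyL hpath using hex
  have hinj : Function.Injective y := by
    intro q q' he
    have hτ : ∀ q : S × Bool, ((if q.2 then 1 else -1 : ℝ) = 1 ∨ (if q.2 then 1 else -1 : ℝ) = -1) := by
      intro q; cases q.2 <;> simp
    have h1 := hpath q
    have h2 := hpath q'
    rw [← he] at h2
    have key : ∃ s ∈ Ioo 0 (T q), ∃ s' ∈ Ioo 0 (T q'), X q s = X q' s' := by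
      rcases H4 _ (hyL q) with ⟨ht, N, hN, hinj⟩ | ⟨u, hu0, hup, huc, N, hN, hinj⟩
      · have val : ∀ (r : S × Bool), HalfPath C f r.1.1 (if r.2 then 1 else -1) (y q) (T r) (X r) →
            f (y q) = (if r.2 then 1 else -1) * T r := by
          intro r hr
          have a := ht.comp hr.limC
          have b : Tendsto (fun s : ℝ => (if r.2 then 1 else -1 : ℝ) * s) (𝓝[<] (T r))
              (𝓝 ((if r.2 then 1 else -1) * T r)) :=
            ((continuous_const.mul continuous_id).tendsto _).mono_left nhdsWithin_le_nhds
          refine tendsto_nhds_unique a (b.congr' ?_)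
          filter_upwards [Ioo_mem_nhdsLT hr.pos] with s hs
          exact ((hr.sec s hs.2).val s ⟨hs.1.le, le_rfl⟩).symm
        have e1 := val q h1
        have e2 := val q' h2
        have hT : T q = T q' ∧ (if q.2 then 1 else -1 : ℝ) = (if q'.2 then 1 else -1) := by
          have p1 := h1.pos
          have p2 := h2.pos
          rw [e1] at e2
          rcases hτ q with h | h <;> rcases hτ q' with h' | h' <;> rw [h, h'] at e2 ⊢ <;>
            constructor <;> linarith
        have ev := (h1.limC.eventually hN)
        have ev' := (h2.limC.eventually hN)
        rw [← hT.1] at ev'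
        obtain ⟨s, ⟨a, b⟩, hs⟩ := ((ev.and ev').and (Ioo_mem_nhdsLT h1.pos)).exists
        refine ⟨s, hs, s, by rw [← hT.1]; exact hs, hinj a b ?_⟩
        rw [(h1.sec s hs.2).val s ⟨hs.1.le, le_rfl⟩,
          (h2.sec s (hT.1 ▸ hs.2)).val s ⟨hs.1.le, le_rfl⟩, hT.2]
      · have start : ∀ (r : S × Bool), HalfPath C f r.1.1 (if r.2 then 1 else -1) (y q) (T r) (X r) →
            ∃ s0, 0 < s0 ∧ s0 < T r ∧ ∀ s ∈ Ico s0 (T r), X r s ∈ N := by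
          intro r hr
          have ev := (hr.limC.eventually hN).and (Ioo_mem_nhdsLT hr.pos)
          rw [Filter.Eventually, mem_nhdsLT_iff_exists_Ico_subset] at ev
          obtain ⟨s0, a, b⟩ := ev
          exact ⟨s0, (b ⟨le_rfl, a⟩).2.1, a, fun s hs => (b hs).1⟩
        obtain ⟨s0, a1, a2, a3⟩ := start q h1
        obtain ⟨s0', b1, b2, b3⟩ := start q' h2
        have c1 : X q s0 ∈ C := (h1.sec s0 a2).mem s0 ⟨a1.le, le_rfl⟩
        have c2 : X q' s0' ∈ C := (h2.sec s0' b2).mem s0' ⟨b1.le, le_rfl⟩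
        rcases le_total (u (X q s0)) (u (X q' s0')) with hle | hle
        · obtain ⟨s', d1, d2, d3⟩ := h2.ivt (p := q.1.1) (τ := 1) (T := 0) (X := X q) hu0 hup huc b1 b2 b3 (hup _ c1) hle
          exact ⟨s0, ⟨a1, a2⟩, s', d1, hinj (a3 s0 ⟨le_rfl, a2⟩) d2 d3.symm⟩
        · obtain ⟨s', d1, d2, d3⟩ := h1.ivt (p := q.1.1) (τ := 1) (T := 0) (X := X q) hu0 hup huc a1 a2 a3 (hup _ c2) hle
          exact ⟨s', d1, s0', ⟨b1, b2⟩, hinj d2 (b3 s0' ⟨le_rfl, b2⟩) d3⟩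
    obtain ⟨s, hs, s', hs', hX⟩ := key
    obtain ⟨r1, r2⟩ := HalfPath.meet H1 h1 h2 (hτ q) (hτ q') hs hs' hX
    refine Prod.ext (Subtype.ext r1) ?_
    cases h3 : q.2 <;> cases h4 : q'.2 <;> simp [h3, h4] at r2 ⊢ <;> linarith
  have hcard : Nat.card (S × Bool) ≤ Nat.card L := by
    have := hL.to_subtype
    exact Nat.card_le_card_of_injective (fun q => (⟨y q, hyL q⟩ : L))
      (fun a b h => hinj (by simpa using h))
  rw [Nat.card_prod, Nat.card_coe_set_eq] at hcard
  simp at hcard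
  omega

end Path
end Fewn

open Set Filter Topology

namespace Fewn

section LogSysA
open MvPolynomial
variable {l m : ℕ}

/-- Row vector as a continuous linear functional. -/
noncomputable def rowL (w : Fin l → ℝ) : (Fin l → ℝ) →L[ℝ] ℝ :=
  ∑ k, w k • ContinuousLinearMap.proj (R := ℝ) (φ := fun _ : Fin l => ℝ) k

lemma rowL_apply (w v : Fin l → ℝ) : rowL w v = ∑ k, w k * v k := by
  simp [rowL]

lemma rowL_add (w w' : Fin l → ℝ) : rowL (w + w') = rowL w + rowL w' := by
  ext; simp [rowL_apply, add_mul, Finset.sum_add_distrib]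

lemma rowL_smul (c : ℝ) (w : Fin l → ℝ) : rowL (c • w) = c • rowL w := by
  ext; simp [rowL_apply, Finset.mul_sum, mul_assoc]

lemma rowL_sum {ι : Type*} (s : Finset ι) (w : ι → Fin l → ℝ) :
    rowL (∑ i ∈ s, w i) = ∑ i ∈ s, rowL (w i) := by
  classical
  induction s using Finset.induction_on with
  | empty => ext; simp [rowL_apply]
  | insert a s ha ih => rw [Finset.sum_insert ha, Finset.sum_insert ha, rowL_add, ih]

lemma fderiv_det_of_rows {G : (Fin l → ℝ) → (Fin l → ℝ)} {x : Fin l → ℝ}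
    {J : Matrix (Fin l) (Fin l) ℝ} (h : ∀ i, HasFDerivAt (fun y => G y i) (rowL (J i)) x) :
    (fderiv ℝ G x).det = J.det := by
  have h1 : HasFDerivAt G (LinearMap.toContinuousLinearMap (Matrix.toLin' J)) x := by
    rw [hasFDerivAt_pi']
    intro i
    refine (h i).congr_fderiv ?_
    ext v
    simp [rowL_apply, Matrix.toLin'_apply, Matrix.mulVec, dotProduct]
  rw [h1.fderiv, ContinuousLinearMap.det]
  simp [LinearMap.det_toLin']

/-- affine forms -/
noncomputable def zf (A : Fin m → Fin l → ℝ) (e : Fin m → ℝ) (s : Fin m) (x : Fin l → ℝ) : ℝ :=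
  ∑ k, A s k * x k + e s

noncomputable def zP (A : Fin m → Fin l → ℝ) (e : Fin m → ℝ) (s : Fin m) :
    MvPolynomial (Fin l) ℝ := ∑ k, C (A s k) * X k + C (e s)

lemma eval_zP (A : Fin m → Fin l → ℝ) (e : Fin m → ℝ) (s : Fin m) (x : Fin l → ℝ) :
    eval x (zP A e s) = zf A e s x := by
  simp [zP, zf, map_sum]

lemma zP_deg (A : Fin m → Fin l → ℝ) (e : Fin m → ℝ) (s : Fin m) :
    (zP A e s).totalDegree ≤ 1 := by
  refine (totalDegree_add _ _).trans (max_le ?_ (by simp))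
  refine (totalDegree_finset_sum _ _).trans (Finset.sup_le fun k _ => ?_)
  refine (totalDegree_mul _ _).trans ?_
  simp

lemma zf_hasFDerivAt (A : Fin m → Fin l → ℝ) (e : Fin m → ℝ) (s : Fin m) (x : Fin l → ℝ) :
    HasFDerivAt (zf A e s) (rowL (A s)) x := by
  have : zf A e s = fun x => rowL (A s) x + e s := by
    ext x; simp [zf, rowL_apply]
  rw [this]
  exact (rowL (A s)).hasFDerivAt.add_const _

lemma zf_continuous (A : Fin m → Fin l → ℝ) (e : Fin m → ℝ) (s : Fin m) :
    Continuous (zf A e s) := by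
  unfold zf; fun_prop

lemma eval_hasFDerivAt (q : MvPolynomial (Fin l) ℝ) (x : Fin l → ℝ) :
    HasFDerivAt (fun y => eval y q) (rowL fun k => eval x (pderiv k q)) x := by
  induction q using MvPolynomial.induction_on with
  | C a =>
    simp only [eval_C, pderiv_C, map_zero]
    have : rowL (fun _ : Fin l => (0:ℝ)) = 0 := by ext; simp [rowL_apply]
    rw [this]
    exact hasFDerivAt_const _ _
  | add p q hp hq =>
    simp only [map_add]
    have := hp.add hq
    rw [← rowL_add] at this
    exact this
  | mul_X p i hp =>
    simp only [map_mul, eval_X]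
    have := hp.mul (ContinuousLinearMap.proj (R := ℝ) (φ := fun _ : Fin l => ℝ) i).hasFDerivAt
    refine this.congr_fderiv ?_
    ext v
    simp only [rowL_apply, Derivation.leibniz, pderiv_X, map_add, smul_eq_mul, map_mul, eval_X,
      ContinuousLinearMap.add_apply, ContinuousLinearMap.smul_apply, ContinuousLinearMap.proj_apply]
    rw [Finset.mul_sum]
    rw [show (eval x) p * v i = ∑ k, (eval x) p * (if k = i then v k else 0) by simp]
    rw [← Finset.sum_add_distrib]
    refine Finset.sum_congr rfl fun k _ => ?_
    by_cases hk : k = i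
    · subst hk; simp; ring
    · simp [hk, Pi.single_apply, Ne.symm hk]; ring

/-- logarithmic form -/
noncomputable def lf (A : Fin m → Fin l → ℝ) (e : Fin m → ℝ) (w : Fin m → ℝ) (x : Fin l → ℝ) : ℝ :=
  ∑ s, w s * Real.log (zf A e s x)

/-- the system with `j` logarithmic slots. -/
noncomputable def LG (j : ℕ) (A : Fin m → Fin l → ℝ) (e : Fin m → ℝ) (β : Fin l → Fin m → ℝ)
    (b : Fin l → ℝ) (P : Fin l → MvPolynomial (Fin l) ℝ) (x : Fin l → ℝ) (i : Fin l) : ℝ :=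
  if (i : ℕ) < j then lf A e (β i) x - b i else eval x (P i)

def Dl (A : Fin m → Fin l → ℝ) (e : Fin m → ℝ) : Set (Fin l → ℝ) := {x | ∀ s, 0 < zf A e s x}

lemma Dl_isOpen (A : Fin m → Fin l → ℝ) (e : Fin m → ℝ) : IsOpen (Dl A e) := by
  simp only [Dl, setOf_forall]
  exact isOpen_iInter_of_finite fun s => isOpen_lt continuous_const (zf_continuous A e s)

lemma lf_hasFDerivAt {A : Fin m → Fin l → ℝ} {e : Fin m → ℝ} (w : Fin m → ℝ) {x : Fin l → ℝ}
    (hx : x ∈ Dl A e) :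
    HasFDerivAt (lf A e w) (rowL (∑ s, (w s / zf A e s x) • A s)) x := by
  rw [rowL_sum]
  unfold lf
  refine HasFDerivAt.fun_sum fun s _ => ?_
  have := ((zf_hasFDerivAt A e s x).log (hx s).ne').const_mul (w s)
  refine this.congr_fderiv ?_
  rw [rowL_smul, smul_smul, div_eq_mul_inv]

/-- Jacobian matrix of `LG`. -/
noncomputable def JM (j : ℕ) (A : Fin m → Fin l → ℝ) (e : Fin m → ℝ) (β : Fin l → Fin m → ℝ)
    (P : Fin l → MvPolynomial (Fin l) ℝ) (x : Fin l → ℝ) : Matrix (Fin l) (Fin l) ℝ :=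
  fun i => if (i : ℕ) < j then ∑ s, (β i s / zf A e s x) • A s else fun k => eval x (pderiv k (P i))

lemma LG_row {j : ℕ} {A : Fin m → Fin l → ℝ} {e : Fin m → ℝ} {β : Fin l → Fin m → ℝ}
    {b : Fin l → ℝ} {P : Fin l → MvPolynomial (Fin l) ℝ} {x : Fin l → ℝ} (hx : x ∈ Dl A e)
    (i : Fin l) : HasFDerivAt (fun y => LG j A e β b P y i) (rowL (JM j A e β P x i)) x := by
  by_cases h : (i : ℕ) < j
  · simp only [LG, JM, h, if_true]
    exact (lf_hasFDerivAt (β i) hx).sub_const _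
  · simp only [LG, JM, h, if_false]
    exact eval_hasFDerivAt (P i) x

lemma LG_det {j : ℕ} {A : Fin m → Fin l → ℝ} {e : Fin m → ℝ} {β : Fin l → Fin m → ℝ}
    {b : Fin l → ℝ} {P : Fin l → MvPolynomial (Fin l) ℝ} {x : Fin l → ℝ} (hx : x ∈ Dl A e) :
    (fderiv ℝ (LG j A e β b P) x).det = (JM j A e β P x).det :=
  fderiv_det_of_rows fun i => LG_row hx i

/-- admissible slot choices: first `j` slots choose distinct forms. -/
def adm (j : ℕ) (r : Fin l → Option (Fin m)) : Prop :=
  (∀ i : Fin l, (r i).isSome ↔ (i : ℕ) < j) ∧ ∀ i i' s, r i = some s → r i' = some s → i = i'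

/-- mixed polynomial system -/
noncomputable def mixP (A : Fin m → Fin l → ℝ) (e : Fin m → ℝ) (P : Fin l → MvPolynomial (Fin l) ℝ)
    (r : Fin l → Option (Fin m)) (i : Fin l) : MvPolynomial (Fin l) ℝ :=
  match r i with
  | some s => zP A e s
  | none => P i

noncomputable def mixJ (A : Fin m → Fin l → ℝ) (P : Fin l → MvPolynomial (Fin l) ℝ)
    (r : Fin l → Option (Fin m)) : Matrix (Fin l) (Fin l) (MvPolynomial (Fin l) ℝ) :=
  fun i k => match r i with
  | some s => C (A s k)
  | none => pderiv k (P i)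

open Classical in
/-- The polynomial `∏ ζ · Jac`. -/
noncomputable def hatP (j : ℕ) (A : Fin m → Fin l → ℝ) (e : Fin m → ℝ) (β : Fin l → Fin m → ℝ)
    (P : Fin l → MvPolynomial (Fin l) ℝ) : MvPolynomial (Fin l) ℝ :=
  ∑ r : Fin l → Option (Fin m), if adm j r then
    C (∏ i, match r i with | some s => β i s | none => 1) *
    (∏ s ∈ Finset.univ.filter (fun s => ∀ i, r i ≠ some s), zP A e s) * (mixJ A P r).det else 0

lemma pderiv_deg (q : MvPolynomial (Fin l) ℝ) (k : Fin l) {d : ℕ} (h : q.totalDegree ≤ d) :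
    (pderiv k q).totalDegree ≤ d - 1 := by
  rw [q.as_sum, map_sum]
  refine (totalDegree_finset_sum _ _).trans (Finset.sup_le fun u hu => ?_)
  rw [pderiv_monomial]
  by_cases h0 : u k = 0
  · simp [h0]
  refine (totalDegree_monomial_le _ _).trans ?_
  have h1 : (u - Finsupp.single k 1).degree + 1 = u.degree := by
    have h2 : u - Finsupp.single k 1 + Finsupp.single k 1 = u := by
      ext i
      by_cases hi : i = k
      · subst hi; simp; omega
      · simp [Finsupp.single_apply, Ne.symm hi]
    conv_rhs => rw [← h2]
    rw [map_add, Finsupp.degree_single]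
  have h2 := (le_totalDegree hu).trans h
  have h3 : (u.sum fun _ e => e) = u.degree := rfl
  have h4 : ((u - Finsupp.single k 1).sum fun _ e => e) = (u - Finsupp.single k 1).degree := rfl
  rw [h3] at h2
  change (u - Finsupp.single k 1).degree ≤ d - 1
  omega

lemma det_deg (M : Matrix (Fin l) (Fin l) (MvPolynomial (Fin l) ℝ)) (d : Fin l → ℕ)
    (h : ∀ i k, (M i k).totalDegree ≤ d i) : M.det.totalDegree ≤ ∑ i, d i := by
  rw [← Matrix.det_transpose, Matrix.det_apply]
  refine (totalDegree_finset_sum _ _).trans (Finset.sup_le fun σ _ => ?_)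
  refine (totalDegree_smul_le _ _).trans ?_
  refine (totalDegree_finsetProd _ _).trans ?_
  exact Finset.sum_le_sum fun i _ => h _ _

lemma hatP_deg (j : ℕ) (hj : j ≤ l) (A : Fin m → Fin l → ℝ) (e : Fin m → ℝ) (β : Fin l → Fin m → ℝ)
    (P : Fin l → MvPolynomial (Fin l) ℝ) (d : Fin l → ℕ) (hd : ∀ i, 1 ≤ d i)
    (hP : ∀ i : Fin l, j ≤ (i : ℕ) → (P i).totalDegree ≤ d i) :
    (hatP j A e β P).totalDegree + l ≤ m + ∑ i : Fin l, (if j ≤ (i : ℕ) then d i else 0) ∨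
      hatP j A e β P = 0 := by
  classical
  have hterm : ∀ r : Fin l → Option (Fin m), adm j r →
     ((C (∏ i, match r i with | some s => β i s | none => 1) *
    (∏ s ∈ Finset.univ.filter (fun s => ∀ i, r i ≠ some s), zP A e s) * (mixJ A P r).det :
      MvPolynomial (Fin l) ℝ)).totalDegree + l ≤ m + ∑ i : Fin l, (if j ≤ (i : ℕ) then d i else 0) := by
    intro r hr
    have h1 : (mixJ A P r).det.totalDegree ≤ ∑ i : Fin l, (if j ≤ (i : ℕ) then d i - 1 else 0) := by
      refine det_deg _ _ fun i k => ?_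
      unfold mixJ
      have := hr.1 i
      cases hri : r i with
      | none =>
        rw [hri] at this
        have hji : j ≤ (i : ℕ) := by simpa using this
        simpa [hji] using pderiv_deg (P i) k (hP i hji)
      | some s => simp
    have h2 : (∏ s ∈ Finset.univ.filter (fun s => ∀ i, r i ≠ some s), zP A e s).totalDegree
        ≤ (Finset.univ.filter (fun s : Fin m => ∀ i, r i ≠ some s)).card := by
      refine (totalDegree_finsetProd _ _).trans ?_
      rw [Finset.card_eq_sum_ones]
      exact Finset.sum_le_sum fun s _ => zP_deg A e s
    -- count
    have h3 : (Finset.univ.filter (fun s : Fin m => ∀ i, r i ≠ some s)).card +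
        (Finset.univ.filter (fun i : Fin l => (i : ℕ) < j)).card ≤ m := by
      have hinj : (Finset.univ.filter (fun i : Fin l => (i : ℕ) < j)).card ≤
          (Finset.univ.filter (fun s : Fin m => ¬ ∀ i, r i ≠ some s)).card := by
        have hs : ∀ i : Fin l, (i : ℕ) < j → ∃ s, r i = some s := fun i hi =>
          Option.isSome_iff_exists.mp ((hr.1 i).mpr hi)
        refine Finset.card_le_card_of_forall_subsingleton (fun i s => r i = some s) ?_ ?_
        · intro i hi
          obtain ⟨s, hs⟩ := hs i (by simpa using hi)
          refine ⟨s, ?_, hs⟩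
          simp only [Finset.mem_filter, Finset.mem_univ, true_and]
          push Not
          exact ⟨i, hs⟩
        · intro s _ i hi i' hi'
          exact hr.2 i i' s hi.2 hi'.2
      have := Finset.card_filter_add_card_filter_not (s := (Finset.univ : Finset (Fin m)))
        (fun s => ∀ i, r i ≠ some s)
      simp only [Finset.card_univ, Fintype.card_fin] at this
      omega
    have h4 : ∑ i : Fin l, (if j ≤ (i : ℕ) then d i - 1 else 0) + l =
        ∑ i : Fin l, (if j ≤ (i : ℕ) then d i else 0) +
        (Finset.univ.filter (fun i : Fin l => (i : ℕ) < j)).card := by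
      have h0 : ∑ i : Fin l, 1 = l := by simp
      refine (congrArg (fun t => ∑ i : Fin l, (if j ≤ (i : ℕ) then d i - 1 else 0) + t) h0).symm.trans ?_
      rw [Finset.card_filter, ← Finset.sum_add_distrib, ← Finset.sum_add_distrib]
      refine Finset.sum_congr rfl fun i _ => ?_
      have := hd i
      by_cases h : j ≤ (i : ℕ)
      · have h9 : ¬ (i : ℕ) < j := by omega
        simp [h, h9]; omega
      · simp [h]
    have h5 : (C (∏ i, match r i with | some s => β i s | none => 1) *
        (∏ s ∈ Finset.univ.filter (fun s => ∀ i, r i ≠ some s), zP A e s) * (mixJ A P r).det :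
        MvPolynomial (Fin l) ℝ).totalDegree ≤
        0 + (∏ s ∈ Finset.univ.filter (fun s => ∀ i, r i ≠ some s), zP A e s).totalDegree +
        (mixJ A P r).det.totalDegree := by
      refine (totalDegree_mul _ _).trans (Nat.add_le_add_right ?_ _)
      refine (totalDegree_mul _ _).trans (Nat.add_le_add_right ?_ _)
      exact (totalDegree_C _).le
    omega
  by_cases hex : ∃ r : Fin l → Option (Fin m), adm j r
  · left
    obtain ⟨r0, hr0⟩ := hex
    have hbig : l ≤ m + ∑ i : Fin l, (if j ≤ (i : ℕ) then d i else 0) := by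
      have := hterm r0 hr0; omega
    have : (hatP j A e β P).totalDegree ≤ m + ∑ i : Fin l, (if j ≤ (i : ℕ) then d i else 0) - l := by
      unfold hatP
      refine (totalDegree_finset_sum _ _).trans (Finset.sup_le fun r _ => ?_)
      by_cases hr : adm j r
      · rw [if_pos hr]
        have := hterm r hr; omega
      · rw [if_neg hr]; simp
    omega
  · right
    push Not at hex
    unfold hatP
    refine Finset.sum_eq_zero fun r _ => ?_
    rw [if_neg (hex r)]

lemma hatP_eval (j : ℕ) {A : Fin m → Fin l → ℝ} {e : Fin m → ℝ} (β : Fin l → Fin m → ℝ)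
    (P : Fin l → MvPolynomial (Fin l) ℝ) {x : Fin l → ℝ} (hx : ∀ s, zf A e s x ≠ 0) :
    eval x (hatP j A e β P) = (∏ s, zf A e s x) * (JM j A e β P x).det := by
  classical
  let g : Fin l → Option (Fin m) → Fin l → ℝ := fun i o =>
    match o with
    | some s => (β i s / zf A e s x) • A s
    | none => fun k => eval x (pderiv k (P i))
  let T : Fin l → Finset (Option (Fin m)) := fun i =>
    if (i : ℕ) < j then Finset.univ.image some else {none}
  have hJ : JM j A e β P x = fun i => ∑ o ∈ T i, g i o := by
    funext i
    unfold JM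
    by_cases h : (i : ℕ) < j
    · simp only [h, T, if_true]
      rw [Finset.sum_image (by intro a _ b _ h; exact Option.some_injective _ h)]
    · simp only [h, T, if_false, Finset.sum_singleton, g]
  have hdet : (JM j A e β P x).det = ∑ r ∈ Fintype.piFinset T, (Matrix.of fun i => g i (r i)).det := by
    rw [hJ]
    exact (Matrix.detRowAlternating (R := ℝ) (n := Fin l)).toMultilinearMap.map_sum_finset g T
  have hmem : ∀ r : Fin l → Option (Fin m), r ∈ Fintype.piFinset T ↔
      ∀ i : Fin l, (r i).isSome ↔ (i : ℕ) < j := by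
    intro r
    rw [Fintype.mem_piFinset]
    refine forall_congr' fun i => ?_
    by_cases h : (i : ℕ) < j
    · simp only [T, h, if_true, iff_true]
      cases hr : r i <;> simp
    · simp only [T, h, if_false, iff_false]
      cases hr : r i <;> simp
  rw [hdet, hatP, map_sum, Finset.mul_sum]
  rw [← Finset.sum_filter_add_sum_filter_not Finset.univ (fun r => r ∈ Fintype.piFinset T)]
  rw [Finset.filter_mem_eq_inter, Finset.univ_inter]
  have hz : ∑ r ∈ Finset.univ.filter (fun r => ¬ r ∈ Fintype.piFinset T), eval x (if adm j r then
    C (∏ i, match r i with | some s => β i s | none => 1) *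
    (∏ s ∈ Finset.univ.filter (fun s => ∀ i, r i ≠ some s), zP A e s) * (mixJ A P r).det else 0) = 0 := by
    refine Finset.sum_eq_zero fun r hr => ?_
    rw [if_neg, map_zero]
    intro h
    exact (Finset.mem_filter.mp hr).2 ((hmem r).mpr h.1)
  rw [hz, add_zero]
  refine Finset.sum_congr rfl fun r hr => ?_
  have hr1 := (hmem r).mp hr
  by_cases hinj : ∀ i i' s, r i = some s → r i' = some s → i = i'
  · rw [if_pos ⟨hr1, hinj⟩, map_mul, map_mul, eval_C, map_prod]
    simp only [eval_zP]
    have hmix : (Matrix.of fun i => g i (r i)).det =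
        (∏ i, match r i with | some s => β i s / zf A e s x | none => 1) *
          eval x (mixJ A P r).det := by
      rw [RingHom.map_det, ← Matrix.det_mul_column]
      congr 1
      ext i k
      simp only [Matrix.of_apply, g, mixJ, RingHom.mapMatrix_apply, Matrix.map_apply]
      cases r i <;> simp
    rw [hmix, ← mul_assoc]
    congr 1
    rw [← Finset.prod_filter_mul_prod_filter_not Finset.univ (fun s => ∀ i, r i ≠ some s)
      (fun s => zf A e s x)]
    have h6 : (∏ i, match r i with | some s => β i s / zf A e s x | none => 1) =
        (∏ i, match r i with | some s => β i s | none => 1) *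
        (∏ s ∈ Finset.univ.filter (fun s => ¬ ∀ i, r i ≠ some s), zf A e s x)⁻¹ := by
      have h7 : ∏ s ∈ Finset.univ.filter (fun s => ¬ ∀ i, r i ≠ some s), zf A e s x =
          ∏ i, match r i with | some s => zf A e s x | none => 1 := by
        have h8 : ∏ i, (match r i with | some s => zf A e s x | none => 1) =
            ∏ i ∈ Finset.univ.filter (fun i => (r i).isSome),
              (match r i with | some s => zf A e s x | none => 1) := by
          rw [Finset.prod_filter]
          refine Finset.prod_congr rfl fun i _ => ?_
          cases r i <;> simp
        rw [h8]
        symm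
        refine Finset.prod_bij (fun i hi => (r i).get (by simpa using hi)) ?_ ?_ ?_ ?_
        · intro i hi
          simp only [Finset.mem_filter, Finset.mem_univ, true_and]
          push Not
          exact ⟨i, by simp⟩
        · intro i hi i' hi' h
          refine hinj i i' ((r i).get (by simpa using hi)) (by simp) ?_
          rw [h]; simp
        · intro s hs
          simp only [Finset.mem_filter, Finset.mem_univ, true_and] at hs
          push Not at hs
          obtain ⟨i, hi⟩ := hs
          exact ⟨i, by simp [hi], by simp [hi]⟩
        · intro i hi
          have : (r i).isSome := by simpa using hi
          obtain ⟨s, hs⟩ := Option.isSome_iff_exists.mp this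
          simp [hs]
      rw [h7, ← Finset.prod_inv_distrib, ← Finset.prod_mul_distrib]
      refine Finset.prod_congr rfl fun i _ => ?_
      cases r i <;> simp [div_eq_mul_inv]
    rw [h6]
    have hne : (∏ s ∈ Finset.univ.filter (fun s => ¬ ∀ i, r i ≠ some s), zf A e s x) ≠ 0 :=
      Finset.prod_ne_zero_iff.mpr fun s _ => hx s
    field_simp
  · rw [if_neg (fun h => hinj h.2), map_zero]
    push Not at hinj
    obtain ⟨i, i', s, h1, h2, hne⟩ := hinj
    have : (Matrix.of fun i => g i (r i)).det = 0 := by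
      by_cases hzz : β i s = 0
      · apply Matrix.det_eq_zero_of_row_eq_zero i
        intro k
        simp [g, h1, hzz]
      · by_contra hd
        have hlin := Matrix.linearIndependent_rows_of_det_ne_zero hd
        rw [Fintype.linearIndependent_iff] at hlin
        have := hlin (fun t => if t = i then β i' s else if t = i' then - β i s else 0) (by
          ext k
          rw [Finset.sum_apply, Finset.sum_eq_add i i' hne]
          · simp [Matrix.row, g, h1, h2, Ne.symm hne]; ring
          · intro c _ hc; simp [hc.1, hc.2]
          · simp
          · simp) i'
        simp [Ne.symm hne, hzz] at this
    rw [this, mul_zero]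

end LogSysA
end Fewn

open Set Filter Topology

namespace Fewn

section LogSysB
open MvPolynomial
variable {l m : ℕ}

lemma strict_anti {E : Type*} [NormedAddCommGroup E] [NormedSpace ℝ E] [FiniteDimensional ℝ E]
    {G : E → E} {x : E} (h : ContDiffAt ℝ 1 G x) (hd : (fderiv ℝ G x).det ≠ 0) :
    ∃ K : ℝ, 0 < K ∧ ∃ N ∈ 𝓝 x, ∀ a ∈ N, ∀ b ∈ N, ‖a - b‖ ≤ K * ‖G a - G b‖ := by
  have hs := h.hasStrictFDerivAt (by norm_num)
  obtain ⟨e, he⟩ := isInvertible_of_det_ne_zero hd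
  rw [← he] at hs
  obtain ⟨K0, hK0, hb⟩ : ∃ K0 : ℝ, 0 < K0 ∧ ∀ v, ‖v‖ ≤ K0 * ‖e v‖ := by
    refine ⟨‖(e.symm : E →L[ℝ] E)‖ + 1, by positivity, fun v => ?_⟩
    have h1 := (e.symm : E →L[ℝ] E).le_opNorm (e v)
    simp at h1
    nlinarith [norm_nonneg (e v)]
  have hc : (0:ℝ) < 1 / (2 * K0) := by positivity
  have := hs.isLittleO.def hc
  rw [nhds_prod_eq, Filter.Eventually, mem_prod_same_iff] at this
  obtain ⟨N, hN, hsub⟩ := this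
  refine ⟨2 * K0, by positivity, N, hN, fun a ha b hb' => ?_⟩
  have h2 := hsub (mk_mem_prod ha hb')
  simp only [mem_setOf_eq] at h2
  have h3 := hb (a - b)
  have h4 : ‖e (a - b)‖ ≤ ‖G a - G b‖ + 1 / (2 * K0) * ‖a - b‖ := by
    have : e (a - b) = (G a - G b) - (G a - G b - e (a - b)) := by abel
    rw [this]
    exact (norm_sub_le _ _).trans (add_le_add le_rfl h2)
  have h5 : K0 * ‖e (a - b)‖ ≤ K0 * ‖G a - G b‖ + 1 / 2 * ‖a - b‖ := by
    calc K0 * ‖e (a - b)‖ ≤ K0 * (‖G a - G b‖ + 1 / (2 * K0) * ‖a - b‖) := by gcongr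
      _ = _ := by field_simp
  linarith

lemma loc_inv {E : Type*} [NormedAddCommGroup E] [NormedSpace ℝ E] [FiniteDimensional ℝ E]
    {G : E → E} {x : E} (h : ContDiffAt ℝ 1 G x) (hd : (fderiv ℝ G x).det ≠ 0) :
    ∃ (g : E → E) (V : Set E), IsOpen V ∧ G x ∈ V ∧ ContinuousOn g V ∧ g (G x) = x ∧
      (∀ z ∈ V, G (g z) = z) ∧ ∀ᶠ a in 𝓝 x, g (G a) = a := by
  have : CompleteSpace E := FiniteDimensional.complete ℝ E
  have hs := h.hasStrictFDerivAt (by norm_num)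
  obtain ⟨e, he⟩ := isInvertible_of_det_ne_zero hd
  rw [← he] at hs
  let φ := hs.toOpenPartialHomeomorph G
  have hφ : ∀ z, φ z = G z := fun z => rfl
  have hx : x ∈ φ.source := hs.mem_toOpenPartialHomeomorph_source
  refine ⟨φ.symm, φ.target, φ.open_target, φ.map_source hx, φ.continuousOn_symm, φ.left_inv hx,
    fun z hz => φ.right_inv hz, ?_⟩
  filter_upwards [φ.open_source.mem_nhds hx] with a ha
  exact φ.left_inv ha

lemma abs_sec {G : (Fin l → ℝ) → (Fin l → ℝ)} {D0 : Set (Fin l → ℝ)} (hD0 : IsOpen D0)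
    (jj : Fin l) {y : Fin l → ℝ} (hy : y ∈ D0) (hyC : ∀ i, i ≠ jj → G y i = 0)
    (hG : ContDiffAt ℝ 1 G y) (hd : (fderiv ℝ G y).det ≠ 0) :
    ∃ ε q, HasLocSec {x | x ∈ D0 ∧ ∀ i, i ≠ jj → G x i = 0}
      (fun x => Real.arctan (G x jj)) y ε q := by
  obtain ⟨g, V, hV, hyV, hgc, hgy, hgr, hgl⟩ := loc_inv hG hd
  let ψ : ℝ → (Fin l → ℝ) := fun t => Function.update (G y) jj (Real.tan t)
  let I : Set ℝ := Ioo (-(Real.pi / 2)) (Real.pi / 2)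
  have hψ : ContinuousOn ψ I := by
    have : ContinuousOn Real.tan I := Real.continuousOn_tan_Ioo
    exact ((continuous_const (y := G y)).update jj continuous_id).comp_continuousOn this
  have hψy : ψ (Real.arctan (G y jj)) = G y := by simp [ψ, Real.tan_arctan]
  have hIo : IsOpen I := isOpen_Ioo
  have h1 : IsOpen (I ∩ ψ ⁻¹' V) := hψ.isOpen_inter_preimage hIo hV
  have hc2 : ContinuousOn (fun t => g (ψ t)) (I ∩ ψ ⁻¹' V) :=
    hgc.comp (hψ.mono inter_subset_left) fun t ht => ht.2
  have h2 : IsOpen ((I ∩ ψ ⁻¹' V) ∩ (fun t => g (ψ t)) ⁻¹' D0) := hc2.isOpen_inter_preimage h1 hD0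
  have hmem : Real.arctan (G y jj) ∈ (I ∩ ψ ⁻¹' V) ∩ (fun t => g (ψ t)) ⁻¹' D0 := by
    refine ⟨⟨Real.arctan_mem_Ioo _, ?_⟩, ?_⟩
    · simp only [mem_preimage, hψy]; exact hyV
    · simp only [mem_preimage, hψy, hgy]; exact hy
  obtain ⟨ε, hε, hball⟩ := Metric.isOpen_iff.mp h2 _ hmem
  refine ⟨ε, fun t => g (ψ t), ⟨hε, ?_, ?_, ?_, ?_, ?_⟩⟩
  · exact hc2.mono fun t ht => (hball ht).1
  · intro t ht
    refine ⟨(hball ht).2, fun i hi => ?_⟩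
    rw [hgr _ (hball ht).1.2]
    simp only [ψ, Function.update_of_ne hi]
    exact hyC i hi
  · intro t ht
    change Real.arctan (G (g (ψ t)) jj) = t
    rw [hgr _ (hball ht).1.2]
    simp only [ψ, Function.update_self]
    exact Real.arctan_tan (hball ht).1.1.1 (hball ht).1.1.2
  · simp only [hψy, hgy]
  · have := hgl.filter_mono (nhdsWithin_le_nhds (s := {x | x ∈ D0 ∧ ∀ i, i ≠ jj → G x i = 0}))
    filter_upwards [this, self_mem_nhdsWithin] with x hx hxC
    have : ψ (Real.arctan (G x jj)) = G x := by
      ext i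
      by_cases hi : i = jj
      · subst hi; simp [ψ, Real.tan_arctan]
      · simp only [ψ, Function.update_of_ne hi]
        rw [hyC i hi, hxC.2 i hi]
    rw [this, hx]

lemma abs_inj {G : (Fin l → ℝ) → (Fin l → ℝ)} {D0 : Set (Fin l → ℝ)}
    (jj : Fin l) {y : Fin l → ℝ}
    (hG : ContDiffAt ℝ 1 G y) (hd : (fderiv ℝ G y).det ≠ 0) :
    Tendsto (fun x => Real.arctan (G x jj)) (𝓝[{x | x ∈ D0 ∧ ∀ i, i ≠ jj → G x i = 0}] y)
      (𝓝 (Real.arctan (G y jj))) ∧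
    ∃ N ∈ 𝓝[{x | x ∈ D0 ∧ ∀ i, i ≠ jj → G x i = 0}] y,
      InjOn (fun x => Real.arctan (G x jj)) N := by
  constructor
  · have h1 : ContinuousAt (fun x => Real.arctan (G x jj)) y :=
      Real.continuous_arctan.continuousAt.comp
        ((continuous_apply jj).continuousAt.comp hG.continuousAt)
    exact h1.tendsto.mono_left nhdsWithin_le_nhds
  · obtain ⟨K, hK, N, hN, h⟩ := strict_anti hG hd
    refine ⟨N ∩ {x | x ∈ D0 ∧ ∀ i, i ≠ jj → G x i = 0}, ?_, ?_⟩
    · exact inter_mem (mem_nhdsWithin_of_mem_nhds hN) self_mem_nhdsWithin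
    · intro a ha b hb hab
      have : G a = G b := by
        ext i
        by_cases hi : i = jj
        · subst hi; exact Real.arctan_injective hab
        · rw [ha.2.2 i hi, hb.2.2 i hi]
      have := h a ha.1 b hb.1
      rw [‹G a = G b›] at this
      simp at this
      exact sub_eq_zero.mp this

lemma LG_contDiffAt {j : ℕ} {A : Fin m → Fin l → ℝ} {e : Fin m → ℝ} {β : Fin l → Fin m → ℝ}
    {b : Fin l → ℝ} {P : Fin l → MvPolynomial (Fin l) ℝ} {x : Fin l → ℝ} (hx : x ∈ Dl A e) :
    ContDiffAt ℝ 1 (LG j A e β b P) x := by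
  rw [contDiffAt_pi]
  intro i
  unfold LG
  by_cases h : (i : ℕ) < j
  · simp only [h, if_true]
    unfold lf
    refine ContDiffAt.sub (ContDiffAt.sum fun s _ => ?_) contDiffAt_const
    refine contDiffAt_const.mul (ContDiffAt.log ?_ (hx s).ne')
    unfold zf; fun_prop
  · simp only [h, if_false]
    exact (contDiff_eval (P i)).contDiffAt

/-- genericity condition G1 -/
def GenA (j : ℕ) (β : Fin l → Fin m → ℝ) : Prop :=
  ∀ I : Finset (Fin m), I.card ≤ j → ∀ w : Fin m → ℝ, (∀ s, s ∉ I → w s = 0) →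
    (∀ i : Fin l, (i : ℕ) < j → ∑ s, β i s * w s = 0) → w = 0

lemma GenA.bound {j : ℕ} {β : Fin l → Fin m → ℝ} (h : GenA j β) (I : Finset (Fin m))
    (hI : I.card ≤ j) : ∃ c : ℝ, 0 < c ∧ ∀ w : Fin m → ℝ, (∀ s, s ∉ I → w s = 0) →
      ∀ B : ℝ, 0 ≤ B → (∀ i : Fin l, (i : ℕ) < j → |∑ s, β i s * w s| ≤ B) → ‖w‖ ≤ c * B := by
  let W : Submodule ℝ (Fin m → ℝ) :=
    { carrier := {w | ∀ s, s ∉ I → w s = 0}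
      add_mem' := by intro a b ha hb s hs; simp [ha s hs, hb s hs]
      zero_mem' := by intro s hs; rfl
      smul_mem' := by intro c a ha s hs; simp [ha s hs] }
  let T0 : (Fin m → ℝ) →ₗ[ℝ] (Fin l → ℝ) :=
    { toFun := fun w i => if (i : ℕ) < j then ∑ s, β i s * w s else 0
      map_add' := by
        intro a b; ext i; by_cases hi : (i : ℕ) < j
        · simp [hi, mul_add, Finset.sum_add_distrib]
        · simp [hi]
      map_smul' := by
        intro c a; ext i; by_cases hi : (i : ℕ) < j
        · simp [hi, Finset.mul_sum, mul_left_comm]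
        · simp [hi] }
  let T := T0.domRestrict W
  have hker : LinearMap.ker T = ⊥ := by
    rw [LinearMap.ker_eq_bot']
    intro w hw
    apply Subtype.ext
    refine h I hI w.1 w.2 fun i hi => ?_
    have := congrFun hw i
    simpa [T, T0, hi] using this
  obtain ⟨K, hK, hKT⟩ := T.exists_antilipschitzWith hker
  refine ⟨K, hK, fun w hw B hB hb => ?_⟩
  have h1 := hKT.le_mul_dist ⟨w, hw⟩ 0
  rw [map_zero, dist_zero_right, dist_zero_right] at h1
  refine (show ‖w‖ ≤ K * ‖T ⟨w, hw⟩‖ from h1).trans ?_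
  gcongr
  rw [pi_norm_le_iff_of_nonneg hB]
  intro i
  by_cases hi : (i : ℕ) < j
  · simpa [T, T0, hi] using hb i hi
  · simpa [T, T0, hi] using hB

end LogSysB
end Fewn

open Set Filter Topology

namespace Fewn

section LogSysC
open MvPolynomial
variable {l m : ℕ}

lemma exists_adm {j : ℕ} (I : Finset (Fin m)) (hI : I.card = j) :
    ∃ r : Fin l → Option (Fin m), adm j r ∧ (j ≤ l → ∀ s, s ∈ I → ∃ i, r i = some s) ∧
      ∀ i s, r i = some s → s ∈ I := by
  refine ⟨fun i => if h : (i : ℕ) < j then some (I.orderEmbOfFin hI ⟨i, h⟩) else none,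
    ⟨fun i => ?_, ?_⟩, ?_, ?_⟩
  · by_cases h : (i : ℕ) < j <;> simp [h]
  · intro i i' s h1 h2
    by_cases h : (i : ℕ) < j
    · by_cases h' : (i' : ℕ) < j
      · simp only [h, h', dif_pos, Option.some.injEq] at h1 h2
        have := (I.orderEmbOfFin hI).injective (h1.trans h2.symm)
        simp only [Fin.mk.injEq] at this
        exact Fin.ext this
      · simp [h'] at h2
    · simp [h] at h1
  · intro hjl s hs
    have : s ∈ Set.range (I.orderEmbOfFin hI) := by
      rw [Finset.range_orderEmbOfFin]; exact hs
    obtain ⟨t, ht⟩ := this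
    refine ⟨⟨t, t.2.trans_le hjl⟩, ?_⟩
    simp [ht]
  · intro i s h1
    by_cases h : (i : ℕ) < j
    · simp only [h, dif_pos, Option.some.injEq] at h1
      rw [← h1]
      exact Finset.orderEmbOfFin_mem I hI _
    · simp [h] at h1

def GenB (j : ℕ) (A : Fin m → Fin l → ℝ) (e : Fin m → ℝ) (P : Fin l → MvPolynomial (Fin l) ℝ) :
    Prop :=
  ∀ r : Fin l → Option (Fin m), adm j r → ∀ x, (∀ i, eval x (mixP A e P r i) = 0) →
    (fderiv ℝ (fun y i => eval y (mixP A e P r i)) x).det ≠ 0 ∧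
      ∀ s, zf A e s x = 0 → ∃ i, r i = some s

/-- boundary limit points -/
def XI (j : ℕ) (A : Fin m → Fin l → ℝ) (e : Fin m → ℝ) (P : Fin l → MvPolynomial (Fin l) ℝ)
    (I : Finset (Fin m)) : Set (Fin l → ℝ) :=
  {x | (∀ s, 0 ≤ zf A e s x) ∧ (∀ s ∈ I, zf A e s x = 0) ∧
    ∀ i : Fin l, j < (i : ℕ) → eval x (P i) = 0}

lemma XI_mix {j : ℕ} {A : Fin m → Fin l → ℝ} {e : Fin m → ℝ} {P : Fin l → MvPolynomial (Fin l) ℝ}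
    {I : Finset (Fin m)} {x : Fin l → ℝ} (hx : x ∈ XI j A e P I) {r : Fin l → Option (Fin m)}
    (hr : adm (j + 1) r) (hrI : ∀ i s, r i = some s → s ∈ I) (i : Fin l) :
    eval x (mixP A e P r i) = 0 := by
  unfold mixP
  have := hr.1 i
  cases h : r i with
  | none =>
    rw [h] at this
    simp at this
    exact hx.2.2 i (by omega)
  | some s =>
    simp only [eval_zP]
    exact hx.2.1 s (hrI i s h)

lemma XI_card {j : ℕ} (hj : j < l) {A : Fin m → Fin l → ℝ} {e : Fin m → ℝ}
    {P : Fin l → MvPolynomial (Fin l) ℝ} (d : Fin l → ℕ)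
    (hP : ∀ i : Fin l, j < (i : ℕ) → (P i).totalDegree ≤ d i) (hG : GenB (j + 1) A e P)
    (I : Finset (Fin m)) (hI : I.card = j + 1) (S : Finset (Fin l → ℝ))
    (hS : ∀ x ∈ S, x ∈ XI j A e P I) :
    S.card ≤ ∏ i : Fin l, (if j < (i : ℕ) then d i else 1) := by
  obtain ⟨r, hr, -, hrI⟩ := exists_adm (l := l) I hI
  refine bezout (mixP A e P r) _ (fun i => ?_) S (fun x hx i => XI_mix (hS x hx) hr hrI i)
    (fun x hx => (hG r hr x fun i => XI_mix (hS x hx) hr hrI i).1)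
  unfold mixP
  have := hr.1 i
  cases h : r i with
  | none =>
    rw [h] at this
    simp at this
    have : j < (i : ℕ) := by omega
    simp only [this, if_true]
    exact hP i this
  | some s =>
    rw [h] at this
    simp at this
    have : ¬ j < (i : ℕ) := by omega
    simp only [this, if_false]
    exact zP_deg A e s

lemma abs_sub_le_log {a b η : ℝ} (ha : 0 < a) (hb : 0 < b) (ha' : a ≤ η) (hb' : b ≤ η) :
    |a - b| ≤ η * |Real.log a - Real.log b| := by
  have key : ∀ a b : ℝ, 0 < a → 0 < b → a ≤ η → b ≤ a →
      a - b ≤ η * (Real.log a - Real.log b) := by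
    intro a b ha hb haη hba
    have h1 := Real.log_le_sub_one_of_pos (div_pos hb ha)
    rw [Real.log_div hb.ne' ha.ne'] at h1
    have h2 : 1 - b / a ≤ Real.log a - Real.log b := by linarith
    have h3 : 0 ≤ 1 - b / a := by
      rw [sub_nonneg, div_le_one ha]; exact hba
    calc a - b = a * (1 - b / a) := by field_simp
      _ ≤ η * (Real.log a - Real.log b) := by
        apply mul_le_mul haη h2 h3 (ha.le.trans haη)
  rcases le_total b a with h | h
  · rw [abs_of_nonneg (sub_nonneg.mpr h),
      abs_of_nonneg (sub_nonneg.mpr (Real.log_le_log hb h))]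
    exact key a b ha hb ha' h
  · rw [abs_sub_comm, abs_sub_comm (Real.log a), abs_of_nonneg (sub_nonneg.mpr h),
      abs_of_nonneg (sub_nonneg.mpr (Real.log_le_log ha h))]
    exact key b a hb ha hb' h

lemma bd_inj {j : ℕ} (hj : j < l) {A : Fin m → Fin l → ℝ} {e : Fin m → ℝ} {β : Fin l → Fin m → ℝ}
    {b : Fin l → ℝ} {P : Fin l → MvPolynomial (Fin l) ℝ} (hA : GenA j β) (hG : GenB (j + 1) A e P)
    {I : Finset (Fin m)} (hI : I.card = j + 1) {y : Fin l → ℝ} (hy : y ∈ XI j A e P I)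
    {i0 : Fin m} (hi0 : i0 ∈ I) :
    ∃ N ∈ 𝓝 y, ∀ x ∈ N, ∀ x' ∈ N, x ∈ Dl A e → x' ∈ Dl A e →
      (∀ i : Fin l, (i : ℕ) < j → lf A e (β i) x = b i) →
      (∀ i : Fin l, (i : ℕ) < j → lf A e (β i) x' = b i) →
      (∀ i : Fin l, j < (i : ℕ) → eval x (P i) = 0) →
      (∀ i : Fin l, j < (i : ℕ) → eval x' (P i) = 0) →
      zf A e i0 x = zf A e i0 x' → x = x' := by
  classical
  obtain ⟨r, hr, hrs, hrI⟩ := exists_adm (l := l) I hI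
  have hG' := hG r hr y fun i => XI_mix hy hr hrI i
  have hMc : ContDiffAt ℝ 1 (fun (x : Fin l → ℝ) (i : Fin l) => eval x (mixP A e P r i)) y := by
    rw [contDiffAt_pi]
    exact fun i => (contDiff_eval _).contDiffAt
  obtain ⟨K, hK, N1, hN1, h1⟩ := strict_anti hMc hG'.1
  have hpos : ∀ s, s ∉ I → 0 < zf A e s y := by
    intro s hs
    refine lt_of_le_of_ne (hy.1 s) fun h => hs ?_
    obtain ⟨i, hi⟩ := hG'.2 s h.symm
    exact hrI i s hi
  let Λ : (Fin l → ℝ) → (Fin m → ℝ) := fun x s => if s ∈ I then 0 else Real.log (zf A e s x)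
  have hΛ : ContDiffAt ℝ 1 Λ y := by
    rw [contDiffAt_pi]
    intro s
    by_cases hs : s ∈ I
    · simp only [Λ, hs, if_true]; exact contDiffAt_const
    · simp only [Λ, hs, if_false]
      refine ContDiffAt.log ?_ (hpos s hs).ne'
      unfold zf; fun_prop
  obtain ⟨KΛ, N2, hN2, h2⟩ := hΛ.exists_lipschitzOnWith
  obtain ⟨c, hc, hcb⟩ := hA.bound (I.erase i0) (by rw [Finset.card_erase_of_mem hi0]; omega)
  let Bβ : ℝ := ∑ i : Fin l, ∑ s, |β i s|
  have hBβ : 0 ≤ Bβ := by positivity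
  let η : ℝ := 1 / (2 * (K * c * Bβ * KΛ + 1))
  have hη : 0 < η := by positivity
  have h3 : ∀ᶠ x in 𝓝 y, ∀ s ∈ I, zf A e s x < η := by
    rw [Filter.eventually_all_finset]
    intro s hs
    refine (zf_continuous A e s).continuousAt.eventually_lt continuousAt_const ?_
    rw [hy.2.1 s hs]; exact hη
  refine ⟨N1 ∩ N2 ∩ {x | ∀ s ∈ I, zf A e s x < η}, inter_mem (inter_mem hN1 hN2) h3, ?_⟩
  rintro x ⟨⟨hx1, hx2⟩, hx3⟩ x' ⟨⟨hx1', hx2'⟩, hx3'⟩ hxD hxD' hl hl' hp hp' hu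
  let w : Fin m → ℝ := fun s => if s ∈ I then Real.log (zf A e s x) - Real.log (zf A e s x') else 0
  have hw0 : ∀ s, s ∉ I.erase i0 → w s = 0 := by
    intro s hs
    by_cases hsI : s ∈ I
    · have : s = i0 := by
        by_contra hne; exact hs (Finset.mem_erase.mpr ⟨hne, hsI⟩)
      subst this
      simp [w, hu]
    · simp [w, hsI]
  have hΛxx : ∀ s, |Λ x s - Λ x' s| ≤ KΛ * ‖x - x'‖ := by
    intro s
    have := h2.norm_sub_le hx2 hx2'
    exact (norm_le_pi_norm (Λ x - Λ x') s).trans this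
  have hwb : ‖w‖ ≤ c * (Bβ * (KΛ * ‖x - x'‖)) := by
    refine hcb w hw0 _ (by positivity) fun i hi => ?_
    have e1 : ∑ s, β i s * w s = - ∑ s, β i s * (Λ x s - Λ x' s) := by
      have e2 : ∑ s, β i s * w s + ∑ s, β i s * (Λ x s - Λ x' s) = lf A e (β i) x - lf A e (β i) x' := by
        unfold lf
        rw [← Finset.sum_add_distrib, ← Finset.sum_sub_distrib]
        refine Finset.sum_congr rfl fun s _ => ?_
        by_cases hs : s ∈ I
        · simp [w, Λ, hs]; ring
        · simp [w, Λ, hs]; ring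
      rw [hl i hi, hl' i hi, sub_self] at e2
      linarith
    rw [e1, abs_neg]
    calc |∑ s, β i s * (Λ x s - Λ x' s)| ≤ ∑ s, |β i s * (Λ x s - Λ x' s)| :=
          Finset.abs_sum_le_sum_abs _ _
      _ ≤ ∑ s, |β i s| * (KΛ * ‖x - x'‖) := by
          refine Finset.sum_le_sum fun s _ => ?_
          rw [abs_mul]
          exact mul_le_mul_of_nonneg_left (hΛxx s) (abs_nonneg _)
      _ = (∑ s, |β i s|) * (KΛ * ‖x - x'‖) := by rw [Finset.sum_mul]
      _ ≤ Bβ * (KΛ * ‖x - x'‖) := by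
          refine mul_le_mul_of_nonneg_right ?_ (by positivity)
          exact Finset.single_le_sum (f := fun i => ∑ s, |β i s|)
            (fun i _ => Finset.sum_nonneg fun s _ => abs_nonneg _) (Finset.mem_univ i)
  have hM : ‖(fun i => eval x (mixP A e P r i)) - (fun i => eval x' (mixP A e P r i))‖ ≤ η * ‖w‖ := by
    rw [pi_norm_le_iff_of_nonneg (by positivity)]
    intro i
    rw [Pi.sub_apply]
    unfold mixP
    have hri := hr.1 i
    cases h : r i with
    | none =>
      rw [h] at hri
      simp at hri
      simp only [hp i (by omega), hp' i (by omega), sub_zero, norm_zero]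
      positivity
    | some s =>
      have hsI := hrI i s h
      simp only [eval_zP, Real.norm_eq_abs]
      refine (abs_sub_le_log (hxD s) (hxD' s) (hx3 s hsI).le (hx3' s hsI).le).trans ?_
      refine mul_le_mul_of_nonneg_left ?_ hη.le
      have := norm_le_pi_norm w s
      simpa [w, hsI] using this
  have hfin := h1 x hx1 x' hx1'
  have hX := norm_nonneg (x - x')
  have hchain : ‖x - x'‖ ≤ K * (η * (c * (Bβ * (KΛ * ‖x - x'‖)))) := by
    refine hfin.trans (mul_le_mul_of_nonneg_left (hM.trans ?_) hK.le)
    exact mul_le_mul_of_nonneg_left hwb hη.le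
  have hhalf : K * (η * (c * (Bβ * (KΛ * ‖x - x'‖)))) ≤ 1 / 2 * ‖x - x'‖ := by
    have h0 : K * (η * (c * (Bβ * (KΛ * ‖x - x'‖)))) = η * (K * c * Bβ * KΛ) * ‖x - x'‖ := by ring
    rw [h0]
    refine mul_le_mul_of_nonneg_right ?_ hX
    have hq : 0 ≤ K * c * Bβ * KΛ := by positivity
    simp only [η]
    rw [div_mul_eq_mul_div, one_mul, div_le_div_iff₀ (by positivity) (by norm_num)]
    linarith
  have : ‖x - x'‖ = 0 := by linarith
  exact sub_eq_zero.mp (norm_eq_zero.mp this)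

lemma bd_card {j : ℕ} {A : Fin m → Fin l → ℝ} {e : Fin m → ℝ} {β : Fin l → Fin m → ℝ}
    {b : Fin l → ℝ} (hjl : j ≤ l) (hA : GenA j β) {C : Set (Fin l → ℝ)} (hC : C ⊆ Dl A e)
    (hCl : ∀ x ∈ C, ∀ i : Fin l, (i : ℕ) < j → lf A e (β i) x = b i)
    {y : Fin l → ℝ} (hy : y ∈ closure C) {I : Finset (Fin m)}
    (hI0 : ∀ s, s ∈ I ↔ zf A e s y = 0) (hne : I.Nonempty) : j < I.card := by
  classical
  by_contra hcard
  push Not at hcard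
  obtain ⟨c, hc, hcb⟩ := hA.bound I hcard
  have : (𝓝[C] y).NeBot := mem_closure_iff_nhdsWithin_neBot.mp hy
  let Φ : Fin l → (Fin l → ℝ) → ℝ := fun i x =>
    ∑ s, β i s * (if s ∈ I then 0 else Real.log (zf A e s x))
  have hΦ : ∀ i, ContinuousAt (Φ i) y := by
    intro i
    refine tendsto_finset_sum _ fun s _ => ?_
    refine Tendsto.const_mul _ ?_
    by_cases hs : s ∈ I
    · simp only [hs, if_true]; exact tendsto_const_nhds
    · simp only [hs, if_false]
      exact ((zf_continuous A e s).continuousAt.log (fun h => hs ((hI0 s).mpr h)))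
  have h1 : ∀ᶠ x in 𝓝 y, ∀ i, |Φ i x| < |Φ i y| + 1 := by
    rw [Filter.eventually_all]
    intro i
    exact (hΦ i).abs.eventually_lt continuousAt_const (by linarith)
  let B : ℝ := ∑ i, (|b i| + |Φ i y| + 1)
  have hB : 0 ≤ B := Finset.sum_nonneg fun i _ => by positivity
  obtain ⟨s0, hs0⟩ := hne
  have h2 : Tendsto (fun x => Real.log (zf A e s0 x)) (𝓝[C] y) atBot := by
    refine Real.tendsto_log_nhdsGT_zero.comp ?_
    refine tendsto_nhdsWithin_iff.mpr ⟨?_, ?_⟩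
    · have := (zf_continuous A e s0).continuousAt (x := y)
      rw [ContinuousAt, (hI0 s0).mp hs0] at this
      exact this.mono_left nhdsWithin_le_nhds
    · filter_upwards [self_mem_nhdsWithin] with x hx
      exact hC hx s0
  have h3 := h2.eventually (eventually_lt_atBot (-(c * B)))
  obtain ⟨x, hx3, hx1, hxC⟩ := (h3.and ((h1.filter_mono nhdsWithin_le_nhds).and
    self_mem_nhdsWithin)).exists
  have := hcb (fun s => if s ∈ I then Real.log (zf A e s x) else 0)
    (fun s hs => by simp [hs]) B hB (fun i hi => by
      have e1 : ∑ s, β i s * (if s ∈ I then Real.log (zf A e s x) else 0) = b i - Φ i x := by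
        rw [← hCl x hxC i hi]
        simp only [Φ, lf]
        rw [← Finset.sum_sub_distrib]
        refine Finset.sum_congr rfl fun s _ => ?_
        by_cases hs : s ∈ I <;> simp [hs]
      rw [e1]
      have e2 : |b i - Φ i x| ≤ |b i| + |Φ i y| + 1 := by
        have := hx1 i
        have := abs_sub (b i) (Φ i x)
        linarith
      refine e2.trans ?_
      exact Finset.single_le_sum (f := fun i => |b i| + |Φ i y| + 1)
        (fun i _ => by positivity) (Finset.mem_univ i))
  have h5 := (norm_le_pi_norm (fun s => if s ∈ I then Real.log (zf A e s x) else 0) s0).trans this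
  simp only [hs0, if_true, Real.norm_eq_abs] at h5
  have := (abs_le.mp h5).1
  linarith

lemma finite_of_card_bound {α : Type*} {Q : Set α} {B : ℕ}
    (h : ∀ S : Finset α, (∀ x ∈ S, x ∈ Q) → S.card ≤ B) : Q.Finite ∧ Q.ncard ≤ B := by
  have hf : Q.Finite := by
    by_contra hinf
    obtain ⟨T, hT, hc⟩ := Set.Infinite.exists_subset_card_eq hinf (B + 1)
    have := h T (fun x hx => hT hx)
    omega
  refine ⟨hf, ?_⟩
  rw [Set.ncard_eq_toFinset_card _ hf]
  exact h _ fun x hx => by simpa using hx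

end LogSysC
end Fewn

open Set Filter Topology

namespace Fewn

section LogSysD
open MvPolynomial
variable {l m : ℕ}

theorem core_step {j : ℕ} (hj : j < l) {A : Fin m → Fin l → ℝ} {e : Fin m → ℝ}
    {β : Fin l → Fin m → ℝ} {b : Fin l → ℝ} {P : Fin l → MvPolynomial (Fin l) ℝ} (d : Fin l → ℕ)
    {δ : ℝ} (hδ : 0 < δ) (hbd : Bornology.IsBounded (Dl A e)) (hA : GenA j β)
    (hG : GenB (j + 1) A e P)
    (hP : ∀ i : Fin l, j < (i : ℕ) → (P i).totalDegree ≤ d i) (Bq : ℕ)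
    (hQ : ∀ σ : ℝ, σ = δ ∨ σ = -δ → ∀ T : Finset (Fin l → ℝ), (∀ x ∈ T, x ∈ Dl A e ∧
      (∀ i, i ≠ ⟨j, hj⟩ → LG (j + 1) A e β b P x i = 0) ∧ eval x (hatP (j + 1) A e β P) = σ) →
      2 * T.card ≤ Bq)
    (T : Finset (Fin l → ℝ)) (hT : ∀ x ∈ T, x ∈ Dl A e ∧ LG (j + 1) A e β b P x = 0 ∧
      δ < |eval x (hatP (j + 1) A e β P)|) :
    2 * T.card ≤ Bq + m.choose (j + 1) * ∏ i : Fin l, (if j < (i : ℕ) then d i else 1) := by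
  classical
  set jj : Fin l := ⟨j, hj⟩ with hjj
  set G := LG (j + 1) A e β b P with hGdef
  set H : (Fin l → ℝ) → ℝ := fun x => eval x (hatP (j + 1) A e β P) with hH
  have hHc : Continuous H := (contDiff_eval (m := 0) _).continuous
  let D0 : Set (Fin l → ℝ) := {x | x ∈ Dl A e ∧ δ < |H x|}
  have hD0 : IsOpen D0 := (Dl_isOpen A e).inter (isOpen_lt continuous_const hHc.abs)
  let C : Set (Fin l → ℝ) := {x | x ∈ D0 ∧ ∀ i, i ≠ jj → G x i = 0}
  let Q : ℝ → Set (Fin l → ℝ) := fun σ => {x | x ∈ Dl A e ∧ (∀ i, i ≠ jj → G x i = 0) ∧ H x = σ}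
  let X : Set (Fin l → ℝ) := ⋃ I ∈ (Finset.univ : Finset (Fin m)).powersetCard (j + 1), XI j A e P I
  have hdet : ∀ x ∈ Dl A e, H x ≠ 0 → (fderiv ℝ G x).det ≠ 0 := by
    intro x hx hne h0
    rw [hGdef, LG_det hx] at h0
    apply hne
    simp only [hH]
    rw [hatP_eval (j + 1) β P (fun s => (hx s).ne'), h0, mul_zero]
  have hGc : ∀ x ∈ Dl A e, ContDiffAt ℝ 1 G x := fun x hx => LG_contDiffAt hx
  have hlog : ∀ x, (∀ i, i ≠ jj → G x i = 0) → ∀ i : Fin l, (i : ℕ) < j → lf A e (β i) x = b i := by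
    intro x hx i hi
    have := hx i (fun h => by rw [h] at hi; simp [hjj] at hi)
    simp only [hGdef, LG, show (i : ℕ) < j + 1 by omega, if_true] at this
    linarith
  have hpol : ∀ x, (∀ i, i ≠ jj → G x i = 0) → ∀ i : Fin l, j < (i : ℕ) → eval x (P i) = 0 := by
    intro x hx i hi
    have := hx i (fun h => by rw [h] at hi; simp [hjj] at hi)
    simpa only [hGdef, LG, show ¬ (i : ℕ) < j + 1 by omega, if_false] using this
  -- finiteness
  have hQf : ∀ σ, σ = δ ∨ σ = -δ → (Q σ).Finite ∧ (Q σ).ncard ≤ Bq / 2 := by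
    intro σ hσ
    refine finite_of_card_bound fun S hS => ?_
    have := hQ σ hσ S (fun x hx => hS x hx)
    omega
  have hXIf : ∀ I ∈ (Finset.univ : Finset (Fin m)).powersetCard (j + 1),
      (XI j A e P I).Finite ∧ (XI j A e P I).ncard ≤ ∏ i : Fin l, (if j < (i : ℕ) then d i else 1) := by
    intro I hI
    refine finite_of_card_bound fun S hS => ?_
    exact XI_card hj d hP hG I (Finset.mem_powersetCard.mp hI).2 S hS
  have hXf : X.Finite := Set.Finite.biUnion (Finset.finite_toSet _) fun I hI => (hXIf I hI).1
  have hXc : X.ncard ≤ m.choose (j + 1) * ∏ i : Fin l, (if j < (i : ℕ) then d i else 1) := by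
    have h1 : X.ncard ≤ ∑ I ∈ (Finset.univ : Finset (Fin m)).powersetCard (j + 1),
        (XI j A e P I).ncard := by
      have h2 : ∀ F : Finset (Finset (Fin m)), (⋃ I ∈ F, XI j A e P I).ncard ≤
          ∑ I ∈ F, (XI j A e P I).ncard := by
        intro F
        induction F using Finset.induction_on with
        | empty => simp
        | insert a F ha ih =>
          rw [Finset.sum_insert ha, Finset.set_biUnion_insert]
          exact (Set.ncard_union_le _ _).trans (Nat.add_le_add_left ih _)
      exact h2 _
    refine h1.trans ((Finset.sum_le_sum fun I hI => (hXIf I hI).2).trans ?_)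
    rw [Finset.sum_const, Finset.card_powersetCard, Finset.card_univ, Fintype.card_fin, smul_eq_mul]
  let L := (Q δ ∪ Q (-δ)) ∪ X
  have hLf : L.Finite := ((hQf δ (Or.inl rfl)).1.union (hQf (-δ) (Or.inr rfl)).1).union hXf
  have hLc : L.ncard ≤ Bq + m.choose (j + 1) * ∏ i : Fin l, (if j < (i : ℕ) then d i else 1) := by
    have h1 := Set.ncard_union_le (Q δ ∪ Q (-δ)) X
    have h2 := Set.ncard_union_le (Q δ) (Q (-δ))
    have h3 := (hQf δ (Or.inl rfl)).2
    have h4 := (hQf (-δ) (Or.inr rfl)).2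
    have : L.ncard = ((Q δ ∪ Q (-δ)) ∪ X).ncard := rfl
    omega
  refine le_trans ?_ hLc
  have hCD : C ⊆ Dl A e := fun x hx => hx.1.1
  refine path_count (C := C) (L := L) (K := closure (Dl A e)) (f := fun x => Real.arctan (G x jj))
    (B := Real.pi / 2) ?_ (hCD.trans subset_closure) hLf ?_ ?_ ?_ ?_ ?_ T ?_
  · exact hbd.isCompact_closure
  · intro y hy
    have hz : ∀ s, 0 ≤ zf A e s y := by
      intro s
      have : closure C ⊆ {x | 0 ≤ zf A e s x} :=
        closure_minimal (fun x hx => (hx.1.1 s).le) (isClosed_le continuous_const (zf_continuous A e s))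
      exact this hy
    have hPy : ∀ i : Fin l, j < (i : ℕ) → eval y (P i) = 0 := by
      intro i hi
      have : closure C ⊆ {x | eval x (P i) = 0} :=
        closure_minimal (fun x hx => hpol x hx.2 i hi)
          (isClosed_eq (contDiff_eval (m := 0) _).continuous continuous_const)
      exact this hy
    by_cases hyD : y ∈ Dl A e
    · have hGy : ∀ i, i ≠ jj → G y i = 0 := by
        intro i hi
        have : (𝓝[C] y).NeBot := mem_closure_iff_nhdsWithin_neBot.mp hy
        have h1 : Tendsto (fun x => G x i) (𝓝[C] y) (𝓝 (G y i)) :=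
          (((continuous_apply i).continuousAt).comp (hGc y hyD).continuousAt).tendsto.mono_left
            nhdsWithin_le_nhds
        have h2 : Tendsto (fun x => G x i) (𝓝[C] y) (𝓝 0) := by
          refine tendsto_const_nhds.congr' ?_
          filter_upwards [self_mem_nhdsWithin] with x hx
          exact (hx.2 i hi).symm
        exact tendsto_nhds_unique h1 h2
      have hHy : δ ≤ |H y| := by
        have : closure C ⊆ {x | δ ≤ |H x|} :=
          closure_minimal (fun x hx => hx.1.2.le) (isClosed_le continuous_const hHc.abs)
        exact this hy
      rcases hHy.lt_or_eq with h | h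
      · exact Or.inl ⟨⟨hyD, h⟩, hGy⟩
      · right; left
        rcases le_total 0 (H y) with h0 | h0
        · left
          exact ⟨hyD, hGy, by rw [abs_of_nonneg h0] at h; exact h.symm⟩
        · right
          exact ⟨hyD, hGy, by rw [abs_of_nonpos h0] at h; linarith⟩
    · right; right
      let I : Finset (Fin m) := Finset.univ.filter fun s => zf A e s y = 0
      have hI0 : ∀ s, s ∈ I ↔ zf A e s y = 0 := by simp [I]
      have hne : I.Nonempty := by
        simp only [Dl, mem_setOf_eq] at hyD
        push Not at hyD
        obtain ⟨s, hs⟩ := hyD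
        exact ⟨s, (hI0 s).mpr (le_antisymm hs (hz s))⟩
      have hcard := bd_card (b := b) hj.le hA hCD (fun x hx => hlog x hx.2) hy hI0 hne
      obtain ⟨I', hI', hc⟩ := Finset.exists_subset_card_eq (show j + 1 ≤ I.card from hcard)
      simp only [X, mem_iUnion]
      exact ⟨I', Finset.mem_powersetCard.mpr ⟨Finset.subset_univ _, hc⟩, hz,
        fun s hs => (hI0 s).mp (hI' hs), hPy⟩
  · intro x hx
    exact (Real.continuous_arctan.continuousAt.comp
      ((continuous_apply jj).continuousAt.comp (hGc x hx.1.1).continuousAt)).continuousWithinAt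
  · intro x hx
    exact abs_le.mpr ⟨(Real.neg_pi_div_two_lt_arctan _).le, (Real.arctan_lt_pi_div_two _).le⟩
  · intro y hy
    refine abs_sec hD0 jj hy.1 hy.2 (hGc y hy.1.1) (hdet y hy.1.1 ?_)
    intro h0
    have := hy.1.2
    rw [h0, abs_zero] at this
    linarith
  · intro y hy
    have hQcase : ∀ σ, σ ≠ 0 → y ∈ Q σ →
        (Tendsto (fun x => Real.arctan (G x jj)) (𝓝[C] y) (𝓝 (Real.arctan (G y jj))) ∧
          ∃ N ∈ 𝓝[C] y, InjOn (fun x => Real.arctan (G x jj)) N) := by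
      intro σ hσ hyσ
      refine abs_inj jj (hGc y hyσ.1) (hdet y hyσ.1 ?_)
      rw [hyσ.2.2]; exact hσ
    rcases hy with (hy | hy) | hy
    · exact Or.inl (hQcase δ hδ.ne' hy)
    · exact Or.inl (hQcase (-δ) (by linarith [hδ] : (-δ) < 0).ne hy)
    · right
      simp only [X, mem_iUnion] at hy
      obtain ⟨I, hI, hyI⟩ := hy
      have hIc := (Finset.mem_powersetCard.mp hI).2
      obtain ⟨i0, hi0⟩ : I.Nonempty := by
        rw [← Finset.card_pos]; omega
      refine ⟨zf A e i0, ?_, fun x hx => hx.1.1 i0, (zf_continuous A e i0).continuousOn, ?_⟩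
      · have := (zf_continuous A e i0).continuousAt (x := y)
        rw [ContinuousAt, hyI.2.1 i0 hi0] at this
        exact this.mono_left nhdsWithin_le_nhds
      · obtain ⟨N, hN, h⟩ := bd_inj (b := b) hj hA hG hIc hyI hi0
        refine ⟨N ∩ C, inter_mem (mem_nhdsWithin_of_mem_nhds hN) self_mem_nhdsWithin, ?_⟩
        intro x hx x' hx' hu
        exact h x hx.1 x' hx'.1 (hCD hx.2) (hCD hx'.2) (hlog x hx.2.2) (hlog x' hx'.2.2)
          (hpol x hx.2.2) (hpol x' hx'.2.2) hu
  · intro p hp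
    obtain ⟨h1, h2, h3⟩ := hT p hp
    refine ⟨⟨⟨h1, h3⟩, fun i _ => by rw [h2]; rfl⟩, ?_⟩
    simp [h2]

end LogSysD
end Fewn

open Set Filter Topology

namespace Fewn

section LogSysE
open MvPolynomial MeasureTheory
variable {l m : ℕ}

lemma eventually_ne_of_finite {F : Set ℝ} (hF : F.Finite) : ∀ᶠ t in 𝓝[≠] (0:ℝ), t ∉ F := by
  have h1 : (F \ {0}).Finite := hF.subset diff_subset
  have h2 : (F \ {0})ᶜ ∈ 𝓝 (0:ℝ) := h1.isClosed.isOpen_compl.mem_nhds (by simp)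
  filter_upwards [mem_nhdsWithin_of_mem_nhds h2, self_mem_nhdsWithin] with t ht h0 htF
  exact ht ⟨htF, h0⟩

lemma det_pencil_finite {p : ℕ} (B V : Matrix (Fin p) (Fin p) ℝ) (hV : V.det ≠ 0) :
    {t : ℝ | (B + t • V).det = 0}.Finite := by
  have hu : IsUnit V.det := isUnit_iff_ne_zero.mpr hV
  refine ((-(V⁻¹ * B)).charpoly.rootSet_finite ℝ).subset ?_
  intro t ht
  rw [Polynomial.mem_rootSet]
  refine ⟨(Matrix.charpoly_monic _).ne_zero, ?_⟩
  rw [Polynomial.coe_aeval_eq_eval, Matrix.eval_charpoly]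
  have : B + t • V = V * (Matrix.scalar _ t - -(V⁻¹ * B)) := by
    rw [sub_neg_eq_add, mul_add, ← mul_assoc, Matrix.mul_nonsing_inv _ hu, one_mul, add_comm]
    congr 1
    rw [Matrix.scalar_apply]
    ext i k
    simp [Matrix.mul_diagonal, mul_comm]
  simp only [mem_setOf_eq] at ht
  rw [this, Matrix.det_mul] at ht
  exact (mul_eq_zero.mp ht).resolve_left hV

lemma genA_dense {j : ℕ} (hj : j ≤ l) (β0 : Fin l → Fin m → ℝ) {U : Set (Fin l → Fin m → ℝ)}
    (hU : U ∈ 𝓝 β0) : ∃ β ∈ U, GenA j β := by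
  classical
  let V : Fin l → Fin m → ℝ := fun i s => ((s : ℕ) : ℝ) ^ (i : ℕ)
  have h1 : ∀ I : Finset (Fin m), I.card ≤ j → ∀ᶠ t in 𝓝[≠] (0:ℝ),
      ∀ w : Fin m → ℝ, (∀ s, s ∉ I → w s = 0) →
    (∀ i : Fin l, (i : ℕ) < j → ∑ s, (β0 + t • V) i s * w s = 0) → w = 0 := by
    intro I hI
    let em := I.orderEmbOfFin rfl
    have hlt : ∀ i : Fin I.card, (i : ℕ) < l := fun i => i.2.trans_le (hI.trans hj)
    let B : Matrix (Fin I.card) (Fin I.card) ℝ := fun i t => β0 ⟨i, hlt i⟩ (em t)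
    let W : Matrix (Fin I.card) (Fin I.card) ℝ := fun i t => V ⟨i, hlt i⟩ (em t)
    have hW : W.det ≠ 0 := by
      have : W = Matrix.transpose (Matrix.vandermonde fun t => (((em t : Fin m) : ℕ) : ℝ)) := by
        ext i t; simp [W, V, Matrix.vandermonde_apply]
      rw [this, Matrix.det_transpose, Matrix.det_vandermonde_ne_zero_iff]
      intro a b hab
      simp only [Nat.cast_inj] at hab
      exact em.injective (Fin.ext hab)
    filter_upwards [eventually_ne_of_finite (det_pencil_finite B W hW)] with t ht w hw hs
    have h2 : (B + t • W).mulVec (fun u => w (em u)) = 0 := by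
      ext i
      have h3 := hs ⟨i, hlt i⟩ (i.2.trans_le hI)
      rw [Pi.zero_apply, ← h3]
      simp only [Matrix.mulVec, dotProduct]
      have h4 : ∑ s, (β0 + t • V) ⟨i, hlt i⟩ s * w s =
          ∑ s ∈ I, (β0 + t • V) ⟨i, hlt i⟩ s * w s := by
        symm
        refine Finset.sum_subset (Finset.subset_univ _) fun s _ hsI => ?_
        rw [hw s hsI, mul_zero]
      rw [h4]
      have h5 : I = Finset.univ.map em.toEmbedding := by
        simp [em]
      have h6 : ∀ φ : Fin m → ℝ, ∑ s ∈ I, φ s = ∑ u, φ (em u) := by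
        intro φ
        have := Finset.sum_map (Finset.univ : Finset (Fin I.card)) em.toEmbedding φ
        rw [← h5] at this
        exact this
      rw [h6]
      rfl
    have h3 := Matrix.eq_zero_of_mulVec_eq_zero ht h2
    ext s
    by_cases hsI : s ∈ I
    · have : s ∈ Set.range em := by
        simp only [em]; rw [Finset.range_orderEmbOfFin]; exact hsI
      obtain ⟨u, rfl⟩ := this
      exact congrFun h3 u
    · exact hw s hsI
  have h2 : ∀ᶠ t in 𝓝[≠] (0:ℝ), GenA j (β0 + t • V) := by
    have : ∀ᶠ t in 𝓝[≠] (0:ℝ), ∀ I : Finset (Fin m), I.card ≤ j →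
      ∀ w : Fin m → ℝ, (∀ s, s ∉ I → w s = 0) →
    (∀ i : Fin l, (i : ℕ) < j → ∑ s, (β0 + t • V) i s * w s = 0) → w = 0 := by
      rw [Filter.eventually_all]
      intro I
      by_cases hI : I.card ≤ j
      · filter_upwards [h1 I hI] with t ht _ using ht
      · exact Eventually.of_forall fun t h => absurd h hI
    exact this
  have h3 : Tendsto (fun t : ℝ => β0 + t • V) (𝓝[≠] 0) (𝓝 β0) := by
    have : Continuous (fun t : ℝ => β0 + t • V) := by fun_prop
    have h4 := this.tendsto 0
    simp only [zero_smul, add_zero] at h4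
    exact h4.mono_left nhdsWithin_le_nhds
  obtain ⟨t, ht1, ht2⟩ := (h2.and (h3.eventually hU)).exists
  exact ⟨_, ht2, ht1⟩

lemma ae_lin {E F : Type*} [NormedAddCommGroup E] [MeasurableSpace E] [BorelSpace E]
    [NormedSpace ℝ E] [FiniteDimensional ℝ E] [NormedAddCommGroup F] [MeasurableSpace F]
    [BorelSpace F] [NormedSpace ℝ F] (L : E →ₗ[ℝ] F) (μ : Measure E) (ν : Measure F)
    [μ.IsAddHaarMeasure] [ν.IsAddHaarMeasure] (h : Function.Surjective L) {N : Set F}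
    (hN : ν N = 0) : ∀ᵐ x ∂μ, L x ∉ N := by
  have : LocallyCompactSpace E := by
    have := FiniteDimensional.proper_real E
    infer_instance
  have h1 : ∀ᵐ y ∂ν, y ∈ (toMeasurable ν N)ᶜ := by
    rw [ae_iff]; simpa using hN
  have h2 := (ae_comp_linearMap_mem_iff L μ ν h (measurableSet_toMeasurable ν N).compl).mpr h1
  filter_upwards [h2] with x hx hxN
  exact hx (subset_toMeasurable _ _ hxN)

lemma sard_ae {E : Type*} [NormedAddCommGroup E] [MeasurableSpace E] [BorelSpace E]
    [NormedSpace ℝ E] [FiniteDimensional ℝ E] (ν : Measure E) [ν.IsAddHaarMeasure] {f : E → E}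
    {D : Set E} (hf : ∀ x ∈ D, DifferentiableAt ℝ f x) :
    ν (f '' {x | x ∈ D ∧ (fderiv ℝ f x).det = 0}) = 0 :=
  addHaar_image_eq_zero_of_det_fderivWithin_eq_zero ν (f' := fderiv ℝ f)
    (fun x hx => (hf x hx.1).hasFDerivAt.hasFDerivWithinAt) fun x hx => hx.2

lemma mixP_shift (A : Fin m → Fin l → ℝ) (e : Fin m → ℝ) (P : Fin l → MvPolynomial (Fin l) ℝ)
    (v : Fin l → ℝ) (r : Fin l → Option (Fin m)) (x : Fin l → ℝ) (i : Fin l) :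
    eval x (mixP A e (fun i => P i - C (v i)) r i) = eval x (mixP A 0 P r i) -
      (match r i with | some s => - e s | none => v i) := by
  unfold mixP
  cases r i with
  | none => simp
  | some s => simp [eval_zP, zf]

/-- parameter map -/
noncomputable def parL (r : Fin l → Option (Fin m)) :
    ((Fin m → ℝ) × (Fin l → ℝ)) →ₗ[ℝ] (Fin l → ℝ) where
  toFun q i := match r i with | some s => - q.1 s | none => q.2 i
  map_add' a b := by
    ext i
    simp only [Pi.add_apply]
    cases r i with
    | none => simp
    | some s => simp; ring
  map_smul' c a := by
    ext i
    simp only [Pi.smul_apply]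
    cases r i with
    | none => simp
    | some s => simp

lemma ae_genB (j : ℕ) (A : Fin m → Fin l → ℝ) (P : Fin l → MvPolynomial (Fin l) ℝ) :
    ∀ᵐ q : (Fin m → ℝ) × (Fin l → ℝ), GenB j A q.1 (fun i => P i - C (q.2 i)) := by
  classical
  haveI i1 : (volume : Measure ((Fin m → ℝ) × (Fin l → ℝ))).IsAddHaarMeasure :=
    Measure.prod.instIsAddHaarMeasure (volume : Measure (Fin m → ℝ)) (volume : Measure (Fin l → ℝ))
  haveI i2 : (volume : Measure ((Fin l → ℝ) × ℝ)).IsAddHaarMeasure := by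
    rw [Measure.volume_eq_prod]; infer_instance
  have key : ∀ r : Fin l → Option (Fin m), adm j r → ∀ᵐ q : (Fin m → ℝ) × (Fin l → ℝ),
      ∀ x, (∀ i, eval x (mixP A q.1 (fun i => P i - C (q.2 i)) r i) = 0) →
      (fderiv ℝ (fun y i => eval y (mixP A q.1 (fun i => P i - C (q.2 i)) r i)) x).det ≠ 0 ∧
      ∀ s, zf A q.1 s x = 0 → ∃ i, r i = some s := by
    intro r hr
    let Φ : (Fin l → ℝ) → (Fin l → ℝ) := fun x i => eval x (mixP A 0 P r i)
    have hΦ : Differentiable ℝ Φ := by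
      rw [differentiable_pi]
      exact fun i => (contDiff_eval (m := 1) _).differentiable (by norm_num)
    have hshift : ∀ (q : (Fin m → ℝ) × (Fin l → ℝ)) (x : Fin l → ℝ),
        (fun i => eval x (mixP A q.1 (fun i => P i - C (q.2 i)) r i)) = Φ x - parL r q := by
      intro q x
      ext i
      rw [mixP_shift]; rfl
    have hsurj : Function.Surjective (parL (l := l) (m := m) r) := by
      intro z
      refine ⟨(fun s => if h : ∃ i, r i = some s then - z h.choose else 0, z), ?_⟩
      ext i
      simp only [parL, LinearMap.coe_mk, AddHom.coe_mk]
      cases h : r i with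
      | none => rfl
      | some s =>
        have hex : ∃ i, r i = some s := ⟨i, h⟩
        simp only [hex, dif_pos, neg_neg]
        rw [hr.2 _ _ s hex.choose_spec h]
    have h1 := ae_lin (parL r) (volume : Measure ((Fin m → ℝ) × (Fin l → ℝ)))
      (volume : Measure (Fin l → ℝ)) hsurj
      (sard_ae volume (f := Φ) (D := univ) (fun x _ => hΦ x))
    have h2 : ∀ s', (¬ ∃ i, r i = some s') → ∀ᵐ q : (Fin m → ℝ) × (Fin l → ℝ),
        ∀ x, Φ x = parL r q → zf A q.1 s' x ≠ 0 := by
      intro s' hs'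
      let f : (Fin l → ℝ) × ℝ → (Fin l → ℝ) × ℝ := fun p => (Φ p.1, zf A 0 s' p.1)
      let L2 : ((Fin m → ℝ) × (Fin l → ℝ)) →ₗ[ℝ] (Fin l → ℝ) × ℝ :=
        (parL r).prod (- (LinearMap.proj s').comp (LinearMap.fst ℝ _ _))
      have hz : Differentiable ℝ (zf A 0 s') := fun x => (zf_hasFDerivAt A 0 s' x).differentiableAt
      have hf : Differentiable ℝ f :=
        (hΦ.comp differentiable_fst).prodMk (hz.comp differentiable_fst)
      have hdet : ∀ p, (fderiv ℝ f p).det = 0 := by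
        intro p
        rw [ContinuousLinearMap.det, LinearMap.det_eq_zero_iff_ker_ne_bot]
        intro hbot
        have : ((0 : Fin l → ℝ), (1:ℝ)) ∈ LinearMap.ker (fderiv ℝ f p : (Fin l → ℝ) × ℝ →ₗ[ℝ] (Fin l → ℝ) × ℝ) := by
          rw [LinearMap.mem_ker]
          have h3 : HasFDerivAt f ((((fderiv ℝ Φ p.1).prod (fderiv ℝ (zf A 0 s') p.1))).comp
              (ContinuousLinearMap.fst ℝ (Fin l → ℝ) ℝ)) p := by
            have := ((hΦ p.1).hasFDerivAt.prodMk (hz p.1).hasFDerivAt)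
            exact this.comp p hasFDerivAt_fst
          rw [h3.fderiv]
          simp
        rw [hbot] at this
        simp at this
      have hnull : (volume : Measure ((Fin l → ℝ) × ℝ)) (f '' {x | x ∈ univ ∧ (fderiv ℝ f x).det = 0}) = 0 :=
        sard_ae volume (fun x _ => hf x)
      have hs2 : Function.Surjective L2 := by
        intro z
        obtain ⟨q, hq⟩ := hsurj z.1
        refine ⟨(Function.update q.1 s' (- z.2), q.2), ?_⟩
        apply Prod.ext
        · rw [← hq]
          change parL r (Function.update q.1 s' (-z.2), q.2) = parL r q
          ext i
          simp only [parL, LinearMap.coe_mk, AddHom.coe_mk]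
          cases h : r i with
          | none => rfl
          | some s =>
            have : s ≠ s' := fun hss => hs' ⟨i, by rw [h, hss]⟩
            simp [Function.update_of_ne this]
        · simp [L2]
      filter_upwards [ae_lin L2 volume volume hs2 hnull] with q hq x hx h0
      apply hq
      refine ⟨(x, 0), ⟨trivial, hdet _⟩, ?_⟩
      apply Prod.ext
      · exact hx
      · simp only [f, L2]
        simp [zf] at h0 ⊢
        linarith
    have h3 : ∀ᵐ q : (Fin m → ℝ) × (Fin l → ℝ), ∀ s', (¬ ∃ i, r i = some s') →
        ∀ x, Φ x = parL r q → zf A q.1 s' x ≠ 0 := by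
      rw [ae_all_iff]
      intro s'
      by_cases hs' : ∃ i, r i = some s'
      · exact Eventually.of_forall fun q h => absurd hs' h
      · filter_upwards [h2 s' hs'] with q hq _ using hq
    filter_upwards [h1, h3] with q hq1 hq3 x hx
    have hx' : Φ x = parL r q := by
      have := hshift q x
      rw [show (fun i => eval x (mixP A q.1 (fun i => P i - C (q.2 i)) r i)) = 0 from funext hx] at this
      exact (sub_eq_zero.mp this.symm)
    constructor
    · intro h0
      apply hq1
      refine ⟨x, ⟨trivial, ?_⟩, hx'⟩
      have : (fun (y : Fin l → ℝ) (i : Fin l) => eval y (mixP A q.1 (fun i => P i - C (q.2 i)) r i)) =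
          fun y => Φ y - parL r q := funext fun y => hshift q y
      rw [this, fderiv_sub_const] at h0
      exact h0
    · intro s hs
      by_contra hcon
      exact hq3 s hcon x hx' hs
  have : ∀ᵐ q : (Fin m → ℝ) × (Fin l → ℝ), ∀ r : Fin l → Option (Fin m), adm j r → ∀ x,
      (∀ i, eval x (mixP A q.1 (fun i => P i - C (q.2 i)) r i) = 0) →
      (fderiv ℝ (fun y i => eval y (mixP A q.1 (fun i => P i - C (q.2 i)) r i)) x).det ≠ 0 ∧
      ∀ s, zf A q.1 s x = 0 → ∃ i, r i = some s := by
    rw [ae_all_iff]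
    intro r
    by_cases hr : adm j r
    · filter_upwards [key r hr] with q hq _ using hq
    · exact Eventually.of_forall fun q h => absurd h hr
  exact this

end LogSysE
end Fewn

open Set Filter Topology

namespace Fewn

section LogSysF
open MvPolynomial MeasureTheory
variable {l m : ℕ}

lemma LG_shift (j : ℕ) (A : Fin m → Fin l → ℝ) (e : Fin m → ℝ) (β : Fin l → Fin m → ℝ)
    (b v : Fin l → ℝ) (P : Fin l → MvPolynomial (Fin l) ℝ) (x : Fin l → ℝ) :
    LG j A e β (b + v) (fun i => P i - C (v i)) x = LG j A e β b P x - v := by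
  ext i
  simp only [LG, Pi.sub_apply, Pi.add_apply]
  split_ifs
  · ring
  · simp

lemma JM_shift (j : ℕ) (A : Fin m → Fin l → ℝ) (e : Fin m → ℝ) (β : Fin l → Fin m → ℝ)
    (v : Fin l → ℝ) (P : Fin l → MvPolynomial (Fin l) ℝ) (x : Fin l → ℝ) :
    JM j A e β (fun i => P i - C (v i)) x = JM j A e β P x := by
  ext i
  simp [JM]

lemma hatP_shift (j : ℕ) (A : Fin m → Fin l → ℝ) (e : Fin m → ℝ) (β : Fin l → Fin m → ℝ)
    (v : Fin l → ℝ) (P : Fin l → MvPolynomial (Fin l) ℝ) :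
    hatP j A e β (fun i => P i - C (v i)) = hatP j A e β P := by
  have : ∀ r : Fin l → Option (Fin m), mixJ A (fun i => P i - C (v i)) r = mixJ A P r := by
    intro r
    ext1 i k
    simp only [mixJ]
    cases r i <;> simp
  simp only [hatP, this]

lemma hatP_cont (j : ℕ) (A : Fin m → Fin l → ℝ) (P : Fin l → MvPolynomial (Fin l) ℝ) :
    Continuous fun q : (Fin l → Fin m → ℝ) × (Fin m → ℝ) × (Fin l → ℝ) =>
      eval q.2.2 (hatP j A q.2.1 q.1 P) := by
  classical
  simp only [hatP, map_sum]
  refine continuous_finsetSum _ fun r _ => ?_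
  by_cases h : adm j r
  · simp only [h, if_true, map_mul, eval_C, map_prod, eval_zP]
    refine (Continuous.mul ?_ ?_).mul ?_
    · refine continuous_finsetProd _ fun i _ => ?_
      cases r i with
      | none => exact continuous_const
      | some s => simp only; fun_prop
    · refine continuous_finsetProd _ fun s _ => ?_
      unfold zf; fun_prop
    · exact (contDiff_eval (m := 0) _).continuous.comp (by fun_prop)
  · simp only [h, if_false, map_zero]; exact continuous_const

lemma LG_param_contDiffAt (j : ℕ) (A : Fin m → Fin l → ℝ) (b : Fin l → ℝ)
    (P : Fin l → MvPolynomial (Fin l) ℝ)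
    (q : ((Fin l → Fin m → ℝ) × (Fin m → ℝ) × (Fin l → ℝ)) × (Fin l → ℝ))
    (hq : q.2 ∈ Dl A q.1.2.1) :
    ContDiffAt ℝ 1 (fun q : ((Fin l → Fin m → ℝ) × (Fin m → ℝ) × (Fin l → ℝ)) × (Fin l → ℝ) =>
      LG j A q.1.2.1 q.1.1 b P q.2 - q.1.2.2) q := by
  rw [contDiffAt_pi]
  intro i
  simp only [Pi.sub_apply]
  refine ContDiffAt.sub ?_ (by fun_prop)
  unfold LG
  by_cases h : (i : ℕ) < j
  · simp only [h, if_true]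
    refine ContDiffAt.sub ?_ (by fun_prop)
    unfold lf
    refine ContDiffAt.sum fun s _ => ?_
    refine ContDiffAt.mul (by fun_prop) ?_
    refine ContDiffAt.log ?_ (hq s).ne'
    unfold zf
    fun_prop
  · simp only [h, if_false]
    exact (contDiff_eval (P i)).contDiffAt.comp q (by fun_prop)

theorem log_count (d : Fin l → ℕ) (hd : ∀ i, 1 ≤ d i)
    (hdd : ∀ j : Fin l, m + ∑ i : Fin l, (if (j : ℕ) + 1 ≤ (i : ℕ) then d i else 0) ≤ d j + l)
    (A : Fin m → Fin l → ℝ) :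
    ∀ j : ℕ, j ≤ l → ∀ (e : Fin m → ℝ) (β : Fin l → Fin m → ℝ) (b : Fin l → ℝ)
      (P : Fin l → MvPolynomial (Fin l) ℝ), (∀ i, (P i).totalDegree ≤ d i) →
      Bornology.IsBounded (Dl A e) → ∀ S : Finset (Fin l → ℝ),
      (∀ x ∈ S, x ∈ Dl A e ∧ LG j A e β b P x = 0 ∧ (JM j A e β P x).det ≠ 0) →
      2 * S.card ≤ 2 * ∏ i, d i +
        ∑ s ∈ Finset.range j, m.choose (s + 1) * ∏ i : Fin l, (if s < (i : ℕ) then d i else 1) := by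
  classical
  intro j
  induction j with
  | zero =>
    intro _ e β b P hP _ S hS
    have := bezout P d hP S (fun x hx i => by
      have := congrFun (hS x hx).2.1 i
      simpa [LG] using this) (fun x hx => by
      have h1 := (hS x hx).2.2
      rw [← LG_det (b := b) (hS x hx).1] at h1
      have h2 : LG 0 A e β b P = fun y i => eval y (P i) := by ext; simp [LG]
      rwa [h2] at h1)
    simpa using this
  | succ j ih =>
    intro hj e0 β0 b P hP hbd S hS
    have hj' : j < l := hj
    set jj : Fin l := ⟨j, hj'⟩ with hjj
    rw [Finset.sum_range_succ, ← add_assoc]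
    let F : ((Fin l → Fin m → ℝ) × (Fin m → ℝ) × (Fin l → ℝ)) × (Fin l → ℝ) → (Fin l → ℝ) :=
      fun q => LG (j + 1) A q.1.2.1 q.1.1 b P q.2 - q.1.2.2
    let O : Set (((Fin l → Fin m → ℝ) × (Fin m → ℝ) × (Fin l → ℝ)) × (Fin l → ℝ)) :=
      {q | q.2 ∈ Dl A q.1.2.1 ∧ |q.1.2.2 jj| < |eval q.2 (hatP (j + 1) A q.1.2.1 q.1.1 P)|}
    have hOo : IsOpen O := by
      have hab : Continuous fun q : ((Fin l → Fin m → ℝ) × (Fin m → ℝ) × (Fin l → ℝ)) × (Fin l → ℝ) =>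
        |q.1.2.2 jj| := by fun_prop
      refine IsOpen.inter ?_ (isOpen_lt hab ?_)
      · have : {q : ((Fin l → Fin m → ℝ) × (Fin m → ℝ) × (Fin l → ℝ)) × (Fin l → ℝ) |
            q.2 ∈ Dl A q.1.2.1} = ⋂ s, {q | 0 < zf A q.1.2.1 s q.2} := by
          ext q; simp [Dl]
        change IsOpen {q : ((Fin l → Fin m → ℝ) × (Fin m → ℝ) × (Fin l → ℝ)) × (Fin l → ℝ) |
            q.2 ∈ Dl A q.1.2.1}
        rw [this]
        refine isOpen_iInter_of_finite fun s => isOpen_lt continuous_const ?_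
        unfold zf; fun_prop
      · exact ((hatP_cont (j + 1) A P).comp (g := fun q => eval q.2.2 (hatP (j + 1) A q.2.1 q.1 P))
          (f := fun q : ((Fin l → Fin m → ℝ) × (Fin m → ℝ) × (Fin l → ℝ)) × (Fin l → ℝ) =>
          (q.1.1, q.1.2.1, q.2)) (by fun_prop)).abs
    have hpers := persist F (β0, e0, 0) S O
      (fun x hx => hOo.mem_nhds ⟨(hS x hx).1, by
        simp only [Pi.zero_apply, abs_zero, abs_pos]
        rw [hatP_eval _ _ _ fun s => ((hS x hx).1 s).ne']
        exact mul_ne_zero (Finset.prod_ne_zero_iff.mpr fun s _ => ((hS x hx).1 s).ne') (hS x hx).2.2⟩)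
      (fun x hx => LG_param_contDiffAt _ _ _ _ _ (hS x hx).1)
      (fun x hx => by simp only [F, (hS x hx).2.1, sub_zero])
      (fun x hx => by
        simp only [F, sub_zero]
        rw [show (fun y => LG (j + 1) A e0 β0 b P y) = LG (j + 1) A e0 β0 b P from rfl,
          LG_det (hS x hx).1]
        exact (hS x hx).2.2)
    obtain ⟨U, hU, W1, hW1, hUW⟩ := mem_nhds_prod_iff.mp hpers
    obtain ⟨V, hV, W, hW, hVW⟩ := mem_nhds_prod_iff.mp hW1
    obtain ⟨β, hβU, hA⟩ := genA_dense (j := j) hj'.le β0 hU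
    -- choose e
    obtain ⟨e, ⟨heV, helt⟩, heG⟩ : ∃ e, (e ∈ interior V ∧ ∀ s, e s < e0 s) ∧
        ∀ᵐ v : Fin l → ℝ, GenB (j + 1) A e (fun i => P i - C (v i)) := by
      have h1 := Measure.ae_ae_of_ae_prod (ae_genB (j + 1) A P)
      have h2 : Dense {e : Fin m → ℝ | ∀ᵐ v : Fin l → ℝ, GenB (j + 1) A e (fun i => P i - C (v i))} :=
        Measure.dense_of_ae h1
      have hop : IsOpen {e : Fin m → ℝ | e ∈ interior V ∧ ∀ s, e s < e0 s} := by
        refine isOpen_interior.inter ?_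
        change IsOpen {e : Fin m → ℝ | ∀ s, e s < e0 s}
        simp only [setOf_forall]
        exact isOpen_iInter_of_finite fun s => isOpen_lt (by fun_prop) continuous_const
      have hne : {e : Fin m → ℝ | e ∈ interior V ∧ ∀ s, e s < e0 s}.Nonempty := by
        have hc : Tendsto (fun t : ℝ => fun s => e0 s - t) (𝓝[>] 0) (𝓝 e0) := by
          have : Continuous (fun t : ℝ => fun s => e0 s - t) := by fun_prop
          have h3 := this.tendsto 0
          simp only [sub_zero] at h3
          exact h3.mono_left nhdsWithin_le_nhds
        have h4 := hc.eventually (isOpen_interior.mem_nhds (mem_interior_iff_mem_nhds.mpr hV))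
        obtain ⟨t, ht1, ht2⟩ := (h4.and self_mem_nhdsWithin).exists
        exact ⟨_, ht1, fun s => by simpa using ht2⟩
      obtain ⟨e, he1, he2⟩ := h2.inter_open_nonempty _ hop hne
      exact ⟨e, he1, he2⟩
    have hDsub : Dl A e ⊆ Dl A e0 := by
      intro x hx s
      have := hx s
      simp only [zf] at this ⊢
      linarith [helt s]
    have hbd' : Bornology.IsBounded (Dl A e) := hbd.subset hDsub
    let P1 : Fin l → MvPolynomial (Fin l) ℝ := Function.update P jj (hatP (j + 1) A e β P)
    let H := LG j A e β b P1
    have hHd : ∀ x ∈ Dl A e, DifferentiableAt ℝ H x := fun x hx =>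
      (LG_contDiffAt hx).differentiableAt (by norm_num)
    have hcrit := sard_ae (volume : Measure (Fin l → ℝ)) hHd
    let R : (Fin l → ℝ) →ₗ[ℝ] (Fin l → ℝ) := LinearMap.pi fun i =>
      if i = jj then - LinearMap.proj i else LinearMap.proj i
    have hR : ∀ v, R v = Function.update v jj (- v jj) := by
      intro v; ext i
      simp only [R, LinearMap.pi_apply]
      by_cases h : i = jj
      · subst h; simp
      · simp [h]
    have hRs : Function.Surjective R := by
      intro v
      refine ⟨Function.update v jj (- v jj), ?_⟩
      rw [hR]; simp
    have hae1 : ∀ᵐ v : Fin l → ℝ, v ∉ H '' {x | x ∈ Dl A e ∧ (fderiv ℝ H x).det = 0} :=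
      measure_eq_zero_iff_ae_notMem.mp hcrit
    have hae2 : ∀ᵐ v : Fin l → ℝ, R v ∉ H '' {x | x ∈ Dl A e ∧ (fderiv ℝ H x).det = 0} :=
      ae_lin R volume volume hRs hcrit
    obtain ⟨v, ⟨hvW, hvpos⟩, hvG, hv1, hv2⟩ : ∃ v, (v ∈ interior W ∧ 0 < v jj) ∧
        GenB (j + 1) A e (fun i => P i - C (v i)) ∧
        v ∉ H '' {x | x ∈ Dl A e ∧ (fderiv ℝ H x).det = 0} ∧
        R v ∉ H '' {x | x ∈ Dl A e ∧ (fderiv ℝ H x).det = 0} := by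
      have h2 := Measure.dense_of_ae (heG.and (hae1.and hae2))
      have hop : IsOpen {v : Fin l → ℝ | v ∈ interior W ∧ 0 < v jj} :=
        isOpen_interior.inter (isOpen_lt continuous_const (continuous_apply jj))
      have hne : {v : Fin l → ℝ | v ∈ interior W ∧ 0 < v jj}.Nonempty := by
        have hc : Tendsto (fun t : ℝ => fun s : Fin l => t) (𝓝[>] 0) (𝓝 0) := by
          have : Continuous (fun t : ℝ => fun s : Fin l => t) := by fun_prop
          exact (this.tendsto 0).mono_left nhdsWithin_le_nhds
        have h4 := hc.eventually (isOpen_interior.mem_nhds (mem_interior_iff_mem_nhds.mpr hW))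
        obtain ⟨t, ht1, ht2⟩ := (h4.and self_mem_nhdsWithin).exists
        exact ⟨_, ht1, ht2⟩
      obtain ⟨v, he1, he2⟩ := h2.inter_open_nonempty _ hop hne
      exact ⟨v, he1, he2⟩
    have hmem : ((β, e, v) : (Fin l → Fin m → ℝ) × (Fin m → ℝ) × (Fin l → ℝ)) ∈ U ×ˢ W1 :=
      ⟨hβU, hVW ⟨interior_subset heV, interior_subset hvW⟩⟩
    obtain ⟨S', hcard, hS'⟩ := hUW hmem
    rw [← hcard]
    have hdeg : ∀ i, (P1 i).totalDegree ≤ d i := by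
      intro i
      by_cases h : i = jj
      · subst h
        simp only [P1, Function.update_self]
        rcases hatP_deg (j + 1) hj A e β P d hd (fun i _ => hP i) with h1 | h1
        · have := hdd jj
          simp only [hjj] at this ⊢
          omega
        · rw [h1]; simp
      · simp only [P1, Function.update_of_ne h]; exact hP i
    have hCdeg : ∀ (Q : Fin l → MvPolynomial (Fin l) ℝ) (w : Fin l → ℝ),
        (∀ i, (Q i).totalDegree ≤ d i) → ∀ i, (Q i - C (w i)).totalDegree ≤ d i := by
      intro Q w hQ i
      refine (totalDegree_sub _ _).trans (max_le (hQ i) (by simp))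
    refine core_step hj' (A := A) (e := e) (β := β) (b := b + v) (P := fun i => P i - C (v i)) d hvpos
      hbd' hA hvG (fun i _ => hCdeg P v hP i) _ ?_ S' ?_
    · intro σ hσ T hT
      let v' : Fin l → ℝ := Function.update v jj σ
      have hv' : v' ∉ H '' {x | x ∈ Dl A e ∧ (fderiv ℝ H x).det = 0} := by
        rcases hσ with rfl | rfl
        · simpa [v'] using hv1
        · simpa [v', hR] using hv2
      refine ih hj'.le e β (b + v') (fun i => P1 i - C (v' i)) (hCdeg P1 v' hdeg) hbd' T ?_
      intro x hx
      obtain ⟨hxD, hx1, hx2⟩ := hT x hx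
      have hz : H x = v' := by
        ext i
        by_cases h : i = jj
        · subst h
          rw [hatP_shift] at hx2
          simp [H, LG, v', P1, jj, hx2]
        · have := hx1 i h
          rw [LG_shift] at this
          simp only [Pi.sub_apply, sub_eq_zero] at this
          simp only [v', Function.update_of_ne h]
          rw [← this]
          have hne : (i : ℕ) ≠ j := fun h' => h (Fin.ext h')
          simp only [H, LG, P1, Function.update_of_ne h]
          by_cases h3 : (i : ℕ) < j
          · simp [h3, Nat.lt_succ_of_lt h3]
          · have : ¬ (i : ℕ) < j + 1 := by omega
            simp [h3, this]
      refine ⟨hxD, ?_, ?_⟩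
      · rw [LG_shift]
        exact sub_eq_zero.mpr hz
      · rw [JM_shift, ← LG_det (b := b) hxD]
        intro h0
        exact hv' ⟨x, ⟨hxD, h0⟩, hz⟩
    · intro x hx
      obtain ⟨hO, hz, -⟩ := hS' x hx
      refine ⟨hO.1, ?_, ?_⟩
      · rw [LG_shift]; exact hz
      · rw [hatP_shift]
        have := hO.2
        simp only [abs_of_pos hvpos] at this
        exact this

end LogSysF
end Fewn

open Set Filter Topology

namespace Fewn

section Comp
variable {E : Type*} [NormedAddCommGroup E] [NormedSpace ℝ E]

lemma sep_fun {g : E → ℝ} (hg : Continuous g) {C C' : Set E} (hC : IsClosed C) (hC' : IsClosed C')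
    (hd : Disjoint C C') (hu : C ∪ C' = {y | g y = 0}) :
    ∃ M : E → ℝ, (∀ y, g y ≠ 0 → ∀ᶠ y' in 𝓝 y, M y' = M y) ∧
      (∀ z ∈ C, ∃ L, Tendsto (fun y => M y - if 0 < g y then 1 else 0) (𝓝[{y | g y ≠ 0}] z) (𝓝 L)) ∧
      (∀ z ∈ C', ∃ L, Tendsto M (𝓝[{y | g y ≠ 0}] z) (𝓝 L)) := by
  classical
  obtain ⟨N, hNo, hCN, hNC⟩ := normal_exists_closure_subset hC hC'.isOpen_compl
    (disjoint_left.mp hd)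
  obtain ⟨d, hd0, hd1, hd01⟩ := exists_continuous_zero_one_of_isClosed hNo.isClosed_compl hC
    (disjoint_left.mpr fun x hx hxC => hx (hCN hxC))
  have hdn : ∀ y, 0 ≤ d y := fun y => (hd01 y).1
  let ψ : E → ℝ := fun y => (g y / (|g y| + d y) + 1) / 2
  have hψc : ∀ y, |g y| + d y ≠ 0 → ContinuousAt ψ y := by
    intro y hy
    have h1 : ContinuousAt g y := hg.continuousAt
    have h2 : ContinuousAt d y := d.continuous.continuousAt
    exact ((h1.div (h1.abs.add h2) hy).add continuousAt_const).div_const 2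
  have hgd : ∀ y, g y ≠ 0 → |g y| + d y ≠ 0 := fun y hy =>
    (add_pos_of_pos_of_nonneg (abs_pos.mpr hy) (hdn y)).ne'
  have hψ0 : ∀ y, d y = 0 → g y ≠ 0 → ψ y = if 0 < g y then 1 else 0 := by
    intro y h1 h2
    simp only [ψ, h1, add_zero]
    rcases lt_or_gt_of_ne h2 with h | h
    · rw [abs_of_neg h, if_neg (not_lt.mpr h.le)]
      rw [div_neg, div_self h2]; norm_num
    · rw [abs_of_pos h, if_pos h, div_self h2]; norm_num
  have hC'd : ∀ z ∈ C', ∀ᶠ y in 𝓝 z, d y = 0 := by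
    intro z hz
    have : z ∈ (closure N)ᶜ := fun h => hNC h hz
    filter_upwards [isClosed_closure.isOpen_compl.mem_nhds this] with y hy
    exact hd0 fun h => hy (subset_closure h)
  let θ : E → AddCircle (1:ℝ) := fun y => if |g y| + d y = 0 then 0 else ((ψ y : ℝ) : AddCircle (1:ℝ))
  have hθc : Continuous θ := by
    rw [continuous_iff_continuousAt]
    intro y
    by_cases hy : |g y| + d y = 0
    · have hgy : g y = 0 := by
        have := abs_nonneg (g y); have := hdn y
        exact abs_eq_zero.mp (by linarith)
      have hdy : d y = 0 := by rw [hgy] at hy; simpa using hy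
      have hyC' : y ∈ C' := by
        have : y ∈ C ∪ C' := by rw [hu]; exact hgy
        rcases this with h | h
        · have := hd1 h; simp only [Pi.one_apply] at this; linarith
        · exact h
      have : ∀ᶠ y' in 𝓝 y, θ y' = 0 := by
        filter_upwards [hC'd y hyC'] with y' hy'
        simp only [θ]
        split_ifs with h
        · rfl
        · have hg0 : g y' ≠ 0 := by
            intro h0; apply h; rw [h0, hy']; simp
          rw [hψ0 y' hy' hg0]
          split_ifs
          · exact AddCircle.coe_period 1
          · rfl
      exact (continuousAt_const (y := (0 : AddCircle (1:ℝ)))).congr (this.mono fun _ h => h.symm)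
    · have h1 : ∀ᶠ y' in 𝓝 y, |g y'| + d y' ≠ 0 := by
        have hc : Continuous fun y' => |g y'| + d y' := hg.abs.add d.continuous
        exact hc.continuousAt.eventually_ne hy
      have h2 : ContinuousAt (fun y' => ((ψ y' : ℝ) : AddCircle (1:ℝ))) y :=
        (AddCircle.isCoveringMap_coe (1:ℝ)).continuous.continuousAt.comp (hψc y hy)
      refine h2.congr ?_
      filter_upwards [h1] with y' hy'
      simp [θ, hy']
  obtain ⟨e0, he0⟩ := QuotientAddGroup.mk_surjective (θ 0)
  obtain ⟨F, ⟨-, hF⟩, -⟩ := (AddCircle.isCoveringMap_coe (1:ℝ)).existsUnique_continuousMap_lifts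
    (⟨θ, hθc⟩ : C(E, AddCircle (1:ℝ))) 0 e0 he0
  have hF' : ∀ y, ((F y : ℝ) : AddCircle (1:ℝ)) = θ y := fun y => congrFun hF y
  let s : E → ℝ := fun y => if 0 < g y then 1 else 0
  have hsc : ∀ y, g y ≠ 0 → ContinuousAt s y := by
    intro y hy
    rcases lt_or_gt_of_ne hy with h | h
    · have : ∀ᶠ y' in 𝓝 y, s y' = 0 := by
        filter_upwards [hg.continuousAt.eventually_lt continuousAt_const h] with y' hy'
        simp [s, not_lt.mpr hy'.le]
      exact (continuousAt_const (y := (0:ℝ))).congr (this.mono fun _ h => h.symm)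
    · have : ∀ᶠ y' in 𝓝 y, s y' = 1 := by
        filter_upwards [continuousAt_const.eventually_lt hg.continuousAt h] with y' hy'
        simp [s, hy']
      exact (continuousAt_const (y := (1:ℝ))).congr (this.mono fun _ h => h.symm)
  let M : E → ℝ := fun y => F y - ψ y + s y
  have hMc : ∀ y, g y ≠ 0 → ContinuousAt M y := fun y hy =>
    (F.continuous.continuousAt.sub (hψc y (hgd y hy))).add (hsc y hy)
  have hMi : ∀ y, g y ≠ 0 → ∃ k : ℤ, M y = k := by
    intro y hy
    have h1 : ((M y : ℝ) : AddCircle (1:ℝ)) = 0 := by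
      have h2 : ((s y : ℝ) : AddCircle (1:ℝ)) = 0 := by
        simp only [s]; split_ifs
        · exact AddCircle.coe_period 1
        · rfl
      simp only [M, AddCircle.coe_add, AddCircle.coe_sub, h2, hF', θ, hgd y hy, if_false, sub_self,
        add_zero]
    obtain ⟨k, hk⟩ := (AddCircle.coe_eq_zero_iff (1:ℝ)).mp h1
    exact ⟨k, by rw [← hk]; simp⟩
  refine ⟨M, ?_, ?_, ?_⟩
  · intro y hy
    have h1 := (hMc y hy).eventually (Metric.ball_mem_nhds (M y) (ε := 1) one_pos)
    filter_upwards [h1, hg.continuousAt.eventually_ne hy] with y' h2 h3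
    obtain ⟨k, hk⟩ := hMi y hy
    obtain ⟨k', hk'⟩ := hMi y' h3
    rw [hk, hk'] at h2 ⊢
    rw [Real.dist_eq] at h2
    have : |k' - k| < 1 := by exact_mod_cast h2
    rw [Int.abs_lt_one_iff] at this
    have : k' = k := by omega
    rw [this]
  · intro z hz
    refine ⟨F z - ψ z, ?_⟩
    have h1 : |g z| + d z ≠ 0 := by
      have := hd1 hz
      simp only [Pi.one_apply] at this
      rw [this]; positivity
    have h2 : ContinuousAt (fun y => F y - ψ y) z := F.continuous.continuousAt.sub (hψc z h1)
    refine (h2.tendsto.mono_left nhdsWithin_le_nhds).congr fun y => ?_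
    simp only [M, s]; ring
  · intro z hz
    refine ⟨F z, ?_⟩
    refine (F.continuous.continuousAt.tendsto.mono_left nhdsWithin_le_nhds).congr' ?_
    filter_upwards [mem_nhdsWithin_of_mem_nhds (hC'd z hz), self_mem_nhdsWithin] with y h1 h2
    simp only [M, s, hψ0 y h1 h2]; ring

/-- locally constant functions descend to connected components -/
lemma cc_const {g : E → ℝ} {M : E → ℝ} (hM : ∀ y, g y ≠ 0 → ∀ᶠ y' in 𝓝 y, M y' = M y)
    (x y : {y // g y ≠ 0}) (h : (x : ConnectedComponents {y // g y ≠ 0}) = y) : M x = M y := by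
  have hl : IsLocallyConstant (fun y : {y // g y ≠ 0} => M y) := by
    rw [IsLocallyConstant.iff_eventually_eq]
    intro y
    have := hM y y.2
    rw [nhds_subtype_eq_comap]
    exact this.comap _
  rw [ConnectedComponents.coe_eq_coe'] at h
  exact hl.apply_eq_of_isPreconnected isPreconnected_connectedComponent h mem_connectedComponent

theorem comps_lt {g : E → ℝ} (hg : Continuous g)
    (hp : ∀ z, g z = 0 → z ∈ closure {y | 0 < g y} ∧ z ∈ closure {y | g y < 0})
    (hne : ∃ y, g y ≠ 0)
    (hfin : Finite (ConnectedComponents {y // g y ≠ 0})) {M : ℕ}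
    (f : {y // g y = 0} → Fin M) (hf : Continuous f) (hs : Function.Surjective f) :
    M + 1 ≤ Nat.card (ConnectedComponents {y // g y ≠ 0}) := by
  classical
  have hZ : IsClosed {y | g y = 0} := isClosed_eq hg continuous_const
  have hcl : ∀ T : Set (Fin M), IsClosed ((Subtype.val : {y // g y = 0} → E) '' (f ⁻¹' T)) := by
    intro T
    exact (hZ.isClosedEmbedding_subtypeVal.isClosedMap) _ ((isClosed_discrete T).preimage hf)
  have H : ∀ i : Fin M, _ := fun i => sep_fun hg (hcl {i}) (hcl {i}ᶜ)
    (by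
      rw [disjoint_left]
      rintro _ ⟨x, hx, rfl⟩ ⟨y, hy, hxy⟩
      have : y = x := Subtype.ext hxy
      subst this
      exact hy hx)
    (by
      rw [← image_union, ← preimage_union, union_compl_self]
      ext y; simp)
  choose m h1 h2 h3 using H
  haveI := Fintype.ofFinite (ConnectedComponents {y // g y ≠ 0})
  let mm : Fin M → ConnectedComponents {y // g y ≠ 0} → ℝ := fun i q =>
    m i ((Classical.choose (ConnectedComponents.surjective_coe q) : {y // g y ≠ 0}) : E)
  have hmm : ∀ i (y : {y // g y ≠ 0}), mm i (y : ConnectedComponents {y // g y ≠ 0}) = m i y := by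
    intro i y
    exact cc_const (h1 i) _ _ (Classical.choose_spec (ConnectedComponents.surjective_coe
      (y : ConnectedComponents {y // g y ≠ 0})))
  have hli : LinearIndependent ℝ (fun o : Option (Fin M) => (match o with
      | none => (fun _ => (1:ℝ))
      | some i => mm i : ConnectedComponents {y // g y ≠ 0} → ℝ)) := by
    rw [Fintype.linearIndependent_iff]
    intro lam hlam
    have hsum : ∀ y, g y ≠ 0 → lam none + ∑ i, lam (some i) * m i y = 0 := by
      intro y hy
      have := congrFun hlam ((⟨y, hy⟩ : {y // g y ≠ 0}) : ConnectedComponents {y // g y ≠ 0})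
      rw [Fintype.sum_option] at this
      simp only [Pi.add_apply, Finset.sum_apply, Pi.smul_apply, smul_eq_mul, mul_one, Pi.zero_apply,
        hmm] at this
      exact this
    have hsome : ∀ i, lam (some i) = 0 := by
      intro i
      obtain ⟨z, hz⟩ := hs i
      have hzC : (z : E) ∈ (Subtype.val : {y // g y = 0} → E) '' (f ⁻¹' {i}) := ⟨z, hz, rfl⟩
      have key : ∀ j, ∃ L, Tendsto (fun y => m j y - if j = i then (if 0 < g y then 1 else 0) else 0)
          (𝓝[{y | g y ≠ 0}] (z : E)) (𝓝 L) := by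
        intro j
        by_cases hj : j = i
        · subst hj
          simpa using h2 j z hzC
        · simp only [hj, if_false, sub_zero]
          exact h3 j z ⟨z, by simp only [mem_preimage, mem_compl_iff, mem_singleton_iff, hz]; exact fun h => hj h.symm, rfl⟩
      choose L hL using key
      have hT : Tendsto (fun y => ∑ j, lam (some j) *
          (m j y - if j = i then (if 0 < g y then 1 else 0) else 0))
          (𝓝[{y | g y ≠ 0}] (z : E)) (𝓝 (∑ j, lam (some j) * L j)) :=
        tendsto_finsetSum _ fun j _ => (hL j).const_mul _
      have heq : ∀ y, g y ≠ 0 → ∑ j, lam (some j) *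
          (m j y - if j = i then (if 0 < g y then 1 else 0) else 0) =
          - lam none - lam (some i) * (if 0 < g y then 1 else 0) := by
        intro y hy
        have := hsum y hy
        simp only [mul_sub, Finset.sum_sub_distrib]
        have h5 : ∑ j, lam (some j) * (if j = i then (if 0 < g y then (1:ℝ) else 0) else 0) =
            lam (some i) * (if 0 < g y then 1 else 0) := by
          rw [Finset.sum_eq_single i] <;> simp +contextual
        rw [h5]; linarith
      have hpos : (𝓝[{y | 0 < g y}] (z : E)).NeBot := mem_closure_iff_nhdsWithin_neBot.mp (hp z z.2).1
      have hneg : (𝓝[{y | g y < 0}] (z : E)).NeBot := mem_closure_iff_nhdsWithin_neBot.mp (hp z z.2).2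
      have ht1 : Tendsto (fun _ : E => - lam none - lam (some i)) (𝓝[{y | 0 < g y}] (z : E))
          (𝓝 (∑ j, lam (some j) * L j)) := by
        refine (hT.mono_left (nhdsWithin_mono _ fun y hy => ne_of_gt hy)).congr' ?_
        filter_upwards [self_mem_nhdsWithin] with y hy
        have hy' : 0 < g y := hy
        rw [heq y hy'.ne', if_pos hy', mul_one]
      have ht2 : Tendsto (fun _ : E => - lam none) (𝓝[{y | g y < 0}] (z : E))
          (𝓝 (∑ j, lam (some j) * L j)) := by
        refine (hT.mono_left (nhdsWithin_mono _ fun y hy => ne_of_lt hy)).congr' ?_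
        filter_upwards [self_mem_nhdsWithin] with y hy
        have hy' : g y < 0 := hy
        rw [heq y hy'.ne, if_neg (not_lt.mpr hy'.le), mul_zero, sub_zero]
      have e1 := tendsto_nhds_unique ht1 tendsto_const_nhds
      have e2 := tendsto_nhds_unique ht2 tendsto_const_nhds
      linarith
    intro o
    cases o with
    | some i => exact hsome i
    | none =>
      obtain ⟨y, hy⟩ := hne
      have := hsum y hy
      simpa [hsome] using this
  have := hli.fintype_card_le_finrank
  simpa using this

theorem comps_bound {Z : Type*} [TopologicalSpace Z] {R : ℕ}
    (h : ∀ (M : ℕ) (f : Z → Fin M), Continuous f → Function.Surjective f → M ≤ R) :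
    Finite (ConnectedComponents Z) ∧ Nat.card (ConnectedComponents Z) ≤ R := by
  classical
  by_cases hZ : Nonempty Z
  swap
  · rw [not_nonempty_iff] at hZ
    haveI : IsEmpty (ConnectedComponents Z) := ⟨fun q => by
      obtain ⟨z, -⟩ := ConnectedComponents.surjective_coe q; exact hZ.elim z⟩
    exact ⟨inferInstance, by simp⟩
  let Pd : ℕ → Prop := fun M => ∃ f : Z → Fin M, Continuous f ∧ Function.Surjective f
  have hP1 : Pd 1 := ⟨fun _ => 0, continuous_const, fun i => ⟨hZ.some, Subsingleton.elim _ _⟩⟩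
  have hPb : ∀ M, Pd M → M ≤ R := fun M ⟨f, h1, h2⟩ => h M f h1 h2
  have h1R := hPb 1 hP1
  let M := Nat.findGreatest Pd R
  have hM : Pd M := Nat.findGreatest_spec h1R hP1
  have hmax : ¬ Pd (M + 1) := fun hc => by
    have := Nat.le_findGreatest (hPb _ hc) hc
    change M + 1 ≤ M at this
    omega
  obtain ⟨f, hfc, hfs⟩ := hM
  have hfib : ∀ i, IsPreconnected (f ⁻¹' {i}) := by
    intro i
    by_contra hcon
    rw [isPreconnected_iff_subset_of_disjoint] at hcon
    push Not at hcon
    obtain ⟨u, v, hu, hv, huv, hdis, hnu, hnv⟩ := hcon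
    have hio : IsOpen (f ⁻¹' {i}) := (isOpen_discrete {i}).preimage hfc
    rw [not_subset] at hnu hnv
    obtain ⟨x, hxf, hxu⟩ := hnu
    obtain ⟨y, hyf, hyv⟩ := hnv
    have hxv : x ∈ v := (huv hxf).resolve_left hxu
    have hyu : y ∈ u := (huv hyf).resolve_right hyv
    apply hmax
    let f' : Z → Fin (M + 1) := fun z => if f z = i ∧ z ∈ u then Fin.last M else (f z).castSucc
    have hcl : IsClopen {z | f z = i ∧ z ∈ u} := by
      constructor
      · have : {z | f z = i ∧ z ∈ u} = ((f ⁻¹' {i})ᶜ ∪ (f ⁻¹' {i} ∩ v))ᶜ := by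
          ext z
          simp only [mem_setOf_eq, mem_compl_iff, mem_union, mem_preimage, mem_singleton_iff,
            mem_inter_iff]
          constructor
          · rintro ⟨h1, h2⟩ (h3 | h3)
            · exact h3 h1
            · have : z ∈ f ⁻¹' {i} ∩ (u ∩ v) := ⟨h1, h2, h3.2⟩
              rw [hdis] at this; exact this
          · intro h3
            push Not at h3
            exact ⟨h3.1, (huv h3.1).resolve_right (h3.2 h3.1)⟩
        rw [this, isClosed_compl_iff]
        exact (((isClosed_discrete {i}).preimage hfc).isOpen_compl).union (hio.inter hv)
      · exact hio.inter hu
    refine ⟨f', ?_, ?_⟩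
    · exact continuous_const.if (fun a ha => by
        have hh : frontier {z | f z = i ∧ z ∈ u} = ∅ := hcl.frontier_eq
        rw [hh] at ha; exact ha.elim) ((continuous_of_discreteTopology (f := Fin.castSucc)).comp hfc)
    · intro t
      refine Fin.lastCases ?_ (fun t => ?_) t
      · exact ⟨y, by simp only [f']; rw [if_pos ⟨hyf, hyu⟩]⟩
      · by_cases ht : t = i
        · subst ht
          exact ⟨x, by simp only [f']; rw [if_neg (fun h => hxu h.2)]; rw [show f x = t from hxf]⟩
        · obtain ⟨z, hz⟩ := hfs t
          exact ⟨z, by simp only [f']; rw [if_neg (fun h => ht (hz ▸ h.1)), hz]⟩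
  let φ : ConnectedComponents Z → Fin M := hfc.connectedComponentsLift
  have hinj : Function.Injective φ := by
    intro p q hpq
    obtain ⟨x, rfl⟩ := ConnectedComponents.surjective_coe p
    obtain ⟨y, rfl⟩ := ConnectedComponents.surjective_coe q
    have hxy : f x = f y := hpq
    rw [ConnectedComponents.coe_eq_coe']
    exact (hfib (f y)).subset_connectedComponent rfl hxy
  haveI := Finite.of_injective φ hinj
  refine ⟨inferInstance, ?_⟩
  have := Nat.card_le_card_of_injective φ hinj
  simp only [Nat.card_fin] at this
  exact this.trans (Nat.findGreatest_le _)

end Comp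
end Fewn

open Set Filter Topology

namespace Fewn

section GaleA
open MeasureTheory

/-- twice the component bound -/
def BB (m D l : ℕ) : ℕ := 2 * (2 ^ (l.choose 2) * D ^ l) +
  ∑ s ∈ Finset.range l, m.choose (s + 1) * (2 ^ ((l - 1 - s).choose 2) * D ^ (l - 1 - s))

lemma prod_pow_range (D q : ℕ) : ∏ i ∈ Finset.range q, (2 ^ i * D) = 2 ^ (q.choose 2) * D ^ q := by
  induction q with
  | zero => simp
  | succ q ih =>
    rw [Finset.prod_range_succ, ih, Nat.choose_succ_succ' q 1, Nat.choose_one_right, pow_add, pow_succ]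
    ring

lemma sum_pow_range (D q : ℕ) : ∑ i ∈ Finset.range q, (2 ^ i * D) + D = 2 ^ q * D := by
  induction q with
  | zero => simp
  | succ q ih =>
    rw [Finset.sum_range_succ, pow_succ]
    linarith

lemma prod_tail (D l s : ℕ) (hs : s < l) :
    ∏ i : Fin l, (if s < (i : ℕ) then 2 ^ (l - 1 - (i : ℕ)) * D else 1) =
      2 ^ ((l - 1 - s).choose 2) * D ^ (l - 1 - s) := by
  rw [Fin.prod_univ_eq_prod_range (fun i => if s < i then 2 ^ (l - 1 - i) * D else 1) l,
    ← Finset.prod_range_reflect, ← prod_pow_range]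
  rw [← Finset.prod_filter_mul_prod_filter_not (Finset.range l) (fun i => i < l - 1 - s)]
  rw [Finset.prod_congr rfl (g := fun i => 2 ^ i * D) (fun i hi => ?_), Finset.prod_eq_one (s := Finset.filter (fun i => ¬ _) _), mul_one]
  · congr 1
    ext i; simp; omega
  · intro i hi
    simp only [Finset.mem_filter, Finset.mem_range] at hi
    rw [if_neg (by omega)]
  · simp only [Finset.mem_filter, Finset.mem_range] at hi
    rw [if_pos (by omega)]
    congr 2; omega

lemma sum_tail (D l s : ℕ) (hs : s < l) :
    ∑ i : Fin l, (if s + 1 ≤ (i : ℕ) then 2 ^ (l - 1 - (i : ℕ)) * D else 0) + D =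
      2 ^ (l - 1 - s) * D := by
  rw [Fin.sum_univ_eq_sum_range (fun i => if s + 1 ≤ i then 2 ^ (l - 1 - i) * D else 0) l,
    ← Finset.sum_range_reflect, ← sum_pow_range]
  rw [← Finset.sum_filter_add_sum_filter_not (Finset.range l) (fun i => i < l - 1 - s)]
  rw [Finset.sum_congr rfl (g := fun i => 2 ^ i * D) (fun i hi => ?_), Finset.sum_eq_zero (s := Finset.filter (fun i => ¬ _) _), add_zero]
  · congr 2
    ext i; simp; omega
  · intro i hi
    simp only [Finset.mem_filter, Finset.mem_range] at hi
    rw [if_neg (by omega)]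
  · simp only [Finset.mem_filter, Finset.mem_range] at hi
    rw [if_pos (by omega)]
    congr 2; omega

lemma prod_all (D l : ℕ) :
    ∏ i : Fin l, (2 ^ (l - 1 - (i : ℕ)) * D) = 2 ^ (l.choose 2) * D ^ l := by
  rw [Fin.prod_univ_eq_prod_range (fun i => 2 ^ (l - 1 - i) * D) l,
    ← Finset.prod_range_reflect, ← prod_pow_range]
  refine Finset.prod_congr rfl fun i hi => ?_
  simp only [Finset.mem_range] at hi
  congr 2; omega

theorem log_count' {l m D : ℕ} (hD : 1 ≤ D) (hm : m ≤ D + l) (A : Fin m → Fin l → ℝ)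
    (e : Fin m → ℝ) (β : Fin l → Fin m → ℝ) (b : Fin l → ℝ)
    (hbd : Bornology.IsBounded (Dl A e)) (S : Finset (Fin l → ℝ))
    (hS : ∀ x ∈ S, x ∈ Dl A e ∧ (∀ i, lf A e (β i) x = b i) ∧
      (JM l A e β 0 x).det ≠ 0) : 2 * S.card ≤ BB m D l := by
  have := log_count (l := l) (m := m) (fun i => 2 ^ (l - 1 - (i : ℕ)) * D)
    (fun i => Nat.one_le_iff_ne_zero.mpr (by positivity)) (fun j => by
      have := sum_tail D l j j.2
      omega) A l le_rfl e β b 0 (fun i => by simp) hbd S (fun x hx => by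
      obtain ⟨h1, h2, h3⟩ := hS x hx
      refine ⟨h1, ?_, h3⟩
      ext i
      simp [LG, h2 i])
  rw [prod_all] at this
  refine this.trans (le_of_eq ?_)
  unfold BB
  congr 1
  refine Finset.sum_congr rfl fun s hs => ?_
  rw [prod_tail D l s (Finset.mem_range.mp hs)]

variable {ι : Type*} [Fintype ι]

/-- orthogonal complement for the dot product -/
def orth (K : Submodule ℝ (ι → ℝ)) : Submodule ℝ (ι → ℝ) where
  carrier := {t | ∀ z ∈ K, ∑ i, z i * t i = 0}
  add_mem' := by
    intro a b ha hb z hz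
    have h1 := ha z hz
    have h2 := hb z hz
    simp only [Pi.add_apply, mul_add, Finset.sum_add_distrib]
    rw [h1, h2, add_zero]
  zero_mem' := by intro z hz; simp
  smul_mem' := by
    intro c a ha z hz
    have h1 := ha z hz
    simp only [Pi.smul_apply, smul_eq_mul]
    rw [show ∑ i, z i * (c * a i) = c * ∑ i, z i * a i by
      rw [Finset.mul_sum]; exact Finset.sum_congr rfl fun i _ => by ring]
    rw [h1, mul_zero]

lemma mem_orth {K : Submodule ℝ (ι → ℝ)} {t : ι → ℝ} :
    t ∈ orth K ↔ ∀ z ∈ K, ∑ i, z i * t i = 0 := Iff.rfl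


lemma orth_eq (K : Submodule ℝ (ι → ℝ)) :
    orth K = LinearMap.BilinForm.orthogonal (dotProductBilin ℝ ℝ : LinearMap.BilinForm ℝ (ι → ℝ)) K := by
  ext t
  rfl

lemma dp_nondeg : (dotProductBilin ℝ ℝ : LinearMap.BilinForm ℝ (ι → ℝ)).Nondegenerate := by
  constructor
  · intro x hx
    exact dotProduct_self_eq_zero.mp (hx x)
  · intro x hx
    exact dotProduct_self_eq_zero.mp (hx x)

lemma dp_refl : (dotProductBilin ℝ ℝ : LinearMap.BilinForm ℝ (ι → ℝ)).IsRefl := by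
  intro x y h
  have h1 : dotProduct x y = 0 := h
  change dotProduct y x = 0
  rwa [dotProduct_comm]

lemma orth_orth (K : Submodule ℝ (ι → ℝ)) : orth (orth K) = K := by
  rw [orth_eq, orth_eq, LinearMap.BilinForm.orthogonal_orthogonal dp_nondeg dp_refl]

lemma orth_finrank (K : Submodule ℝ (ι → ℝ)) :
    Module.finrank ℝ K + Module.finrank ℝ (orth K) = Fintype.card ι := by
  have h := LinearMap.BilinForm.finrank_orthogonal dp_nondeg K
  rw [← orth_eq, Module.finrank_fintype_fun_eq_card] at h
  have := Submodule.finrank_le K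
  rw [Module.finrank_fintype_fun_eq_card] at this
  omega

/-- regularity of a coefficient vector -/
def Reg (K : Submodule ℝ (ι → ℝ)) (c : ι → ℝ) : Prop :=
  ∀ z ∈ K, ∀ t ∈ orth K, (∀ i, z i = c i * Real.exp (t i)) → ∀ w ∈ K, ∀ v ∈ orth K,
    (∀ i, w i = z i * v i) → w = 0

lemma reg_ae (K : Submodule ℝ (ι → ℝ)) : ∀ᵐ c : ι → ℝ, Reg K c := by
  classical
  have hfr : Module.finrank ℝ (ι → ℝ) = Module.finrank ℝ (K × orth K) := by
    rw [Module.finrank_prod, orth_finrank, Module.finrank_fintype_fun_eq_card]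
  let L : (ι → ℝ) ≃ₗ[ℝ] (K × orth K) := LinearEquiv.ofFinrankEq _ _ hfr
  let L1 : (ι → ℝ) →L[ℝ] (ι → ℝ) := LinearMap.toContinuousLinearMap
    (K.subtype ∘ₗ LinearMap.fst ℝ _ _ ∘ₗ L.toLinearMap)
  let L2 : (ι → ℝ) →L[ℝ] (ι → ℝ) := LinearMap.toContinuousLinearMap
    ((orth K).subtype ∘ₗ LinearMap.snd ℝ _ _ ∘ₗ L.toLinearMap)
  let f : (ι → ℝ) → (ι → ℝ) := fun x i => L1 x i * Real.exp (- L2 x i)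
  have hf : ∀ x, HasFDerivAt f (ContinuousLinearMap.pi fun i =>
      (L1 x i) • (Real.exp (- L2 x i) • (-((ContinuousLinearMap.proj i).comp L2))) +
      (Real.exp (- L2 x i)) • ((ContinuousLinearMap.proj i).comp L1)) x := by
    intro x
    rw [hasFDerivAt_pi]
    intro i
    have h1 : HasFDerivAt (fun x => L1 x i) ((ContinuousLinearMap.proj i).comp L1) x :=
      ((ContinuousLinearMap.proj (R := ℝ) (φ := fun _ : ι => ℝ) i).comp L1).hasFDerivAt
    have h2 : HasFDerivAt (fun x => L2 x i) ((ContinuousLinearMap.proj i).comp L2) x :=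
      ((ContinuousLinearMap.proj (R := ℝ) (φ := fun _ : ι => ℝ) i).comp L2).hasFDerivAt
    exact h1.mul h2.neg.exp
  have hnull := sard_ae (volume : Measure (ι → ℝ)) (f := f) (D := univ)
    (fun x _ => (hf x).differentiableAt)
  filter_upwards [measure_eq_zero_iff_ae_notMem.mp hnull] with c hc z hz t ht hzt w hw v hv hwv
  by_contra hne
  apply hc
  refine ⟨L.symm (⟨z, hz⟩, ⟨t, ht⟩), ⟨trivial, ?_⟩, ?_⟩
  · rw [ContinuousLinearMap.det, LinearMap.det_eq_zero_iff_ker_ne_bot]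
    intro hbot
    have hmem : L.symm (⟨w, hw⟩, ⟨v, hv⟩) ∈
        LinearMap.ker (fderiv ℝ f (L.symm (⟨z, hz⟩, ⟨t, ht⟩)) : (ι → ℝ) →ₗ[ℝ] (ι → ℝ)) := by
      rw [LinearMap.mem_ker, (hf _).fderiv]
      ext i
      simp [L1, L2]
      rw [hwv i]; ring
    rw [hbot, Submodule.mem_bot, LinearEquiv.map_eq_zero_iff] at hmem
    exact hne (congrArg (fun p => ((p.1 : K) : ι → ℝ)) hmem)
  · ext i
    simp only [f]
    simp [L1, L2]
    rw [hzt i, mul_assoc, ← Real.exp_add]; simp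

/-- the function on the row space -/
noncomputable def hh (c0 : ℝ) (c t : ι → ℝ) : ℝ := c0 + ∑ i, c i * Real.exp (t i)

lemma hh_cont (c0 : ℝ) (c : ι → ℝ) : Continuous (hh c0 c) := by
  unfold hh; fun_prop

lemma crit_one (K : Submodule ℝ (ι → ℝ)) (c0 : ℝ) (c : ι → ℝ) (Q : Set (orth K))
    (ho : IsOpen Q) (hb : Bornology.IsBounded Q) (hne : Q.Nonempty)
    (hnz : ∀ t ∈ Q, hh c0 c t ≠ 0) (hcl : ∀ t ∈ closure Q, hh c0 c t ≠ 0 → t ∈ Q) :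
    ∀ᶠ c' in 𝓝 c, ∃ t ∈ Q, (fun i => c' i * Real.exp ((t : ι → ℝ) i)) ∈ K := by
  obtain ⟨t0, ht0⟩ := hne
  set η := |hh c0 c t0| with hη
  have hη0 : 0 < η := abs_pos.mpr (hnz t0 ht0)
  have hK : IsCompact (closure Q) := hb.isCompact_closure
  have hcont : ∀ c' : ι → ℝ, Continuous fun t : orth K => |hh c0 c' (t : ι → ℝ)| := fun c' =>
    ((hh_cont c0 c').comp continuous_subtype_val).abs
  have hEc : Continuous fun t : orth K => ∑ i, Real.exp ((t : ι → ℝ) i) := by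
    refine continuous_finsetSum _ fun i _ => Real.continuous_exp.comp ?_
    exact (continuous_apply i).comp continuous_subtype_val
  obtain ⟨B, hB⟩ := (hK.image hEc).bddAbove
  have hB' : ∀ t ∈ closure Q, ∑ i, Real.exp ((t : ι → ℝ) i) ≤ B := fun t ht => hB ⟨t, ht, rfl⟩
  have hB0 : 0 ≤ B := le_trans (Finset.sum_nonneg fun i _ => (Real.exp_pos _).le)
    (hB' t0 (subset_closure ht0))
  have hr : 0 < η / (3 * (B + 1)) := by positivity
  filter_upwards [Metric.ball_mem_nhds c hr] with c' hc'
  have hdiff : ∀ t ∈ closure Q, |hh c0 c' t - hh c0 c t| < η / 3 := by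
    intro t ht
    have h1 : hh c0 c' t - hh c0 c t = ∑ i, (c' i - c i) * Real.exp ((t : ι → ℝ) i) := by
      simp only [hh, sub_mul, Finset.sum_sub_distrib]; ring
    rw [h1]
    calc |∑ i, (c' i - c i) * Real.exp ((t : ι → ℝ) i)|
        ≤ ∑ i, |(c' i - c i) * Real.exp ((t : ι → ℝ) i)| := Finset.abs_sum_le_sum_abs _ _
      _ ≤ ∑ i, dist c' c * Real.exp ((t : ι → ℝ) i) := by
          refine Finset.sum_le_sum fun i _ => ?_
          rw [abs_mul, Real.abs_exp]
          refine mul_le_mul_of_nonneg_right ?_ (Real.exp_pos _).le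
          rw [← Real.dist_eq]; exact dist_le_pi_dist c' c i
      _ = dist c' c * ∑ i, Real.exp ((t : ι → ℝ) i) := by rw [Finset.mul_sum]
      _ ≤ dist c' c * (B + 1) := by
          refine mul_le_mul_of_nonneg_left ?_ dist_nonneg
          linarith [hB' t ht]
      _ < η / (3 * (B + 1)) * (B + 1) := by
          exact mul_lt_mul_of_pos_right hc' (by positivity)
      _ = η / 3 := by field_simp
  obtain ⟨t, htc, htmax⟩ := hK.exists_isMaxOn ⟨t0, subset_closure ht0⟩ (hcont c').continuousOn
  have h0 : |hh c0 c' t0| ≤ |hh c0 c' t| := htmax (subset_closure ht0)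
  have h1 : η - η / 3 < |hh c0 c' t0| := by
    have := hdiff t0 (subset_closure ht0)
    have h2 := abs_sub_abs_le_abs_sub (hh c0 c t0) (hh c0 c' t0)
    rw [abs_sub_comm] at h2
    linarith
  have htQ : t ∈ Q := by
    by_contra hcon
    have h2 : hh c0 c t = 0 := by
      by_contra h3; exact hcon (hcl t htc h3)
    have h3 := hdiff t htc
    rw [h2, sub_zero] at h3
    linarith
  refine ⟨t, htQ, ?_⟩
  suffices hsuf : (fun i => c' i * Real.exp ((t : ι → ℝ) i)) ∈ orth (orth K) by
    rwa [orth_orth K] at hsuf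
  rw [mem_orth]
  intro s hs
  have hne' : hh c0 c' t ≠ 0 := by
    intro h2; rw [h2, abs_zero] at h0; linarith
  -- derivative along s
  let sK : orth K := ⟨s, hs⟩
  let φ : ℝ → ℝ := fun τ => hh c0 c' ((t + τ • sK : orth K) : ι → ℝ)
  have hφ : HasDerivAt φ (∑ i, c' i * (Real.exp ((t : ι → ℝ) i) * s i)) 0 := by
    have : φ = fun τ => c0 + ∑ i, c' i * Real.exp ((t : ι → ℝ) i + τ * s i) := by
      ext τ; simp [φ, hh, sK]
    rw [this]
    refine HasDerivAt.const_add c0 (HasDerivAt.fun_sum fun i _ => ?_)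
    have h2 : HasDerivAt (fun τ : ℝ => (t : ι → ℝ) i + τ * s i) (s i) 0 := by
      simpa using ((hasDerivAt_id (0:ℝ)).mul_const (s i)).const_add ((t : ι → ℝ) i)
    have h3 := h2.exp
    simp only [zero_mul, add_zero] at h3
    exact h3.const_mul (c' i)
  have hpc : Continuous fun τ : ℝ => (t + τ • sK : orth K) := by fun_prop
  have hev : ∀ᶠ τ in 𝓝 (0:ℝ), |φ τ| ≤ |φ 0| := by
    have h2 : ∀ᶠ τ in 𝓝 (0:ℝ), (t + τ • sK : orth K) ∈ Q := by
      apply hpc.continuousAt.eventually (ho.mem_nhds _)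
      simpa using htQ
    filter_upwards [h2] with τ hτ
    have := htmax (subset_closure hτ)
    simpa [φ] using this
  have hφ0 : φ 0 ≠ 0 := by simpa [φ] using hne'
  have hext : IsLocalExtr φ 0 := by
    rcases lt_or_gt_of_ne hφ0 with h2 | h2
    · left
      filter_upwards [hev] with τ hτ
      rw [abs_of_neg h2] at hτ
      linarith [neg_abs_le (φ τ)]
    · right
      filter_upwards [hev] with τ hτ
      rw [abs_of_pos h2] at hτ
      linarith [le_abs_self (φ τ)]
  have := hext.hasDerivAt_eq_zero hφ
  rw [← this]
  exact Finset.sum_congr rfl fun i _ => by ring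

end GaleA
end Fewn

open Set Filter Topology

namespace Fewn

section GaleB
open MeasureTheory

variable {ι : Type*} [Fintype ι]

lemma ker_param (l : ℕ) (K : Submodule ℝ (ι → ℝ)) (hK : Module.finrank ℝ K = l + 1)
    (φ : (ι → ℝ) →ₗ[ℝ] ℝ) (v : ι → ℝ) (hvK : v ∈ K) (hv : φ v ≠ 0) :
    ∃ ω : (Fin l → ℝ) →ₗ[ℝ] (ι → ℝ), Function.Injective ω ∧ (∀ x, ω x ∈ K) ∧ (∀ x, φ (ω x) = 0) ∧
      ∀ z ∈ K, φ z = 0 → ∃ x, ω x = z := by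
  let ψ : K →ₗ[ℝ] ℝ := φ ∘ₗ K.subtype
  have h1 := LinearMap.finrank_range_add_finrank_ker ψ
  have h2 : LinearMap.range ψ = ⊤ := LinearMap.range_eq_top.mpr
    (LinearMap.surjective (fun h => hv (by
      have : ψ ⟨v, hvK⟩ = 0 := by rw [h]; rfl
      exact this)))
  rw [h2, finrank_top, Module.finrank_self] at h1
  let W := (LinearMap.ker ψ).map K.subtype
  have h3 : Module.finrank ℝ W = l := by
    rw [LinearEquiv.finrank_eq (Submodule.equivMapOfInjective K.subtype K.injective_subtype
      (LinearMap.ker ψ)).symm]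
    omega
  let E : (Fin l → ℝ) ≃ₗ[ℝ] W := LinearEquiv.ofFinrankEq _ _ (by simp [h3])
  have hW : ∀ z, z ∈ W ↔ z ∈ K ∧ φ z = 0 := by
    intro z
    simp only [W, Submodule.mem_map, LinearMap.mem_ker]
    constructor
    · rintro ⟨y, hy, rfl⟩; exact ⟨y.2, hy⟩
    · rintro ⟨hz, h0⟩; exact ⟨⟨z, hz⟩, h0, rfl⟩
  refine ⟨W.subtype ∘ₗ E.toLinearMap, W.injective_subtype.comp E.injective,
    fun x => ((hW _).mp (E x).2).1, fun x => ((hW _).mp (E x).2).2, fun z hz h0 => ?_⟩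
  refine ⟨E.symm ⟨z, (hW z).mpr ⟨hz, h0⟩⟩, by simp⟩

theorem gale_count [Nonempty ι] {l m D : ℕ} (hD : 1 ≤ D) (hm : m ≤ D + l)
    (K : Submodule ℝ (ι → ℝ)) (hK : Module.finrank ℝ K = l + 1) (rep : Fin m → ι) (ρ : ι → Fin m)
    (κ : ι → ℝ) (hκ : ∀ z ∈ K, ∀ i, z i = κ i * z (rep (ρ i))) (c : ι → ℝ) (hc : ∀ i, c i ≠ 0)
    (hreg : Reg K c) (T : Finset (ι → ℝ))
    (hT : ∀ t ∈ T, t ∈ orth K ∧ (fun i => c i * Real.exp (t i)) ∈ K) :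
    2 * T.card ≤ BB m D l := by
  classical
  rcases T.eq_empty_or_nonempty with rfl | ⟨t0, ht0⟩
  · simp
  obtain ⟨ht0o, hz0⟩ := hT t0 ht0
  let zt : (ι → ℝ) → ι → ℝ := fun t i => c i * Real.exp (t i)
  have hzt : ∀ t i, zt t i = c i * Real.exp (t i) := fun _ _ => rfl
  have hztne : ∀ t i, zt t i ≠ 0 := fun t i => mul_ne_zero (hc i) (Real.exp_ne_zero _)
  let ε : ι → ℝ := fun i => |c i| / c i
  have hε1 : ∀ i, ε i * ε i = 1 := fun i => by
    have := hc i
    simp only [ε]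
    rw [div_mul_div_comm, abs_mul_abs_self, div_self (mul_ne_zero this this)]
  have hεz : ∀ t i, ε i * zt t i = |c i| * Real.exp (t i) := fun t i => by
    have := hc i
    simp only [ε, zt]; field_simp
  have hεpos : ∀ t i, 0 < ε i * zt t i := fun t i => by
    rw [hεz]; exact mul_pos (abs_pos.mpr (hc i)) (Real.exp_pos _)
  let κ' : ι → ℝ := fun i => ε i * κ i * ε (rep (ρ i))
  have hκz : ∀ z ∈ K, ∀ i, ε i * z i = κ' i * (ε (rep (ρ i)) * z (rep (ρ i))) := fun z hz i => by
    simp only [κ']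
    calc ε i * z i = ε i * (κ i * z (rep (ρ i))) := by rw [← hκ z hz i]
      _ = ε i * κ i * (ε (rep (ρ i)) * ε (rep (ρ i))) * z (rep (ρ i)) := by rw [hε1]; ring
      _ = _ := by ring
  have hκpos : ∀ i, 0 < κ' i := fun i => by
    have h1 := hκz _ hz0 i
    have h2 := hεpos t0 i
    rw [show ε i * zt t0 i = _ from h1] at h2
    exact pos_of_mul_pos_left h2 (hεpos t0 _).le
  -- functional sigma
  let σ' : (ι → ℝ) →ₗ[ℝ] ℝ := ∑ i, ε i • LinearMap.proj i
  have hσ' : ∀ z, σ' z = ∑ i, ε i * z i := fun z => by simp [σ']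
  have hσpos : ∀ t, 0 < σ' (zt t) := fun t => by
    rw [hσ']; exact Finset.sum_pos (fun i _ => hεpos t i) Finset.univ_nonempty
  obtain ⟨Zl, hZlinj, hZlK, hZlσ, hZlsurj⟩ := ker_param l K hK σ' _ hz0 (hσpos t0).ne'
  let s' : (ι → ℝ) →ₗ[ℝ] ℝ := ∑ i, LinearMap.proj i
  have hs' : ∀ z, s' z = ∑ i, z i := fun z => by simp [s']
  obtain ⟨w1, hw1K, hw1⟩ : ∃ w1 ∈ K, s' w1 = 1 := by
    by_contra hcon
    push Not at hcon
    have h1 : ∀ z ∈ K, s' z = 0 := by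
      intro z hz
      by_contra h2
      apply hcon ((s' z)⁻¹ • z) (K.smul_mem _ hz)
      rw [map_smul, smul_eq_mul, inv_mul_cancel₀ h2]
    have h2 : (fun _ => 1 : ι → ℝ) ∈ orth K := by
      rw [mem_orth]; intro z hz
      simpa [hs'] using h1 z hz
    have := hreg (zt t0) hz0 t0 ht0o (fun i => rfl) (zt t0) hz0 _ h2 (fun i => by simp)
    obtain ⟨i⟩ := ‹Nonempty ι›
    exact hztne t0 i (congrFun this i)
  obtain ⟨βl, hβinj, hβK, hβs, hβsurj⟩ := ker_param l K hK s' w1 hw1K (by rw [hw1]; exact one_ne_zero)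
  let be : Fin l → ι → ℝ := fun j => βl (Pi.single j 1)
  have hlin : ∀ (φ : (Fin l → ℝ) →ₗ[ℝ] (ι → ℝ)) x i, φ x i = ∑ k, x k * φ (Pi.single k 1) i := by
    intro φ x i
    conv_lhs => rw [← Finset.univ_sum_single x]
    rw [map_sum, Finset.sum_apply]
    refine Finset.sum_congr rfl fun k _ => ?_
    have : (Pi.single k (x k) : Fin l → ℝ) = x k • Pi.single k 1 := by
      rw [← Pi.single_smul]; simp
    rw [this, map_smul]; rfl
  have hbeK : ∀ j, be j ∈ K := fun j => hβK _
  have hbes : ∀ j, ∑ i, be j i = 0 := fun j => by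
    rw [← hs']; exact hβs _
  let om : Fin l → ι → ℝ := fun j => Zl (Pi.single j 1)
  have hZl : ∀ x i, Zl x i = ∑ k, x k * om k i := fun x i => hlin Zl x i
  let z0 : ι → ℝ := (σ' (zt t0))⁻¹ • zt t0
  have hz0K : z0 ∈ K := K.smul_mem _ hz0
  have hz0σ : σ' z0 = 1 := by
    simp only [z0, map_smul, smul_eq_mul]; exact inv_mul_cancel₀ (hσpos t0).ne'
  let Z : (Fin l → ℝ) → ι → ℝ := fun x => z0 + Zl x
  have hZK : ∀ x, Z x ∈ K := fun x => K.add_mem hz0K (hZlK x)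
  have hZσ : ∀ x, σ' (Z x) = 1 := fun x => by simp only [Z, map_add, hz0σ, hZlσ, add_zero]
  let A : Fin m → Fin l → ℝ := fun s k => ε (rep s) * om k (rep s)
  let e : Fin m → ℝ := fun s => ε (rep s) * z0 (rep s)
  have hA : ∀ s x, ∑ k, A s k * x k = ε (rep s) * Zl x (rep s) := fun s x => by
    rw [hZl, Finset.mul_sum]
    exact Finset.sum_congr rfl fun k _ => by simp only [A]; ring
  have hzf : ∀ s x, zf A e s x = ε (rep s) * Z x (rep s) := fun s x => by
    rw [zf, hA]; simp only [e, Z, Pi.add_apply]; ring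
  have hzf' : ∀ i x, ε i * Z x i = κ' i * zf A e (ρ i) x := fun i x => by
    rw [hzf, hκz _ (hZK x)]
  -- bounded
  have hbd : Bornology.IsBounded (Dl A e) := by
    rw [isBounded_iff_forall_norm_le]
    obtain ⟨C, hC0, hC⟩ := LinearMap.exists_antilipschitzWith Zl (LinearMap.ker_eq_bot.mpr hZlinj)
    refine ⟨C * (1 + ‖z0‖), fun x hx => ?_⟩
    have h2 : ‖Zl x‖ ≤ 1 + ‖z0‖ := by
      have h4 : Zl x = Z x - z0 := by simp [Z]
      rw [h4]
      refine (norm_sub_le _ _).trans (add_le_add ?_ le_rfl)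
      rw [pi_norm_le_iff_of_nonneg zero_le_one]
      intro i
      have h5 : ∀ i, 0 ≤ ε i * Z x i := fun i => by
        rw [hzf']; exact (mul_pos (hκpos i) (hx _)).le
      have h6 : ε i * Z x i ≤ 1 := by
        rw [← hZσ x, hσ']
        exact Finset.single_le_sum (f := fun i => ε i * Z x i) (fun i _ => h5 i) (Finset.mem_univ i)
      have h7 : ‖Z x i‖ = ε i * Z x i := by
        rw [← abs_of_nonneg (h5 i), abs_mul, Real.norm_eq_abs]
        have : |ε i| = 1 := by
          simp only [ε, abs_div, abs_abs]; exact div_self (abs_ne_zero.mpr (hc i))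
        rw [this, one_mul]
      rw [h7]; exact h6
    have h1 := hC.le_mul_dist x 0
    rw [map_zero, dist_zero_right, dist_zero_right] at h1
    exact h1.trans (mul_le_mul_of_nonneg_left h2 C.2)
  -- the points
  have hx : ∀ t ∈ T, ∃ x, Z x = (σ' (zt t))⁻¹ • zt t := by
    intro t ht
    have h1 : (σ' (zt t))⁻¹ • zt t - z0 ∈ K := K.sub_mem (K.smul_mem _ (hT t ht).2) hz0K
    obtain ⟨x, hx⟩ := hZlsurj _ h1 (by
      rw [map_sub, map_smul, hz0σ, smul_eq_mul, inv_mul_cancel₀ (hσpos t).ne', sub_self])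
    exact ⟨x, by simp only [Z]; rw [hx]; abel⟩
  choose! xp hxp using hx
  have hinj : Set.InjOn xp T := by
    intro t1 h1 t2 h2 h12
    have h3 : (σ' (zt t1))⁻¹ • zt t1 = (σ' (zt t2))⁻¹ • zt t2 := by
      rw [← hxp t1 h1, ← hxp t2 h2, h12]
    have h4 : ∀ i, t1 i - t2 i = Real.log (σ' (zt t1)) - Real.log (σ' (zt t2)) := by
      intro i
      have h5 := congrFun h3 i
      simp only [Pi.smul_apply, smul_eq_mul, hzt] at h5
      have h6 : σ' (zt t2) * Real.exp (t1 i) = σ' (zt t1) * Real.exp (t2 i) := by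
        have a1 := (hσpos t1).ne'
        have a2 := (hσpos t2).ne'
        have a3 := hc i
        field_simp at h5
        linarith
      have h7 := congrArg Real.log h6
      rw [Real.log_mul (hσpos t2).ne' (Real.exp_ne_zero _),
        Real.log_mul (hσpos t1).ne' (Real.exp_ne_zero _), Real.log_exp, Real.log_exp] at h7
      linarith
    have h5 : t1 - t2 ∈ orth K := (orth K).sub_mem (hT t1 h1).1 (hT t2 h2).1
    have h6 := h5 w1 hw1K
    simp only [Pi.sub_apply, h4] at h6
    rw [← Finset.sum_mul, ← hs', hw1, one_mul] at h6
    ext i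
    have := h4 i
    rw [h6] at this
    linarith
  rw [← Finset.card_image_of_injOn hinj]
  let β' : Fin l → Fin m → ℝ := fun j s => ∑ i with ρ i = s, be j i
  have hβ' : ∀ j (f : Fin m → ℝ), ∑ s, β' j s * f s = ∑ i, be j i * f (ρ i) := fun j f => by
    rw [← Finset.sum_fiberwise Finset.univ ρ]
    refine Finset.sum_congr rfl fun s _ => ?_
    simp only [β', Finset.sum_mul]
    refine Finset.sum_congr rfl fun i hi => ?_
    rw [(Finset.mem_filter.mp hi).2]
  refine log_count' hD hm A e β' (fun j => ∑ i, be j i * (Real.log |c i| - Real.log (κ' i))) hbd _ ?_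
  intro x hxS
  obtain ⟨t, ht, rfl⟩ := Finset.mem_image.mp hxS
  have hZx := hxp t ht
  have hzfx : ∀ i, κ' i * zf A e (ρ i) (xp t) = (σ' (zt t))⁻¹ * (|c i| * Real.exp (t i)) := fun i => by
    rw [← hzf', hZx, ← hεz]; simp only [Pi.smul_apply, smul_eq_mul]; ring
  refine ⟨?_, ?_, ?_⟩
  · intro s
    rw [hzf, hZx]
    have := mul_pos (inv_pos.mpr (hσpos t)) (hεpos t (rep s))
    simp only [Pi.smul_apply, smul_eq_mul]
    linarith
  · intro j
    rw [lf, hβ' j (fun s => Real.log (zf A e s (xp t)))]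
    have h1 : ∀ i, Real.log (zf A e (ρ i) (xp t)) = (Real.log |c i| - Real.log (κ' i)) + t i
        - Real.log (σ' (zt t)) := by
      intro i
      have h2 : zf A e (ρ i) (xp t) = (|c i| / κ' i) * Real.exp (t i) / σ' (zt t) := by
        have a1 := (hκpos i).ne'
        have a2 := (hσpos t).ne'
        rw [eq_div_iff a2]
        have := hzfx i
        field_simp at this ⊢
        linarith
      rw [h2, Real.log_div (mul_ne_zero (div_ne_zero (abs_ne_zero.mpr (hc i)) (hκpos i).ne')
        (Real.exp_ne_zero _)) (hσpos t).ne', Real.log_mul (div_ne_zero (abs_ne_zero.mpr (hc i))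
        (hκpos i).ne') (Real.exp_ne_zero _), Real.log_exp, Real.log_div (abs_ne_zero.mpr (hc i))
        (hκpos i).ne']
    simp only [h1, mul_sub, mul_add, Finset.sum_add_distrib, Finset.sum_sub_distrib]
    rw [(hT t ht).1 (be j) (hbeK j), ← Finset.sum_mul, hbes]
    ring
  · intro hdet
    obtain ⟨v, hv0, hv⟩ := Matrix.exists_mulVec_eq_zero_iff.mpr hdet
    apply hv0
    let q : ι → ℝ := fun i => Zl v i / Z (xp t) i
    have hZne : ∀ i, Z (xp t) i ≠ 0 := fun i => by
      rw [hZx]; exact mul_ne_zero (inv_ne_zero (hσpos t).ne') (hztne t i)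
    have hεne : ∀ i, ε i ≠ 0 := fun i h => by have := hε1 i; rw [h] at this; simp at this
    have hq : ∀ i, (ε (rep (ρ i)) * Zl v (rep (ρ i))) / zf A e (ρ i) (xp t) = q i := by
      intro i
      have a1 := (hκpos i).ne'
      have h1 := hκz _ (hZlK v) i
      have h2 := hzf' i (xp t)
      have h3 : q i = (ε i * Zl v i) / (ε i * Z (xp t) i) := by
        rw [mul_div_mul_left _ _ (hεne i)]
      rw [h3, h1, h2, mul_div_mul_left _ _ a1]
    have hbq : ∀ j, ∑ i, be j i * q i = 0 := by
      intro j
      have h1 := congrFun hv j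
      simp only [Matrix.mulVec, dotProduct, JM, Fin.is_lt, if_true, Finset.sum_apply, Pi.smul_apply,
        smul_eq_mul, Pi.zero_apply] at h1
      rw [← h1]
      have h2 := hβ' j (fun s => (ε (rep s) * Zl v (rep s)) / zf A e s (xp t))
      simp only [hq] at h2
      rw [← h2]
      simp only [Finset.sum_mul]
      rw [Finset.sum_comm]
      refine Finset.sum_congr rfl fun s _ => ?_
      rw [← hA, Finset.sum_div, Finset.mul_sum]
      refine Finset.sum_congr rfl fun k _ => by ring
    have hWq : ∀ w ∈ K, s' w = 0 → ∑ i, w i * q i = 0 := by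
      intro w hw hsw
      obtain ⟨x, hx⟩ := hβsurj w hw hsw
      have h3 : ∀ i, w i = ∑ j, x j * be j i := by
        intro i
        rw [← hx]; exact hlin βl x i
      simp only [h3, Finset.sum_mul]
      rw [Finset.sum_comm]
      refine Finset.sum_eq_zero fun j _ => ?_
      simp only [mul_assoc]
      rw [← Finset.mul_sum, hbq, mul_zero]
    let τ : ℝ := ∑ i, w1 i * q i
    have hqo : (fun i => q i - τ) ∈ orth K := by
      intro w hw
      have h1 := hWq (w - s' w • w1) (K.sub_mem hw (K.smul_mem _ hw1K))
        (by rw [map_sub, map_smul, hw1]; simp)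
      simp only [Pi.sub_apply, Pi.smul_apply, smul_eq_mul, sub_mul, Finset.sum_sub_distrib] at h1
      simp only [mul_assoc] at h1
      rw [← Finset.mul_sum] at h1
      simp only [mul_sub, Finset.sum_sub_distrib]
      rw [← Finset.sum_mul, ← hs' w]
      exact h1
    have hR := hreg (zt t) (hT t ht).2 t (hT t ht).1 (fun i => rfl)
      (σ' (zt t) • Zl v - τ • zt t) (K.sub_mem (K.smul_mem _ (hZlK v)) (K.smul_mem _ (hT t ht).2))
      _ hqo (fun i => by
        have h1 := hztne t i
        have h2 := (hσpos t).ne'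
        simp only [q, Pi.sub_apply, Pi.smul_apply, smul_eq_mul, hZx]
        field_simp)
    have hτ : τ = 0 := by
      have h1 := congrArg σ' hR
      rw [map_sub, map_smul, map_smul, hZlσ, map_zero] at h1
      simp only [smul_eq_mul, mul_zero, zero_sub, neg_eq_zero, mul_eq_zero] at h1
      exact h1.resolve_right (hσpos t).ne'
    rw [hτ, zero_smul, sub_zero] at hR
    have hZ0 : Zl v = 0 := (smul_eq_zero.mp hR).resolve_left (hσpos t).ne'
    exact hZlinj (by rw [hZ0, map_zero])

end GaleB
end Fewn

open Set Filter Topology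

namespace Fewn

section GaleC
open MeasureTheory

variable {ι : Type*} [Fintype ι]

lemma BB_mono {m m' D l : ℕ} (h : m ≤ m') : BB m D l ≤ BB m' D l := by
  unfold BB
  gcongr

lemma exists_near_good (K : Submodule ℝ (ι → ℝ)) (c : ι → ℝ) (P : (ι → ℝ) → Prop)
    (hP : ∀ᶠ c' in 𝓝 c, P c') : ∃ c', P c' ∧ (∀ i, c' i ≠ 0) ∧ Reg K c' := by
  have h1 : ∀ i, ∀ᵐ c : ι → ℝ, c i ≠ 0 := fun i => by
    have h2 := ae_lin (LinearMap.proj i : (ι → ℝ) →ₗ[ℝ] ℝ) (volume : Measure (ι → ℝ))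
      (volume : Measure ℝ) (fun y => ⟨fun _ => y, rfl⟩) (N := {0}) (by simp)
    simpa using h2
  have h2 : ∀ᵐ c : ι → ℝ, (∀ i, c i ≠ 0) ∧ Reg K c := by
    filter_upwards [ae_all_iff.mpr h1, reg_ae K] with c a b using ⟨a, b⟩
  have h3 : Dense {c : ι → ℝ | (∀ i, c i ≠ 0) ∧ Reg K c} := Measure.dense_of_ae h2
  obtain ⟨c', h4, h5⟩ := (mem_closure_iff_frequently.mp (h3 c)).and_eventually hP |>.exists
  exact ⟨c', h5, h4.1, h4.2⟩

theorem regions_full (K : Submodule ℝ (ι → ℝ)) (c0 : ℝ) (c : ι → ℝ) (Q : Set (orth K))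
    (ho : IsOpen Q) (hb : Bornology.IsBounded Q) (hne : Q.Nonempty)
    (hnz : ∀ t ∈ Q, hh c0 c t ≠ 0) (hcl : ∀ t ∈ closure Q, hh c0 c t ≠ 0 → t ∈ Q) :
    ∃ z ∈ K, ∀ i, z i ≠ 0 := by
  obtain ⟨c', ⟨t, ht, hK⟩, hc', _⟩ := exists_near_good K c _ (crit_one K c0 c Q ho hb hne hnz hcl)
  exact ⟨_, hK, fun i => mul_ne_zero (hc' i) (Real.exp_ne_zero _)⟩

theorem regions_count [Nonempty ι] {l m D : ℕ} (hD : 1 ≤ D) (hm : m ≤ D + l)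
    (K : Submodule ℝ (ι → ℝ)) (hK : Module.finrank ℝ K = l + 1) (rep : Fin m → ι) (ρ : ι → Fin m)
    (κ : ι → ℝ) (hκ : ∀ z ∈ K, ∀ i, z i = κ i * z (rep (ρ i))) (c0 : ℝ) (c : ι → ℝ)
    {J : Type*} [Fintype J] (Q : J → Set (orth K))
    (ho : ∀ j, IsOpen (Q j)) (hb : ∀ j, Bornology.IsBounded (Q j)) (hne : ∀ j, (Q j).Nonempty)
    (hnz : ∀ j, ∀ t ∈ Q j, hh c0 c t ≠ 0) (hcl : ∀ j, ∀ t ∈ closure (Q j), hh c0 c t ≠ 0 → t ∈ Q j)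
    (hdis : ∀ i j, i ≠ j → Disjoint (Q i) (Q j)) :
    2 * Fintype.card J ≤ BB m D l := by
  classical
  obtain ⟨c', h1, hc', hreg⟩ := exists_near_good K c _ (eventually_all.mpr fun j =>
    crit_one K c0 c (Q j) (ho j) (hb j) (hne j) (hnz j) (hcl j))
  choose t ht htK using h1
  have hinj : Function.Injective fun j => ((t j : orth K) : ι → ℝ) := by
    intro i j hij
    by_contra hne'
    have : t i = t j := Subtype.ext hij
    exact Set.disjoint_left.mp (hdis i j hne') (ht i) (this ▸ ht j)
  have := gale_count hD hm K hK rep ρ κ hκ c' hc' hreg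
    (Finset.univ.image fun j => ((t j : orth K) : ι → ℝ)) (by
      intro t' ht'
      obtain ⟨j, _, rfl⟩ := Finset.mem_image.mp ht'
      exact ⟨(t j).2, htK j⟩)
  rwa [Finset.card_image_of_injective _ hinj, Finset.card_univ] at this

/-- kernel of a configuration -/
def kerA {n : ℕ} (α : ι → Fin n → ℝ) : Submodule ℝ (ι → ℝ) :=
  LinearMap.ker (Matrix.mulVecLin (fun r i => α i r : Matrix (Fin n) ι ℝ))

lemma mem_kerA {n : ℕ} {α : ι → Fin n → ℝ} {z : ι → ℝ} :
    z ∈ kerA α ↔ ∀ r, ∑ i, z i * α i r = 0 := by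
  rw [kerA, LinearMap.mem_ker, funext_iff]
  refine forall_congr' fun r => ?_
  rw [Finset.sum_congr rfl fun i _ => mul_comm (z i) _]
  rfl

def rowA {n : ℕ} (α : ι → Fin n → ℝ) : (Fin n → ℝ) →ₗ[ℝ] (ι → ℝ) :=
  Matrix.mulVecLin (fun i r => α i r : Matrix ι (Fin n) ℝ)

lemma rowA_apply {n : ℕ} (α : ι → Fin n → ℝ) (u : Fin n → ℝ) (i : ι) :
    rowA α u i = ∑ r, α i r * u r := rfl

lemma orth_kerA {n : ℕ} (α : ι → Fin n → ℝ) : orth (kerA α) = LinearMap.range (rowA α) := by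
  have : kerA α = orth (LinearMap.range (rowA α)) := by
    ext z
    rw [mem_kerA, mem_orth]
    constructor
    · rintro h _ ⟨u, rfl⟩
      simp only [rowA_apply, Finset.sum_mul]
      rw [Finset.sum_comm]
      refine Finset.sum_eq_zero fun r _ => ?_
      have := h r
      calc ∑ i, α i r * u r * z i = (∑ i, z i * α i r) * u r := by
            rw [Finset.sum_mul]; exact Finset.sum_congr rfl fun i _ => by ring
        _ = 0 := by rw [this, zero_mul]
    · intro h r
      classical
      have := h _ ⟨Pi.single r 1, rfl⟩
      simp only [rowA_apply] at this
      rw [← this]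
      refine Finset.sum_congr rfl fun i _ => ?_
      simp [Pi.single_apply, mul_comm]
  rw [this, orth_orth]

/-- Transfer of a clopen piece from `u`-space to the row space. -/
lemma transfer {n : ℕ} (α : ι → Fin n → ℝ) (c0 : ℝ) (c : ι → ℝ) (Q : Set (Fin n → ℝ))
    (ho : IsOpen Q) (B : ℝ) (hb : ∀ u ∈ Q, ∀ i, |rowA α u i| ≤ B) (hne : Q.Nonempty)
    (hnz : ∀ u ∈ Q, hh c0 c (rowA α u) ≠ 0)
    (hcl : ∀ u ∈ closure Q, hh c0 c (rowA α u) ≠ 0 → u ∈ Q) :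
    ∃ Q' : Set (orth (kerA α)), IsOpen Q' ∧ Bornology.IsBounded Q' ∧ Q'.Nonempty ∧
      (∀ t ∈ Q', hh c0 c t ≠ 0) ∧ (∀ t ∈ closure Q', hh c0 c t ≠ 0 → t ∈ Q') ∧
      ∀ t ∈ Q', ∀ u, rowA α u = t → u ∈ Q := by
  have hmem : ∀ u, rowA α u ∈ orth (kerA α) := fun u => by rw [orth_kerA]; exact ⟨u, rfl⟩
  let T : (Fin n → ℝ) →ₗ[ℝ] orth (kerA α) := (rowA α).codRestrict _ hmem
  have hT : ∀ u, ((T u : orth (kerA α)) : ι → ℝ) = rowA α u := fun _ => rfl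
  have hsurj : Function.Surjective T := by
    rintro ⟨t, ht⟩
    have h1 := ht
    rw [orth_kerA] at h1
    obtain ⟨u, hu⟩ := h1
    exact ⟨u, Subtype.ext hu⟩
  have hTc : Continuous T := T.continuous_of_finiteDimensional
  have hopen : IsOpenMap T := (LinearMap.toContinuousLinearMap T).isOpenMap hsurj
  have hinv : ∀ u ∈ Q, ∀ u', T u' = T u → u' ∈ Q := by
    intro u hu u' huu
    let γ : ℝ → Fin n → ℝ := fun s => u + s • (u' - u)
    have hγ : Continuous γ := by fun_prop
    have hTγ : ∀ s, rowA α (γ s) = rowA α u := fun s => by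
      have : rowA α u' = rowA α u := congrArg Subtype.val huu
      simp [γ, this]
    have hclo : IsClopen (γ ⁻¹' Q) := by
      refine ⟨?_, ho.preimage hγ⟩
      rw [← closure_subset_iff_isClosed]
      intro s hs
      have h1 : γ s ∈ closure Q := hγ.closure_preimage_subset _ hs
      refine hcl _ h1 ?_
      rw [hTγ]; exact hnz u hu
    have h2 : γ ⁻¹' Q = univ := hclo.eq_univ ⟨0, by simpa [γ] using hu⟩
    have h3 : (1 : ℝ) ∈ γ ⁻¹' Q := by rw [h2]; trivial
    simpa [γ] using h3
  have hpre : T ⁻¹' (T '' Q) = Q := by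
    ext u
    constructor
    · rintro ⟨v, hv, hvu⟩; exact hinv v hv u hvu.symm
    · intro hu; exact ⟨u, hu, rfl⟩
  refine ⟨T '' Q, hopen _ ho, ?_, hne.image _, ?_, ?_, ?_⟩
  · rw [isBounded_iff_forall_norm_le]
    obtain ⟨u0, hu0⟩ := hne
    refine ⟨max B 0, ?_⟩
    rintro _ ⟨u, hu, rfl⟩
    change ‖((T u : orth (kerA α)) : ι → ℝ)‖ ≤ _
    rw [pi_norm_le_iff_of_nonneg (le_max_right _ _)]
    intro i
    exact (hb u hu i).trans (le_max_left _ _)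
  · rintro _ ⟨u, hu, rfl⟩; exact hnz u hu
  · intro t ht hne'
    obtain ⟨u, rfl⟩ := hsurj t
    have h1 : u ∈ T ⁻¹' closure (T '' Q) := ht
    rw [hopen.preimage_closure_eq_closure_preimage hTc, hpre] at h1
    exact ⟨u, hcl u h1 hne', rfl⟩
  · rintro _ ⟨u, hu, rfl⟩ u' hu'
    exact hinv u hu u' (Subtype.ext hu')

/-- relations supported on `F` -/
def KF {n N : ℕ} (a : Fin N → Fin n → ℝ) (F : Finset (Fin N)) : Submodule ℝ (Fin N → ℝ) where
  carrier := {z | (∀ i ∉ F, z i = 0) ∧ ∑ i, z i = 0 ∧ ∀ r, ∑ i, z i * a i r = 0}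
  add_mem' := by
    rintro x y ⟨h1, h2, h3⟩ ⟨h4, h5, h6⟩
    refine ⟨fun i hi => by simp [h1 i hi, h4 i hi], by simp [Finset.sum_add_distrib, h2, h5],
      fun r => by simp [add_mul, Finset.sum_add_distrib, h3, h6]⟩
  zero_mem' := by simp
  smul_mem' := by
    rintro c x ⟨h1, h2, h3⟩
    refine ⟨fun i hi => by simp [h1 i hi], by simp [← Finset.mul_sum, h2],
      fun r => by simp [mul_assoc, ← Finset.mul_sum, h3]⟩

lemma mem_KF {n N : ℕ} {a : Fin N → Fin n → ℝ} {F : Finset (Fin N)} {z : Fin N → ℝ} :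
    z ∈ KF a F ↔ (∀ i ∉ F, z i = 0) ∧ ∑ i, z i = 0 ∧ ∀ r, ∑ i, z i * a i r = 0 := Iff.rfl

variable {n N : ℕ}

/-- exponents -/
noncomputable def dt (a : Fin N → Fin n → ℝ) (i : Fin N) (u : Fin n → ℝ) : ℝ := ∑ r, a i r * u r

/-- face function -/
noncomputable def hF (a : Fin N → Fin n → ℝ) (c : Fin N → ℝ) (F : Finset (Fin N)) (u : Fin n → ℝ) : ℝ :=
  ∑ i ∈ F, c i * Real.exp (dt a i u)

/-- a bounded clopen piece -/
structure Piece (a : Fin N → Fin n → ℝ) (c : Fin N → ℝ) (F : Finset (Fin N))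
    (Q : Set (Fin n → ℝ)) : Prop where
  ho : IsOpen Q
  hne : Q.Nonempty
  hnz : ∀ u ∈ Q, hF a c F u ≠ 0
  hcl : ∀ u ∈ closure Q, hF a c F u ≠ 0 → u ∈ Q
  hb : ∃ B, ∀ u ∈ Q, ∀ i ∈ F, ∀ j ∈ F, |dt a i u - dt a j u| ≤ B

abbrev al (a : Fin N → Fin n → ℝ) (F : Finset (Fin N)) (j0 : Fin N) :
    {i // i ∈ F.erase j0} → Fin n → ℝ := fun i r => a i r - a j0 r

lemma rowA_al (a : Fin N → Fin n → ℝ) (F : Finset (Fin N)) (j0 : Fin N) (u : Fin n → ℝ)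
    (i : {i // i ∈ F.erase j0}) : rowA (al a F j0) u i = dt a i u - dt a j0 u := by
  rw [rowA_apply, dt, dt, ← Finset.sum_sub_distrib]
  exact Finset.sum_congr rfl fun r _ => by simp only [al]; ring

lemma hF_eq (a : Fin N → Fin n → ℝ) (c : Fin N → ℝ) (F : Finset (Fin N)) (j0 : Fin N) (hj : j0 ∈ F)
    (u : Fin n → ℝ) : hF a c F u = Real.exp (dt a j0 u) *
      hh (c j0) (fun i : {i // i ∈ F.erase j0} => c i) (rowA (al a F j0) u) := by
  rw [hF, hh, ← Finset.add_sum_erase F _ hj, mul_add, ← Finset.sum_attach (F.erase j0), Finset.mul_sum]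
  congr 1
  · ring
  · rw [Finset.univ_eq_attach]
    refine Finset.sum_congr rfl fun i _ => ?_
    rw [rowA_al, Real.exp_sub]
    field_simp

lemma Piece.transfer {a : Fin N → Fin n → ℝ} {c : Fin N → ℝ} {F : Finset (Fin N)}
    {Q : Set (Fin n → ℝ)} (h : Piece a c F Q) (j0 : Fin N) (hj : j0 ∈ F) :
    ∃ Q' : Set (orth (kerA (al a F j0))), IsOpen Q' ∧ Bornology.IsBounded Q' ∧ Q'.Nonempty ∧
      (∀ t ∈ Q', hh (c j0) (fun i : {i // i ∈ F.erase j0} => c i) t ≠ 0) ∧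
      (∀ t ∈ closure Q', hh (c j0) (fun i : {i // i ∈ F.erase j0} => c i) t ≠ 0 → t ∈ Q') ∧
      ∀ t ∈ Q', ∀ u, rowA (al a F j0) u = t → u ∈ Q := by
  obtain ⟨B, hB⟩ := h.hb
  refine Fewn.transfer (al a F j0) (c j0) _ Q h.ho B ?_ h.hne ?_ ?_
  · intro u hu i
    rw [rowA_al]
    exact hB u hu i (Finset.mem_of_mem_erase i.2) j0 hj
  · intro u hu h0
    apply h.hnz u hu
    rw [hF_eq a c F j0 hj, h0, mul_zero]
  · intro u hu h0
    refine h.hcl u hu ?_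
    rw [hF_eq a c F j0 hj]
    exact mul_ne_zero (Real.exp_ne_zero _) h0

/-- relations in the chart extend to relations on `F` -/
noncomputable def extz (F : Finset (Fin N)) (j0 : Fin N) (z : {i // i ∈ F.erase j0} → ℝ) : Fin N → ℝ :=
  fun i => if h : i ∈ F.erase j0 then z ⟨i, h⟩ else if i = j0 then - ∑ i, z i else 0

lemma extz_mem (F : Finset (Fin N)) (j0 : Fin N) (z : {i // i ∈ F.erase j0} → ℝ)
    (i : {i // i ∈ F.erase j0}) : extz F j0 z i = z i := by
  simp [extz]

lemma extz_sum (F : Finset (Fin N)) (j0 : Fin N) (hj : j0 ∈ F) (z : {i // i ∈ F.erase j0} → ℝ)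
    (f : Fin N → ℝ) :
    ∑ i, extz F j0 z i * f i = ∑ i : {i // i ∈ F.erase j0}, z i * (f i - f j0) := by
  classical
  have h0 : ∀ i ∉ F, extz F j0 z i * f i = 0 := by
    intro i hi
    have h1 : i ∉ F.erase j0 := fun h => hi (Finset.mem_of_mem_erase h)
    have h2 : i ≠ j0 := fun h => hi (h ▸ hj)
    simp only [extz, dif_neg h1, if_neg h2, zero_mul]
  rw [← Finset.sum_subset (Finset.subset_univ F) (fun i _ hi => h0 i hi),
    ← Finset.add_sum_erase F _ hj, ← Finset.sum_attach (F.erase j0), Finset.univ_eq_attach]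
  have h1 : extz F j0 z j0 = - ∑ i ∈ (F.erase j0).attach, z i := by
    simp [extz]
  rw [h1]
  simp only [extz_mem, mul_sub, Finset.sum_sub_distrib, ← Finset.sum_mul]
  ring

lemma extz_KF (a : Fin N → Fin n → ℝ) (F : Finset (Fin N)) (j0 : Fin N) (hj : j0 ∈ F)
    (z : {i // i ∈ F.erase j0} → ℝ) (hz : z ∈ kerA (al a F j0)) : extz F j0 z ∈ KF a F := by
  rw [mem_kerA] at hz
  refine ⟨?_, ?_, ?_⟩
  · intro i hi
    have h1 : i ∉ F.erase j0 := fun h => hi (Finset.mem_of_mem_erase h)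
    have h2 : i ≠ j0 := fun h => hi (h ▸ hj)
    simp only [extz, dif_neg h1, if_neg h2]
  · have := extz_sum F j0 hj z (fun _ => 1)
    simpa using this
  · intro r
    rw [extz_sum F j0 hj z (fun i => a i r)]
    exact hz r

lemma kerA_of_KF (a : Fin N → Fin n → ℝ) (F : Finset (Fin N)) (j0 : Fin N) (hj : j0 ∈ F)
    (w : Fin N → ℝ) (hw : w ∈ KF a F) :
    (fun i : {i // i ∈ F.erase j0} => w i) ∈ kerA (al a F j0) ∧
      extz F j0 (fun i : {i // i ∈ F.erase j0} => w i) = w := by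
  classical
  obtain ⟨h1, h2, h3⟩ := hw
  have hsum : w j0 = - ∑ i : {i // i ∈ F.erase j0}, w i := by
    rw [Finset.univ_eq_attach, Finset.sum_attach (F.erase j0)]
    rw [← Finset.sum_subset (Finset.subset_univ F) (fun i _ hi => h1 i hi),
      ← Finset.add_sum_erase F _ hj] at h2
    linarith
  have hext : extz F j0 (fun i : {i // i ∈ F.erase j0} => w i) = w := by
    ext i
    by_cases h : i ∈ F.erase j0
    · exact extz_mem F j0 _ ⟨i, h⟩
    · simp only [extz, dif_neg h]
      split_ifs with h4
      · rw [h4]; exact hsum.symm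
      · rw [h1 i]; intro hi; exact h (Finset.mem_erase.mpr ⟨h4, hi⟩)
  refine ⟨?_, hext⟩
  rw [mem_kerA]
  intro r
  rw [← h3 r]
  have := extz_sum F j0 hj (fun i : {i // i ∈ F.erase j0} => w i) (fun i => a i r)
  rw [hext] at this
  exact this.symm

lemma finrank_chart (a : Fin N → Fin n → ℝ) (F : Finset (Fin N)) (j0 : Fin N) (hj : j0 ∈ F) :
    Module.finrank ℝ (kerA (al a F j0)) = Module.finrank ℝ (KF a F) := by
  let φ : KF a F →ₗ[ℝ] kerA (al a F j0) :=
    { toFun := fun w => ⟨fun i => (w : Fin N → ℝ) i, (kerA_of_KF a F j0 hj w w.2).1⟩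
      map_add' := fun x y => rfl
      map_smul' := fun c x => rfl }
  refine (LinearEquiv.finrank_eq (LinearEquiv.ofBijective φ ⟨?_, ?_⟩)).symm
  · intro x y hxy
    apply Subtype.ext
    rw [← (kerA_of_KF a F j0 hj x x.2).2, ← (kerA_of_KF a F j0 hj y y.2).2]
    exact congrArg (fun z : kerA (al a F j0) => extz F j0 z) hxy
  · intro z
    refine ⟨⟨extz F j0 z, extz_KF a F j0 hj z z.2⟩, ?_⟩
    apply Subtype.ext
    ext i
    exact extz_mem F j0 z i

/-- If `F` supports a bounded piece, `K_F` has no coloops. -/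
theorem Piece.full {a : Fin N → Fin n → ℝ} {c : Fin N → ℝ} {F : Finset (Fin N)}
    {Q : Set (Fin n → ℝ)} (h : Piece a c F Q) (hF : 2 ≤ F.card) (i : Fin N) (hi : i ∈ F) :
    ∃ z ∈ KF a F, z i ≠ 0 := by
  obtain ⟨j0, hj0, hne⟩ := Finset.exists_mem_ne (by omega : 1 < F.card) i
  obtain ⟨Q', h1, h2, h3, h4, h5, -⟩ := h.transfer j0 hj0
  obtain ⟨z, hz, hz0⟩ := regions_full _ _ _ Q' h1 h2 h3 h4 h5
  refine ⟨extz F j0 z, extz_KF a F j0 hj0 z hz, ?_⟩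
  have := extz_mem F j0 z ⟨i, Finset.mem_erase.mpr ⟨hne.symm, hi⟩⟩
  simp only at this
  rw [this]; exact hz0 _

theorem face_count {a : Fin N → Fin n → ℝ} {c : Fin N → ℝ} {F : Finset (Fin N)} (hF : 2 ≤ F.card)
    {J : Type*} [Fintype J] (Q : J → Set (Fin n → ℝ)) (hQ : ∀ j, Piece a c F (Q j))
    (hdis : ∀ i j, i ≠ j → Disjoint (Q i) (Q j)) {l D : ℕ} (hD : 1 ≤ D)
    (hK : Module.finrank ℝ (KF a F) = l + 1) (j0 : Fin N) (hj0 : j0 ∈ F) (R : Finset (Fin N))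
    (hR : R ⊆ F.erase j0) (hRc : R.card ≤ D + l)
    (hrep : ∀ i ∈ F.erase j0, ∃ r ∈ R, ∃ κ : ℝ, ∀ z ∈ KF a F, z i = κ * z r) :
    2 * Fintype.card J ≤ BB (D + l) D l := by
  classical
  have hne : Nonempty {i // i ∈ F.erase j0} := by
    obtain ⟨i, hi, hne⟩ := Finset.exists_mem_ne (by omega : 1 < F.card) j0
    exact ⟨⟨i, Finset.mem_erase.mpr ⟨hne, hi⟩⟩⟩
  choose Q' h1 h2 h3 h4 h5 h6 using fun j => (hQ j).transfer j0 hj0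
  choose r hr κ hκ using hrep
  let eR := R.equivFin
  refine le_trans (regions_count hD hRc (kerA (al a F j0)) ((finrank_chart a F j0 hj0).trans hK)
    (fun s => ⟨(eR.symm s : Fin N), hR (eR.symm s).2⟩) (fun i => eR ⟨r i i.2, hr i i.2⟩)
    (fun i => κ i i.2) ?_ (c j0) (fun i : {i // i ∈ F.erase j0} => c i) Q' h1 h2 h3 h4 h5 ?_)
    (BB_mono hRc)
  · intro z hz i
    have := hκ i i.2 _ (extz_KF a F j0 hj0 z hz)
    rw [extz_mem] at this
    rw [this]
    congr 1
    have h7 := extz_mem F j0 z ⟨r i i.2, hR (hr i i.2)⟩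
    simp only [Equiv.symm_apply_apply]
    exact h7
  · intro i j hij
    rw [Set.disjoint_left]
    intro t hti htj
    have ht := t.2
    obtain ⟨u, hu⟩ := (orth_kerA (al a F j0)).le ht
    exact Set.disjoint_left.mp (hdis i j hij) (h6 i t hti u hu) (h6 j t htj u hu)

end GaleC
end Fewn

open Set Filter Topology

namespace Fewn

section AsyA

variable {n N : ℕ}

lemma dt_add (a : Fin N → Fin n → ℝ) (i : Fin N) (u v : Fin n → ℝ) :
    dt a i (u + v) = dt a i u + dt a i v := by
  simp [dt, mul_add, Finset.sum_add_distrib]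

lemma dt_smul (a : Fin N → Fin n → ℝ) (i : Fin N) (s : ℝ) (v : Fin n → ℝ) :
    dt a i (s • v) = s * dt a i v := by
  simp only [dt, Pi.smul_apply, smul_eq_mul, Finset.mul_sum]
  exact Finset.sum_congr rfl fun r _ => by ring

lemma dt_zero (a : Fin N → Fin n → ℝ) (i : Fin N) : dt a i 0 = 0 := by simp [dt]

lemma dt_neg (a : Fin N → Fin n → ℝ) (i : Fin N) (v : Fin n → ℝ) :
    dt a i (-v) = - dt a i v := by simp [dt]

lemma dt_cont (a : Fin N → Fin n → ℝ) (i : Fin N) : Continuous (dt a i) := by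
  unfold dt; fun_prop

/-- action of shifts on the simplex -/
noncomputable def act (a : Fin N → Fin n → ℝ) (w : Fin n → ℝ) (r : Fin N → ℝ) : Fin N → ℝ :=
  fun i => r i * Real.exp (dt a i w) / ∑ j, r j * Real.exp (dt a j w)

/-- normalized monomials -/
noncomputable def Pm (a : Fin N → Fin n → ℝ) (y : Fin n → ℝ) : Fin N → ℝ := act a y (fun _ => 1)

/-- the positive quadrant minus zero -/
def Pq (N : ℕ) : Set (Fin N → ℝ) := {r | (∀ i, 0 ≤ r i) ∧ ∑ i, r i = 1}

lemma Pq_closed : IsClosed (Pq N) := by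
  apply IsClosed.inter
  · change IsClosed {r : Fin N → ℝ | ∀ i, 0 ≤ r i}
    rw [Set.setOf_forall]
    exact isClosed_iInter fun i => isClosed_le continuous_const (continuous_apply i)
  · exact isClosed_eq (by fun_prop) continuous_const

lemma Pq_compact : IsCompact (Pq N) := by
  refine (isCompact_univ_pi fun i : Fin N => isCompact_Icc (a := (0:ℝ)) (b := 1)).of_isClosed_subset
    Pq_closed ?_
  intro r hr i _
  refine ⟨hr.1 i, ?_⟩
  rw [← hr.2]
  exact Finset.single_le_sum (f := r) (fun i _ => hr.1 i) (Finset.mem_univ i)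

lemma exists_pos {r : Fin N → ℝ} (h : ∀ i, 0 ≤ r i) (h0 : ∑ i, r i ≠ 0) : ∃ i, 0 < r i := by
  by_contra hcon
  push Not at hcon
  exact h0 (Finset.sum_eq_zero fun i _ => le_antisymm (hcon i) (h i))

lemma den_pos (a : Fin N → Fin n → ℝ) (w : Fin n → ℝ) {r : Fin N → ℝ} (h : ∀ i, 0 ≤ r i)
    (h0 : ∑ i, r i ≠ 0) : 0 < ∑ j, r j * Real.exp (dt a j w) := by
  obtain ⟨i, hi⟩ := exists_pos h h0
  exact Finset.sum_pos' (fun j _ => mul_nonneg (h j) (Real.exp_pos _).le)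
    ⟨i, Finset.mem_univ i, mul_pos hi (Real.exp_pos _)⟩

lemma act_mem (a : Fin N → Fin n → ℝ) (w : Fin n → ℝ) {r : Fin N → ℝ} (h : ∀ i, 0 ≤ r i)
    (h0 : ∑ i, r i ≠ 0) : act a w r ∈ Pq N := by
  have := den_pos a w h h0
  refine ⟨fun i => div_nonneg (mul_nonneg (h i) (Real.exp_pos _).le) this.le, ?_⟩
  simp only [act]
  rw [← Finset.sum_div, div_self this.ne']

lemma act_act (a : Fin N → Fin n → ℝ) (w v : Fin n → ℝ) {r : Fin N → ℝ} (h : ∀ i, 0 ≤ r i)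
    (h0 : ∑ i, r i ≠ 0) : act a w (act a v r) = act a (v + w) r := by
  have h1 := (den_pos a v h h0).ne'
  ext i
  simp only [act, dt_add, Real.exp_add]
  have h2 : ∑ j, r j * Real.exp (dt a j v) / (∑ j, r j * Real.exp (dt a j v)) * Real.exp (dt a j w)
      = (∑ j, r j * (Real.exp (dt a j v) * Real.exp (dt a j w))) / ∑ j, r j * Real.exp (dt a j v) := by
    rw [Finset.sum_div]
    exact Finset.sum_congr rfl fun j _ => by ring
  rw [h2]
  rw [div_mul_eq_mul_div, div_div_div_cancel_right₀ h1, mul_assoc]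

lemma act_pos_iff (a : Fin N → Fin n → ℝ) (w : Fin n → ℝ) {r : Fin N → ℝ} (h : r ∈ Pq N) (i : Fin N) :
    act a w r i = 0 ↔ r i = 0 := by
  have h1 := (den_pos a w h.1 (by rw [h.2]; exact one_ne_zero)).ne'
  simp [act, h1, Real.exp_ne_zero]

lemma one_ok [NeZero N] : ∑ i : Fin N, (1 : ℝ) ≠ 0 := by
  simp [NeZero.ne N]

lemma Pm_mem [NeZero N] (a : Fin N → Fin n → ℝ) (y : Fin n → ℝ) : Pm a y ∈ Pq N :=
  act_mem a y (fun _ => zero_le_one) one_ok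

lemma Pm_pos [NeZero N] (a : Fin N → Fin n → ℝ) (y : Fin n → ℝ) (i : Fin N) : 0 < Pm a y i := by
  have := den_pos a y (r := fun _ => 1) (fun _ => zero_le_one) one_ok
  simp only [Pm, act]
  positivity

lemma Pm_add [NeZero N] (a : Fin N → Fin n → ℝ) (y w : Fin n → ℝ) :
    Pm a (y + w) = act a w (Pm a y) :=
  (act_act a w y (fun _ => zero_le_one) one_ok).symm

lemma act_cont_r (a : Fin N → Fin n → ℝ) (w : Fin n → ℝ) : ContinuousOn (act a w) (Pq N) := by
  refine continuousOn_pi.mpr fun i => ?_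
  refine ContinuousOn.div (by fun_prop) (by fun_prop) ?_
  intro r hr
  exact (den_pos a w hr.1 (by rw [hr.2]; exact one_ne_zero)).ne'

lemma act_cont_w (a : Fin N → Fin n → ℝ) {r : Fin N → ℝ} (hr : r ∈ Pq N) :
    Continuous fun w => act a w r := by
  have hd := dt_cont a
  refine continuous_pi fun i => ?_
  refine Continuous.div (by fun_prop) (by fun_prop) ?_
  intro w
  exact (den_pos a w hr.1 (by rw [hr.2]; exact one_ne_zero)).ne'

lemma Pm_cont [NeZero N] (a : Fin N → Fin n → ℝ) : Continuous (Pm a) := by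
  have hd := dt_cont a
  refine continuous_pi fun i => ?_
  refine Continuous.div (by fun_prop) (by fun_prop) ?_
  intro w
  exact (den_pos a w (r := fun _ => 1) (fun _ => zero_le_one) one_ok).ne'

/-- closure of the image -/
def LL (a : Fin N → Fin n → ℝ) : Set (Fin N → ℝ) := closure (range (Pm a))

lemma clP_sub [NeZero N] (a : Fin N → Fin n → ℝ) (Ω : Set (Fin n → ℝ)) :
    closure (Pm a '' Ω) ⊆ Pq N := by
  refine closure_minimal ?_ Pq_closed
  rintro _ ⟨y, _, rfl⟩
  exact Pm_mem a y

lemma LL_sub [NeZero N] (a : Fin N → Fin n → ℝ) : LL a ⊆ Pq N := by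
  rw [LL, ← image_univ]; exact clP_sub a univ

lemma LL_compact [NeZero N] (a : Fin N → Fin n → ℝ) : IsCompact (LL a) :=
  Pq_compact.of_isClosed_subset isClosed_closure (LL_sub a)

lemma act_closure [NeZero N] (a : Fin N → Fin n → ℝ) (w : Fin n → ℝ) {Ω Ω' : Set (Fin n → ℝ)}
    (h : ∀ y ∈ Ω, y + w ∈ Ω') {r : Fin N → ℝ} (hr : r ∈ closure (Pm a '' Ω)) :
    act a w r ∈ closure (Pm a '' Ω') := by
  have hc : ContinuousWithinAt (act a w) (Pm a '' Ω) r :=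
    (act_cont_r a w r (clP_sub a Ω hr)).mono (by
      rintro _ ⟨y, _, rfl⟩; exact Pm_mem a y)
  refine closure_mono ?_ (hc.mem_closure_image hr)
  rintro _ ⟨_, ⟨y, hy, rfl⟩, rfl⟩
  exact ⟨y + w, h y hy, Pm_add a y w⟩

lemma act_LL [NeZero N] (a : Fin N → Fin n → ℝ) (w : Fin n → ℝ) {r : Fin N → ℝ} (hr : r ∈ LL a) :
    act a w r ∈ LL a := by
  rw [LL, ← image_univ] at *
  exact act_closure a w (fun y _ => mem_univ _) hr

/-- support -/
noncomputable def sp (r : Fin N → ℝ) : Finset (Fin N) := by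
  classical exact Finset.univ.filter fun i => r i ≠ 0

lemma mem_sp {r : Fin N → ℝ} {i : Fin N} : i ∈ sp r ↔ r i ≠ 0 := by simp [sp]

lemma sp_nonempty {r : Fin N → ℝ} (h : r ∈ Pq N) : (sp r).Nonempty := by
  obtain ⟨i, hi⟩ := exists_pos h.1 (by rw [h.2]; exact one_ne_zero)
  exact ⟨i, mem_sp.mpr hi.ne'⟩

lemma log_Pm [NeZero N] (a : Fin N → Fin n → ℝ) (y : Fin n → ℝ) (i : Fin N) :
    Real.log (Pm a y i) = dt a i y - Real.log (∑ j, Real.exp (dt a j y)) := by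
  have := den_pos a y (r := fun _ => 1) (fun _ => zero_le_one) one_ok
  simp only [one_mul] at this
  simp only [Pm, act, one_mul]
  rw [Real.log_div (Real.exp_ne_zero _) this.ne', Real.log_exp]

/-- limit points are torus translates of the indicator of their support -/
lemma LL_orbit [NeZero N] (a : Fin N → Fin n → ℝ) {r : Fin N → ℝ} (hr : r ∈ LL a) :
    ∃ u : Fin n → ℝ, ∃ σ : ℝ, 0 < σ ∧ ∀ i ∈ sp r, r i = σ * Real.exp (dt a i u) := by
  have hrP := LL_sub a hr
  obtain ⟨j0, hj0⟩ := sp_nonempty hrP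
  have hpos : ∀ i ∈ sp r, 0 < r i := fun i hi => lt_of_le_of_ne (hrP.1 i) (Ne.symm (mem_sp.mp hi))
  let T : (Fin n → ℝ) →ₗ[ℝ] ({i // i ∈ sp r} → ℝ) :=
    { toFun := fun u i => dt a i u - dt a j0 u
      map_add' := fun u v => by ext i; simp [dt_add]; ring
      map_smul' := fun s v => by ext i; simp [dt_smul]; ring }
  let φ : (Fin N → ℝ) → ({i // i ∈ sp r} → ℝ) := fun r i => Real.log (r i) - Real.log (r j0)
  have hφ : ContinuousAt φ r := by
    refine continuousAt_pi.mpr fun i => ?_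
    have e1 : ∀ j ∈ sp r, ContinuousAt (fun r' : Fin N → ℝ => Real.log (r' j)) r := fun j hj =>
      ContinuousAt.log (f := fun r' : Fin N → ℝ => r' j) (continuous_apply j).continuousAt (mem_sp.mp hj)
    exact (e1 i i.2).sub (e1 j0 hj0)
  have h1 : φ r ∈ closure (φ '' range (Pm a)) :=
    hφ.continuousWithinAt.mem_closure_image hr
  have h2 : φ '' range (Pm a) ⊆ LinearMap.range T := by
    rintro _ ⟨_, ⟨y, rfl⟩, rfl⟩
    refine ⟨y, ?_⟩
    ext i
    simp only [φ, log_Pm]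
    change dt a i y - dt a j0 y = _
    ring
  have h3 : φ r ∈ LinearMap.range T :=
    closure_minimal h2 (Submodule.closed_of_finiteDimensional _) h1
  obtain ⟨u, hu⟩ := h3
  refine ⟨u, r j0 * Real.exp (- dt a j0 u), mul_pos (hpos j0 hj0) (Real.exp_pos _), fun i hi => ?_⟩
  have h4 : dt a i u - dt a j0 u = Real.log (r i) - Real.log (r j0) := congrFun hu ⟨i, hi⟩
  rw [mul_assoc, ← Real.exp_add, show - dt a j0 u + dt a i u = Real.log (r i) - Real.log (r j0) by
    rw [← h4]; ring, Real.exp_sub, Real.exp_log (hpos i hi), Real.exp_log (hpos j0 hj0)]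
  have := (hpos j0 hj0).ne'
  field_simp

lemma KF_dt (a : Fin N → Fin n → ℝ) (F : Finset (Fin N)) {z : Fin N → ℝ} (hz : z ∈ KF a F)
    (y : Fin n → ℝ) : ∑ i, z i * dt a i y = 0 := by
  simp only [dt, Finset.mul_sum]
  rw [Finset.sum_comm]
  refine Finset.sum_eq_zero fun r _ => ?_
  calc ∑ i, z i * (a i r * y r) = (∑ i, z i * a i r) * y r := by
        rw [Finset.sum_mul]; exact Finset.sum_congr rfl fun i _ => by ring
    _ = 0 := by rw [hz.2.2 r, zero_mul]

/-- supports are flats -/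
lemma LL_flat [NeZero N] (a : Fin N → Fin n → ℝ) {r : Fin N → ℝ} (hr : r ∈ LL a) (i : Fin N)
    (hi : i ∉ sp r) (z : Fin N → ℝ) (hz : z ∈ KF a (insert i (sp r))) : z i = 0 := by
  classical
  by_contra hzi
  apply hi
  rw [mem_sp]
  let φ : (Fin N → ℝ) → ℝ := fun r' => Real.exp (- ∑ j ∈ sp r, (z j / z i) * Real.log (r' j))
  have hφ : ContinuousAt φ r := by
    refine Real.continuous_exp.continuousAt.comp (ContinuousAt.neg ?_)
    refine tendsto_finsetSum _ fun j hj => ?_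
    exact (ContinuousAt.log (f := fun r' : Fin N → ℝ => r' j) (continuous_apply j).continuousAt
      (mem_sp.mp hj)).const_mul (z j / z i)
  have hψ : ContinuousAt (fun r' : Fin N → ℝ => (φ r' - r' i)) r :=
    hφ.sub (continuous_apply i).continuousAt
  have h1 := hψ.continuousWithinAt.mem_closure_image hr
  have h2 : (fun r' : Fin N → ℝ => (φ r' - r' i)) '' range (Pm a) ⊆ {0} := by
    rintro _ ⟨_, ⟨y, rfl⟩, rfl⟩
    simp only [mem_singleton_iff, sub_eq_zero, φ]
    rw [← Real.exp_log (Pm_pos a y i)]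
    congr 1
    have h3 : ∑ j, z j * Real.log (Pm a y j) = 0 := by
      simp only [log_Pm, mul_sub, Finset.sum_sub_distrib]
      rw [KF_dt a _ hz, ← Finset.sum_mul, hz.2.1]; simp
    rw [← Finset.sum_subset (Finset.subset_univ (insert i (sp r)))
      (fun j _ hj => by rw [hz.1 j hj, zero_mul]), Finset.sum_insert hi] at h3
    have h4 : ∑ j ∈ sp r, z j / z i * Real.log (Pm a y j) = (∑ j ∈ sp r, z j * Real.log (Pm a y j)) / z i := by
      rw [Finset.sum_div]; exact Finset.sum_congr rfl fun j _ => by ring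
    rw [h4]
    field_simp
    linarith
  have h3 := closure_minimal h2 isClosed_singleton h1
  simp only [mem_singleton_iff, sub_eq_zero] at h3
  rw [← h3]
  exact (Real.exp_pos _).ne'

end AsyA
end Fewn

open Set Filter Topology

namespace Fewn

section AsyB

variable {n N : ℕ}

def Bad (a : Fin N → Fin n → ℝ) : Set (Fin N → ℝ) :=
  {c | ∃ r ∈ LL a, (fun i => c i * r i) ∈ KF a Finset.univ}

def UU (a : Fin N → Fin n → ℝ) : Set (Fin N → ℝ) :=
  {c | ∀ j, c j ≠ 0} ∩ (Bad a)ᶜ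

lemma nz_open : IsOpen {c : Fin N → ℝ | ∀ j, c j ≠ 0} := by
  rw [Set.setOf_forall]
  exact isOpen_iInter_of_finite fun j => isOpen_ne_fun (continuous_apply j) continuous_const

lemma nz_dense : Dense {c : Fin N → ℝ | ∀ j, c j ≠ 0} := by
  have : {c : Fin N → ℝ | ∀ j, c j ≠ 0} = Set.pi univ fun _ => {x : ℝ | x ≠ 0} := by
    ext c; simp
  rw [this]
  apply dense_pi
  intro i _
  exact dense_compl_singleton (0 : ℝ)

lemma Bad_closed [NeZero N] (a : Fin N → Fin n → ℝ) : IsClosed (Bad a) := by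
  haveI : CompactSpace (LL a) := isCompact_iff_compactSpace.mp (LL_compact a)
  have h1 : Bad a = Prod.fst '' {p : (Fin N → ℝ) × LL a | (fun i => p.1 i * (p.2 : Fin N → ℝ) i) ∈
      KF a Finset.univ} := by
    ext c
    constructor
    · rintro ⟨r, hr, h⟩; exact ⟨(c, ⟨r, hr⟩), h, rfl⟩
    · rintro ⟨⟨c', r⟩, h, rfl⟩; exact ⟨r, r.2, h⟩
  rw [h1]
  apply isClosedMap_fst_of_compactSpace
  have h2 : IsClosed ((KF a Finset.univ : Submodule ℝ (Fin N → ℝ)) : Set (Fin N → ℝ)) :=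
    Submodule.closed_of_finiteDimensional _
  refine h2.preimage (f := fun p : (Fin N → ℝ) × LL a => fun i => p.1 i * (p.2 : Fin N → ℝ) i) ?_
  refine continuous_pi fun i => ?_
  exact ((continuous_apply i).comp continuous_fst).mul
    ((continuous_apply i).comp (continuous_subtype_val.comp continuous_snd))

lemma UU_open [NeZero N] (a : Fin N → Fin n → ℝ) : IsOpen (UU a) :=
  nz_open.inter (Bad_closed a).isOpen_compl

/-- parameter space of bad coefficients -/
def T0 (a : Fin N → Fin n → ℝ) (F : Finset (Fin N)) (j0 : Fin N) : Submodule ℝ (Fin N → ℝ) :=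
  orth (KF a F) ⊓ LinearMap.ker (LinearMap.proj j0 : (Fin N → ℝ) →ₗ[ℝ] ℝ)

lemma mem_orth_KF (a : Fin N → Fin n → ℝ) (F : Finset (Fin N)) (u : Fin n → ℝ) (s : ℝ)
    (t : Fin N → ℝ) (ht : ∀ i ∈ F, t i = dt a i u + s) : t ∈ orth (KF a F) := by
  intro z hz
  have h1 : ∀ i, z i * t i = z i * dt a i u + z i * s := by
    intro i
    by_cases hi : i ∈ F
    · rw [ht i hi, mul_add]
    · rw [hz.1 i hi]; ring
  simp only [h1, Finset.sum_add_distrib]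
  rw [KF_dt a F hz, ← Finset.sum_mul, hz.2.1]; ring

lemma T0_finrank (a : Fin N → Fin n → ℝ) (F : Finset (Fin N)) (j0 : Fin N) :
    Module.finrank ℝ (KF a F × T0 a F j0) < N := by
  have h1 : T0 a F j0 < orth (KF a F) := by
    refine lt_of_le_of_ne inf_le_left ?_
    intro h
    have h2 : (fun _ => 1 : Fin N → ℝ) ∈ orth (KF a F) :=
      mem_orth_KF a F 0 1 _ (fun i _ => by simp [dt_zero])
    rw [← h] at h2
    have := h2.2
    simp at this
  have h2 := Submodule.finrank_lt_finrank_of_lt h1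
  have h3 := orth_finrank (KF a F)
  rw [Module.finrank_prod]
  simp only [Fintype.card_fin] at h3
  omega

open Classical in
noncomputable def badmap (a : Fin N → Fin n → ℝ) (F : Finset (Fin N)) (j0 : Fin N)
    (p : KF a F × T0 a F j0) : Fin N → ℝ :=
  fun i => (p.1 : Fin N → ℝ) i * Real.exp ((p.2 : Fin N → ℝ) i) +
    (if i ∈ F then 0 else 1) * (p.2 : Fin N → ℝ) i

lemma badmap_smooth (a : Fin N → Fin n → ℝ) (F : Finset (Fin N)) (j0 : Fin N) :
    ContDiff ℝ 1 (badmap a F j0) := by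
  rw [contDiff_pi]
  intro i
  have h1 : ContDiff ℝ 1 fun p : KF a F × T0 a F j0 => (p.1 : Fin N → ℝ) i :=
    contDiff_pi.mp ((KF a F).subtypeL.contDiff.comp contDiff_fst) i
  have h2 : ContDiff ℝ 1 fun p : KF a F × T0 a F j0 => (p.2 : Fin N → ℝ) i :=
    contDiff_pi.mp ((T0 a F j0).subtypeL.contDiff.comp contDiff_snd) i
  exact (h1.mul h2.exp).add (contDiff_const.mul h2)

lemma Bad_sub [NeZero N] (a : Fin N → Fin n → ℝ) :
    Bad a ⊆ ⋃ q : Finset (Fin N) × Fin N, range (badmap a q.1 q.2) := by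
  classical
  rintro c ⟨r, hr, hK⟩
  have hrP := LL_sub a hr
  obtain ⟨j0, hj0⟩ := sp_nonempty hrP
  obtain ⟨u, σ, hσ, hu⟩ := LL_orbit a hr
  rw [mem_iUnion]
  refine ⟨(sp r, j0), ?_⟩
  have hz : (fun i => c i * r i) ∈ KF a (sp r) := by
    refine ⟨fun i hi => ?_, hK.2⟩
    have : r i = 0 := by by_contra h; exact hi (mem_sp.mpr h)
    simp [this]
  let t : Fin N → ℝ := fun i => if i ∈ sp r then dt a i (-u) + dt a j0 u else c i
  have ht : t ∈ T0 a (sp r) j0 := by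
    refine ⟨mem_orth_KF a _ (-u) (dt a j0 u) t (fun i hi => by simp only [t, if_pos hi]), ?_⟩
    change t j0 = 0
    simp only [t, if_pos hj0, dt_neg]
    ring
  refine ⟨(⟨_, (KF a (sp r)).smul_mem (σ⁻¹ * Real.exp (- dt a j0 u)) hz⟩, ⟨t, ht⟩), ?_⟩
  ext i
  simp only [badmap, Pi.smul_apply, smul_eq_mul]
  by_cases hi : i ∈ sp r
  · simp only [if_pos hi, t, zero_mul, add_zero, dt_neg]
    rw [hu i hi, Real.exp_add, Real.exp_neg, Real.exp_neg]
    have := hσ.ne'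
    have h1 := Real.exp_ne_zero (dt a i u)
    have h2 := Real.exp_ne_zero (dt a j0 u)
    field_simp
  · have : r i = 0 := by by_contra h; exact hi (mem_sp.mpr h)
    simp [if_neg hi, t, this]

lemma UU_dense [NeZero N] (a : Fin N → Fin n → ℝ) : Dense (UU a) := by
  refine nz_dense.inter_of_isOpen_left ?_ nz_open
  have h1 : Dense (⋃ q : Finset (Fin N) × Fin N, range (badmap a q.1 q.2))ᶜ := by
    apply dense_compl_of_dimH_lt_finrank
    rw [dimH_iUnion]
    have hN : 0 < N := Nat.pos_of_ne_zero (NeZero.ne N)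
    have h2 : ∀ q : Finset (Fin N) × Fin N, dimH (range (badmap a q.1 q.2)) ≤ ((N - 1 : ℕ) : ENNReal) := by
      intro q
      refine ((badmap_smooth a q.1 q.2).dimH_range_le).trans ?_
      have := T0_finrank a q.1 q.2
      exact_mod_cast (by omega : Module.finrank ℝ (KF a q.1 × T0 a q.1 q.2) ≤ N - 1)
    refine lt_of_le_of_lt (iSup_le h2) ?_
    rw [Module.finrank_fintype_fun_eq_card, Fintype.card_fin]
    exact_mod_cast (by omega : N - 1 < N)
  exact h1.mono (compl_subset_compl.mpr (Bad_sub a))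

end AsyB
end Fewn

open Set Filter Topology

namespace Fewn

section AsyC

variable {n N : ℕ}

/-- a partition of the complement of the zero set in open pieces -/
structure Regs (a : Fin N → Fin n → ℝ) (c : Fin N → ℝ) {M : ℕ} (Ω : Fin M → Set (Fin n → ℝ)) : Prop where
  ho : ∀ j, IsOpen (Ω j)
  hd : ∀ i j y, y ∈ Ω i → y ∈ Ω j → i = j
  hc : ∀ y, hF a c Finset.univ y ≠ 0 ↔ ∃ j, y ∈ Ω j

lemma hF_cont (a : Fin N → Fin n → ℝ) (c : Fin N → ℝ) (F : Finset (Fin N)) : Continuous (hF a c F) := by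
  have hd := dt_cont a
  unfold hF; fun_prop

lemma Regs.seg {a : Fin N → Fin n → ℝ} {c : Fin N → ℝ} {M : ℕ} {Ω : Fin M → Set (Fin n → ℝ)}
    (h : Regs a c Ω) {s : Set (Fin n → ℝ)} (hs : IsPreconnected s)
    (hnz : ∀ y ∈ s, hF a c Finset.univ y ≠ 0) {j : Fin M} {y : Fin n → ℝ} (hys : y ∈ s) (hy : y ∈ Ω j) :
    s ⊆ Ω j := by
  refine hs.subset_left_of_subset_union (h.ho j) (v := ⋃ i : {i // i ≠ j}, Ω i)
    (isOpen_iUnion fun i => h.ho i) ?_ ?_ ⟨y, hys, hy⟩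
  · rw [Set.disjoint_left]
    intro z hz hz'
    obtain ⟨i, hi⟩ := mem_iUnion.mp hz'
    exact i.2 (h.hd _ _ z hi hz)
  · intro z hz
    obtain ⟨i, hi⟩ := (h.hc z).mp (hnz z hz)
    by_cases hij : i = j
    · left; rwa [← hij]
    · right; exact mem_iUnion.mpr ⟨⟨i, hij⟩, hi⟩

def lc (c r : Fin N → ℝ) : ℝ := ∑ i, c i * r i

lemma lc_cont (c : Fin N → ℝ) : Continuous (lc c) := by unfold lc; fun_prop

lemma lc_act (a : Fin N → Fin n → ℝ) (c : Fin N → ℝ) (w : Fin n → ℝ) (r : Fin N → ℝ) :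
    lc c (act a w r) = (∑ i, c i * r i * Real.exp (dt a i w)) / ∑ j, r j * Real.exp (dt a j w) := by
  rw [lc, Finset.sum_div]
  exact Finset.sum_congr rfl fun i _ => by simp only [act]; ring

lemma lc_Pm (a : Fin N → Fin n → ℝ) (c : Fin N → ℝ) (y : Fin n → ℝ) :
    lc c (Pm a y) = hF a c Finset.univ y / ∑ j, Real.exp (dt a j y) := by
  rw [Pm, lc_act]; simp [hF]

lemma den1_pos [NeZero N] (a : Fin N → Fin n → ℝ) (y : Fin n → ℝ) : 0 < ∑ j, Real.exp (dt a j y) := by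
  have := den_pos a y (r := fun _ => 1) (fun _ => zero_le_one) one_ok
  simpa using this

lemma hF_Pm [NeZero N] (a : Fin N → Fin n → ℝ) (c : Fin N → ℝ) (y : Fin n → ℝ) :
    hF a c Finset.univ y = (∑ j, Real.exp (dt a j y)) * lc c (Pm a y) := by
  rw [lc_Pm]; have := (den1_pos a y).ne'; field_simp

lemma Pm_ratio [NeZero N] (a : Fin N → Fin n → ℝ) (y : Fin n → ℝ) (i j : Fin N) :
    Pm a y i / Pm a y j = Real.exp (dt a i y - dt a j y) := by
  have := (den1_pos a y).ne'
  simp only [Pm, act, one_mul]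
  rw [div_div_div_cancel_right₀ this, Real.exp_sub]

lemma Regs.nbhd [NeZero N] {a : Fin N → Fin n → ℝ} {c : Fin N → ℝ} {M : ℕ} {Ω : Fin M → Set (Fin n → ℝ)}
    (h : Regs a c Ω) {r : Fin N → ℝ} {j : Fin M} (hr : r ∈ closure (Pm a '' Ω j)) (hne : lc c r ≠ 0) :
    ∃ V, IsOpen V ∧ r ∈ V ∧ ∀ y, Pm a y ∈ V → y ∈ Ω j := by
  have hrP := clP_sub a _ hr
  obtain ⟨j0, hj0⟩ := sp_nonempty hrP
  have hj0pos : 0 < r j0 := lt_of_le_of_ne (hrP.1 j0) (Ne.symm (mem_sp.mp hj0))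
  let φ : (Fin N → ℝ) → (Fin N → ℝ) := fun r' i => r' i / r' j0
  have hφ : ContinuousOn φ {r' | 0 < r' j0} := by
    refine continuousOn_pi.mpr fun i => ?_
    exact ContinuousOn.div (by fun_prop) (by fun_prop) (fun r' hr' => ne_of_gt hr')
  have hlcφ : ∀ r', lc c (φ r') = lc c r' / r' j0 := fun r' => by
    simp only [lc, φ, Finset.sum_div]
    exact Finset.sum_congr rfl fun i _ => by ring
  have h1 : lc c (φ r) ≠ 0 := by rw [hlcφ]; exact div_ne_zero hne hj0pos.ne'
  obtain ⟨ε, hε, hball⟩ := Metric.mem_nhds_iff.mp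
    ((lc_cont c).continuousAt.eventually_ne h1)
  let V : Set (Fin N → ℝ) := {r' | 0 < r' j0} ∩ φ ⁻¹' Metric.ball (φ r) ε
  have hVo : IsOpen V := hφ.isOpen_inter_preimage
    (isOpen_lt continuous_const (continuous_apply j0)) Metric.isOpen_ball
  have hrV : r ∈ V := ⟨hj0pos, Metric.mem_ball_self hε⟩
  refine ⟨V, hVo, hrV, ?_⟩
  let W : Set (Fin n → ℝ) := {y | Pm a y ∈ V}
  have hW : W = ⋂ i, {y | Real.exp (dt a i y - dt a j0 y) ∈ Metric.ball (φ r i) ε} := by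
    ext y
    simp only [W, V, mem_setOf_eq, mem_inter_iff, mem_preimage, Pm_pos, true_and, mem_iInter]
    rw [Metric.mem_ball, dist_pi_lt_iff hε]
    simp only [φ, Pm_ratio, Metric.mem_ball]
  have hWc : Convex ℝ W := by
    rw [hW]
    refine convex_iInter fun i => ?_
    have h2 : (Real.exp ⁻¹' Metric.ball (φ r i) ε).OrdConnected := by
      rw [Real.ball_eq_Ioo]
      exact ordConnected_Ioo.preimage_mono Real.exp_monotone
    have h3 : Convex ℝ (Real.exp ⁻¹' Metric.ball (φ r i) ε) := h2.convex
    let T : (Fin n → ℝ) →ₗ[ℝ] ℝ :=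
      { toFun := fun u => dt a i u - dt a j0 u
        map_add' := fun u v => by simp [dt_add]; ring
        map_smul' := fun s v => by simp [dt_smul]; ring }
    exact h3.linear_preimage T
  have hWnz : ∀ y ∈ W, hF a c Finset.univ y ≠ 0 := by
    intro y hy
    have h2 := hball hy.2
    have h3 : lc c (φ (Pm a y)) ≠ 0 := h2
    rw [hlcφ, lc_Pm] at h3
    intro h4
    rw [h4] at h3
    simp at h3
  obtain ⟨_, h4, ⟨y, hy, rfl⟩⟩ := mem_closure_iff.mp hr V hVo hrV
  intro y' hy'
  exact h.seg hWc.isPreconnected hWnz (y := y) h4 hy hy'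

lemma Regs.unique [NeZero N] {a : Fin N → Fin n → ℝ} {c : Fin N → ℝ} {M : ℕ} {Ω : Fin M → Set (Fin n → ℝ)}
    (h : Regs a c Ω) {r : Fin N → ℝ} {i j : Fin M} (hr : r ∈ closure (Pm a '' Ω i))
    (hr' : r ∈ closure (Pm a '' Ω j)) (hne : lc c r ≠ 0) : i = j := by
  obtain ⟨V, hVo, hrV, hV⟩ := h.nbhd hr hne
  obtain ⟨_, h4, ⟨y, hy, rfl⟩⟩ := mem_closure_iff.mp hr' V hVo hrV
  exact h.hd i j y (hV y h4) hy

lemma dt_single (a : Fin N → Fin n → ℝ) (i : Fin N) (s : Fin n) (x : ℝ) :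
    dt a i (Pi.single s x) = x * a i s := by
  classical
  simp [dt, Pi.single_apply, mul_comm]

lemma nondeg_dir {a : Fin N → Fin n → ℝ} {c r : Fin N → ℝ} (hc : c ∉ Bad a) (hr : r ∈ LL a)
    (h0 : lc c r = 0) (σ : ℝ) (hσ : σ ≠ 0) : ∃ w, 0 < σ * ∑ i, c i * r i * dt a i w := by
  have h1 : ∃ s, ∑ i, c i * r i * a i s ≠ 0 := by
    by_contra hcon
    push Not at hcon
    exact hc ⟨r, hr, fun i hi => absurd (Finset.mem_univ i) hi, h0, hcon⟩
  obtain ⟨s, hs⟩ := h1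
  refine ⟨Pi.single s (σ * ∑ i, c i * r i * a i s), ?_⟩
  have h2 : ∑ i, c i * r i * dt a i (Pi.single s (σ * ∑ i, c i * r i * a i s)) =
      (σ * ∑ i, c i * r i * a i s) * ∑ i, c i * r i * a i s := by
    conv_rhs => rw [Finset.mul_sum]
    refine Finset.sum_congr rfl fun i _ => ?_
    rw [dt_single]; ring
  rw [h2]
  have : σ * ∑ i, c i * r i * a i s ≠ 0 := mul_ne_zero hσ hs
  have h3 := mul_self_pos.mpr this
  calc 0 < _ := h3
    _ = _ := by ring

lemma deriv_path (a : Fin N → Fin n → ℝ) (c r : Fin N → ℝ) (w : Fin n → ℝ) (τ : ℝ) :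
    HasDerivAt (fun τ => ∑ i, c i * r i * Real.exp (τ * dt a i w))
      (∑ i, c i * r i * (dt a i w * Real.exp (τ * dt a i w))) τ := by
  refine HasDerivAt.fun_sum fun i _ => ?_
  have h2 : HasDerivAt (fun τ : ℝ => τ * dt a i w) (dt a i w) τ := by
    simpa using (hasDerivAt_id τ).mul_const (dt a i w)
  have h3 := (h2.exp).const_mul (c i * r i)
  refine h3.congr_deriv ?_
  ring

lemma Regs.reduce [NeZero N] {a : Fin N → Fin n → ℝ} {c : Fin N → ℝ} {M : ℕ} {Ω : Fin M → Set (Fin n → ℝ)}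
    (h : Regs a c Ω) (hc : c ∉ Bad a) {r : Fin N → ℝ} {j : Fin M} (hr : r ∈ closure (Pm a '' Ω j)) :
    ∃ r' ∈ closure (Pm a '' Ω j), lc c r' ≠ 0 ∧ sp r' = sp r := by
  by_cases h0 : lc c r = 0
  swap
  · exact ⟨r, hr, h0, rfl⟩
  have hrP := clP_sub a _ hr
  have hrL : r ∈ LL a := closure_mono (image_subset_range _ _) hr
  obtain ⟨σ, hσ, hrσ⟩ : ∃ σ : ℝ, σ ≠ 0 ∧
      r ∈ closure (Pm a '' {y | y ∈ Ω j ∧ 0 < σ * hF a c Finset.univ y}) := by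
    have h1 : Pm a '' Ω j = Pm a '' {y | y ∈ Ω j ∧ 0 < (1:ℝ) * hF a c Finset.univ y} ∪
        Pm a '' {y | y ∈ Ω j ∧ 0 < (-1:ℝ) * hF a c Finset.univ y} := by
      rw [← image_union]
      congr 1
      ext y
      simp only [mem_union, mem_setOf_eq]
      constructor
      · intro hy
        rcases lt_or_gt_of_ne ((h.hc y).mpr ⟨j, hy⟩) with h2 | h2
        · right; exact ⟨hy, by linarith⟩
        · left; exact ⟨hy, by linarith⟩
      · rintro (hy | hy) <;> exact hy.1
    rw [h1, closure_union] at hr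
    rcases hr with hr | hr
    · exact ⟨1, one_ne_zero, hr⟩
    · exact ⟨-1, by norm_num, hr⟩
  obtain ⟨w, hw⟩ := nondeg_dir hc hrL h0 σ hσ
  let ψ : ℝ × (Fin N → ℝ) → ℝ := fun p => σ * ∑ i, c i * p.2 i * (dt a i w * Real.exp (p.1 * dt a i w))
  have hψ : Continuous ψ := by fun_prop
  have hψ0 : 0 < ψ (0, r) := by simpa [ψ] using hw
  have hev := hψ.continuousAt.eventually (lt_mem_nhds hψ0)
  rw [nhds_prod_eq] at hev
  obtain ⟨pa, hpa, pb, hpb, hab⟩ := eventually_prod_iff.mp hev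
  obtain ⟨δ, hδ, hball⟩ := Metric.eventually_nhds_iff.mp hpa
  obtain ⟨V, hVs, hVo, hrV⟩ := mem_nhds_iff.mp hpb
  have key : ∀ r' ∈ V, ∀ τ, 0 < τ → τ < δ →
      σ * ∑ i, c i * r' i < σ * ∑ i, c i * r' i * Real.exp (τ * dt a i w) := by
    intro r' hr' τ hτ hτδ
    have h1 : StrictMonoOn (fun τ => σ * ∑ i, c i * r' i * Real.exp (τ * dt a i w)) (Icc 0 τ) := by
      refine strictMonoOn_of_deriv_pos (convex_Icc _ _) (by fun_prop) ?_
      intro x hx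
      rw [interior_Icc] at hx
      rw [((deriv_path a c r' w x).const_mul σ).deriv]
      refine hab (hball ?_) (hVs hr')
      rw [Real.dist_eq, sub_zero, abs_of_pos hx.1]; linarith [hx.2]
    have h2 := h1 (left_mem_Icc.mpr hτ.le) (right_mem_Icc.mpr hτ.le) hτ
    simpa using h2
  let τ0 := δ / 2
  have hτ0 : 0 < τ0 := by positivity
  have hτδ : τ0 < δ := by simp only [τ0]; linarith
  have hshift : ∀ y τ, hF a c Finset.univ (y + τ • w) =
      (∑ j, Real.exp (dt a j y)) * ∑ i, c i * Pm a y i * Real.exp (τ * dt a i w) := by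
    intro y τ
    have := (den1_pos a y).ne'
    rw [hF, Finset.mul_sum]
    refine Finset.sum_congr rfl fun i _ => ?_
    rw [dt_add, dt_smul, Real.exp_add]
    simp only [Pm, act, one_mul]
    field_simp
  have hstep : ∀ y ∈ {y | y ∈ Ω j ∧ 0 < σ * hF a c Finset.univ y} ∩ Pm a ⁻¹' V, y + τ0 • w ∈ Ω j := by
    rintro y ⟨⟨hy, hpos⟩, hyV⟩
    have hpre : IsPreconnected ((fun τ : ℝ => y + τ • w) '' Icc 0 τ0) :=
      isPreconnected_Icc.image _ (by fun_prop)
    refine h.seg hpre ?_ (y := y) ⟨0, left_mem_Icc.mpr hτ0.le, by simp⟩ hy ⟨τ0, right_mem_Icc.mpr hτ0.le, rfl⟩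
    rintro _ ⟨τ, hτ, rfl⟩
    simp only
    rw [hshift]
    refine mul_ne_zero (den1_pos a y).ne' ?_
    have h1 : 0 < σ * ∑ i, c i * Pm a y i := by
      rw [hF_Pm] at hpos
      have h2 := den1_pos a y
      have h3 : 0 < (∑ j, Real.exp (dt a j y)) * (σ * lc c (Pm a y)) := by linarith
      exact pos_of_mul_pos_right h3 h2.le
    rcases hτ.1.eq_or_lt with h2 | h2
    · rw [← h2]
      simp only [zero_mul, Real.exp_zero, mul_one]
      exact right_ne_zero_of_mul h1.ne'
    · have h3 := key _ hyV τ h2 (lt_of_le_of_lt hτ.2 hτδ)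
      exact right_ne_zero_of_mul (h1.trans h3).ne'
  have hrV' : r ∈ closure (Pm a '' ({y | y ∈ Ω j ∧ 0 < σ * hF a c Finset.univ y} ∩ Pm a ⁻¹' V)) := by
    rw [mem_closure_iff]
    intro O hO hrO
    obtain ⟨_, ⟨h4, h5⟩, ⟨y, hy, rfl⟩⟩ := mem_closure_iff.mp hrσ (O ∩ V) (hO.inter hVo) ⟨hrO, hrV⟩
    exact ⟨_, h4, ⟨y, ⟨hy, h5⟩, rfl⟩⟩
  refine ⟨act a (τ0 • w) r, act_closure a (τ0 • w) hstep hrV', ?_, ?_⟩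
  · rw [lc_act]
    refine div_ne_zero ?_ (den_pos a _ hrP.1 (by rw [hrP.2]; exact one_ne_zero)).ne'
    have h3 := key r hrV τ0 hτ0 hτδ
    rw [show ∑ i, c i * r i = 0 from h0, mul_zero] at h3
    simp only [dt_smul]
    exact right_ne_zero_of_mul h3.ne'
  · ext i
    rw [mem_sp, mem_sp, Ne, Ne, act_pos_iff a _ hrP]

end AsyC
end Fewn

open Set Filter Topology

namespace Fewn

section AsyD

variable {n N : ℕ}

/-- barycenter of a face -/
noncomputable def bary (F : Finset (Fin N)) : Fin N → ℝ := by
  classical exact fun i => if i ∈ F then (F.card : ℝ)⁻¹ else 0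

lemma bary_mem {F : Finset (Fin N)} (hF : F.Nonempty) : bary F ∈ Pq N := by
  classical
  refine ⟨fun i => ?_, ?_⟩
  · simp only [bary]; split_ifs <;> positivity
  · have : (F.card : ℝ) ≠ 0 := by exact_mod_cast hF.card_pos.ne'
    simp only [bary, Finset.sum_ite_mem, Finset.univ_inter, Finset.sum_const, nsmul_eq_mul]
    field_simp

lemma bary_of_mem {F : Finset (Fin N)} {i : Fin N} (h : i ∈ F) : bary F i = (F.card : ℝ)⁻¹ := by
  simp [bary, h]
lemma bary_of_not {F : Finset (Fin N)} {i : Fin N} (h : i ∉ F) : bary F i = 0 := by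
  simp [bary, h]

lemma bary_orbit [NeZero N] (a : Fin N → Fin n → ℝ) {r : Fin N → ℝ} (hr : r ∈ LL a) :
    ∃ u, r = act a u (bary (sp r)) := by
  obtain ⟨u, σ, hσ, h⟩ := LL_orbit a hr
  have hrP := LL_sub a hr
  have hne := sp_nonempty hrP
  have hcard : ((sp r).card : ℝ) ≠ 0 := by exact_mod_cast hne.card_pos.ne'
  refine ⟨u, ?_⟩
  have h1 : ∀ i, bary (sp r) i * Real.exp (dt a i u) = ((sp r).card : ℝ)⁻¹ * σ⁻¹ * r i := by
    intro i
    by_cases hi : i ∈ sp r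
    · rw [bary_of_mem hi, h i hi]; field_simp
    · rw [bary_of_not hi, zero_mul]
      have : r i = 0 := by by_contra h2; exact hi (mem_sp.mpr h2)
      simp [this]
  ext i
  simp only [act, h1]
  rw [← Finset.mul_sum, hrP.2]
  field_simp

lemma lc_bary (a : Fin N → Fin n → ℝ) (c : Fin N → ℝ) {F : Finset (Fin N)} (hF' : F.Nonempty) (u : Fin n → ℝ) :
    lc c (act a u (bary F)) ≠ 0 ↔ hF a c F u ≠ 0 := by
  classical
  have hb := bary_mem hF'
  have h1 := (den_pos a u hb.1 (by rw [hb.2]; exact one_ne_zero)).ne'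
  have hcard : (F.card : ℝ) ≠ 0 := by exact_mod_cast hF'.card_pos.ne'
  have h2 : ∑ i, c i * bary F i * Real.exp (dt a i u) = (F.card : ℝ)⁻¹ * hF a c F u := by
    rw [hF, Finset.mul_sum, ← Finset.sum_subset (Finset.subset_univ F)]
    · refine Finset.sum_congr rfl fun i hi => ?_
      rw [bary_of_mem hi]; ring
    · intro i _ hi; rw [bary_of_not hi]; ring
  rw [lc_act, h2, Ne, div_eq_zero_iff, mul_eq_zero]
  simp [h1, hF'.ne_empty]

/-- the piece of a face attached to a region -/
def Qp (a : Fin N → Fin n → ℝ) (c : Fin N → ℝ) (Ω : Set (Fin n → ℝ)) (F : Finset (Fin N)) : Set (Fin n → ℝ) :=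
  {u | hF a c F u ≠ 0 ∧ act a u (bary F) ∈ closure (Pm a '' Ω)}

lemma Regs.piece [NeZero N] {a : Fin N → Fin n → ℝ} {c : Fin N → ℝ} {M : ℕ} {Ω : Fin M → Set (Fin n → ℝ)}
    (h : Regs a c Ω) {r : Fin N → ℝ} {j : Fin M} (hr : r ∈ closure (Pm a '' Ω j)) (hne : lc c r ≠ 0)
    (hmin : ∀ r' ∈ closure (Pm a '' Ω j), (sp r).card ≤ (sp r').card) :
    Piece a c (sp r) (Qp a c (Ω j) (sp r)) := by
  have hrL : r ∈ LL a := closure_mono (image_subset_range _ _) hr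
  have hrP := LL_sub a hrL
  have hFn := sp_nonempty hrP
  obtain ⟨u0, hu0⟩ := bary_orbit a hrL
  set F := sp r with hFdef
  have hb := bary_mem hFn
  have hb1 : ∑ i, bary F i ≠ 0 := by rw [hb.2]; exact one_ne_zero
  have hpL : ∀ u, act a u (bary F) ∈ LL a := by
    intro u
    have h1 := act_LL a (u - u0) hrL
    rw [hu0, act_act a _ _ hb.1 hb1] at h1
    simpa using h1
  have hcont : Continuous fun u => act a u (bary F) := act_cont_w a hb
  constructor
  · rw [isOpen_iff_mem_nhds]
    rintro u ⟨hu1, hu2⟩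
    obtain ⟨V, hVo, huV, hV⟩ := h.nbhd hu2 ((lc_bary a c hFn u).mpr hu1)
    have e1 := (hF_cont a c F).continuousAt.eventually_ne hu1
    have e2 := hcont.continuousAt.eventually (hVo.mem_nhds huV)
    filter_upwards [e1, e2] with u' h1 h2
    refine ⟨h1, ?_⟩
    rw [mem_closure_iff]
    intro O hO hO'
    obtain ⟨_, ⟨h4, h5⟩, ⟨y, rfl⟩⟩ := mem_closure_iff.mp (hpL u') (O ∩ V) (hO.inter hVo) ⟨hO', h2⟩
    exact ⟨_, h4, ⟨y, hV y h5, rfl⟩⟩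
  · refine ⟨u0, (lc_bary a c hFn u0).mp ?_, ?_⟩
    · rw [← hu0]; exact hne
    · rw [← hu0]; exact hr
  · exact fun u hu => hu.1
  · intro u hu hu1
    refine ⟨hu1, ?_⟩
    have : closure (Qp a c (Ω j) F) ⊆ (fun u => act a u (bary F)) ⁻¹' closure (Pm a '' Ω j) :=
      closure_minimal (fun u hu => hu.2) (isClosed_closure.preimage hcont)
    exact this hu
  · let C : Set (Fin N → ℝ) := closure (Pm a '' Ω j) ∩ {r' | ∀ i, i ∉ F → r' i = 0}
    have hCc : IsCompact C := by
      refine Pq_compact.of_isClosed_subset ?_ (fun r' hr' => clP_sub a _ hr'.1)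
      refine isClosed_closure.inter ?_
      rw [Set.setOf_forall]
      refine isClosed_iInter fun i => ?_
      rw [Set.setOf_forall]
      exact isClosed_iInter fun _ => isClosed_eq (continuous_apply i) continuous_const
    have hCs : ∀ r' ∈ C, ∀ i ∈ F, r' i ≠ 0 := by
      rintro r' ⟨h1, h2⟩ i hi
      have h3 : sp r' ⊆ F := by
        intro i hi
        by_contra h4
        exact (mem_sp.mp hi) (h2 i h4)
      have h4 := Finset.eq_of_subset_of_card_le h3 (hmin r' h1)
      rw [← h4] at hi
      exact mem_sp.mp hi
    have hcontL : ContinuousOn (fun r' : Fin N → ℝ => ∑ i ∈ F, |Real.log (r' i)|) C := by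
      refine continuousOn_finset_sum _ fun i hi => ?_
      refine ContinuousOn.abs ?_
      exact ContinuousOn.log (by fun_prop) (fun r' hr' => hCs r' hr' i hi)
    obtain ⟨B, hB⟩ := hCc.exists_bound_of_continuousOn hcontL
    refine ⟨2 * B, ?_⟩
    intro u hu
    have huC : act a u (bary F) ∈ C := by
      refine ⟨hu.2, fun i hi => ?_⟩
      simp [act, bary_of_not hi]
    have hB1 := (le_abs_self _).trans (hB _ huC)
    have hd := (den_pos a u hb.1 hb1)
    have hcard : (F.card : ℝ) ≠ 0 := by exact_mod_cast hFn.card_pos.ne'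
    have hlog : ∀ i ∈ F, Real.log (act a u (bary F) i) = dt a i u +
        (Real.log ((F.card : ℝ)⁻¹) - Real.log (∑ j, bary F j * Real.exp (dt a j u))) := by
      intro i hi
      simp only [act]
      rw [bary_of_mem hi, Real.log_div (mul_ne_zero (inv_ne_zero hcard) (Real.exp_ne_zero _)) hd.ne',
        Real.log_mul (inv_ne_zero hcard) (Real.exp_ne_zero _),
        Real.log_exp]
      ring
    have hle : ∀ i ∈ F, |Real.log (act a u (bary F) i)| ≤ B := fun i hi =>
      (Finset.single_le_sum (f := fun i => |Real.log (act a u (bary F) i)|)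
        (fun i _ => abs_nonneg _) hi).trans hB1
    intro i hi i' hi'
    have h1 := abs_le.mp (hle i hi)
    have h2 := abs_le.mp (hle i' hi')
    rw [hlog i hi] at h1
    rw [hlog i' hi'] at h2
    rw [abs_le]
    constructor <;> linarith [h1.1, h1.2, h2.1, h2.2]

lemma exists_minimal_card {s : Set (Fin N → ℝ)} (hs : s.Nonempty) :
    ∃ r ∈ s, ∀ r' ∈ s, (sp r).card ≤ (sp r').card := by
  obtain ⟨r, hr, h⟩ := WellFounded.has_min (measure fun r : Fin N → ℝ => (sp r).card).wf s hs
  exact ⟨r, hr, fun r' hr' => not_lt.mp (h r' hr')⟩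

theorem Regs.pieces [NeZero N] {a : Fin N → Fin n → ℝ} {c : Fin N → ℝ} {M : ℕ} {Ω : Fin M → Set (Fin n → ℝ)}
    (h : Regs a c Ω) (hc : c ∉ Bad a) (hne : ∀ j, (Ω j).Nonempty) :
    ∃ (Fs : Fin M → Finset (Fin N)) (Q : Fin M → Set (Fin n → ℝ)),
      (∀ j, (Fs j).Nonempty) ∧ (∀ j, ∀ i ∉ Fs j, ∀ z ∈ KF a (insert i (Fs j)), z i = 0) ∧
      (∀ j, Piece a c (Fs j) (Q j)) ∧ (∀ i j, i ≠ j → Fs i = Fs j → Disjoint (Q i) (Q j)) := by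
  have hex : ∀ j, ∃ r ∈ closure (Pm a '' Ω j), lc c r ≠ 0 ∧
      ∀ r' ∈ closure (Pm a '' Ω j), (sp r).card ≤ (sp r').card := by
    intro j
    have hn : (closure (Pm a '' Ω j)).Nonempty := ((hne j).image _).closure
    obtain ⟨r, hr, hmin⟩ := exists_minimal_card hn
    obtain ⟨r', hr', h1, h2⟩ := h.reduce hc hr
    exact ⟨r', hr', h1, by rw [h2]; exact hmin⟩
  choose r hr hlc hmin using hex
  have hL : ∀ j, r j ∈ LL a := fun j => closure_mono (image_subset_range _ _) (hr j)
  refine ⟨fun j => sp (r j), fun j => Qp a c (Ω j) (sp (r j)), fun j => sp_nonempty (LL_sub a (hL j)),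
    fun j i hi z hz => LL_flat a (hL j) i hi z hz, fun j => h.piece (hr j) (hlc j) (hmin j), ?_⟩
  intro i j hij hF'
  rw [Set.disjoint_left]
  rintro u ⟨h1, h2⟩ ⟨h3, h4⟩
  simp only at hF'
  rw [hF'] at h2
  exact hij (h.unique h2 h4 ((lc_bary a c (sp_nonempty (LL_sub a (hL j))) u).mpr h3))

end AsyD
end Fewn

open Set Filter Topology

namespace Fewn

section NumA

/-- the summands of the crude bound -/
noncomputable def Es (x l s : ℕ) : ℝ :=
  ((x + l).choose s : ℝ) * (2 ^ ((l - s).choose 2) * (x : ℝ) ^ (l - s))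

lemma Es_nonneg (x l s : ℕ) : 0 ≤ Es x l s := by unfold Es; positivity

lemma crude1 {x l D : ℕ} (hD : D ≤ x) :
    (BB (D + l) D l : ℝ) ≤ 2 * (2 ^ (l.choose 2) * (D : ℝ) ^ l) + ∑ s ∈ Finset.range l, Es x l (s + 1) := by
  unfold BB
  push_cast
  gcongr with s hs
  rw [Es, show l - 1 - s = l - (s + 1) by omega]
  gcongr

lemma crude2 {x l p : ℕ} (hl : 1 ≤ l) (hx : 2 ≤ x) (hp : 2 * p ≤ x + l) :
    (p * BB (x - 2 + (l - 1)) (x - 2) (l - 1) : ℝ) ≤ Es x l 1 +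
      ∑ s ∈ Finset.range (l - 1), ((s + 2 : ℝ) / 2) * Es x l (s + 2) := by
  have hp' : (p : ℝ) ≤ ((x + l : ℕ) : ℝ) / 2 := by
    rw [le_div_iff₀ (by norm_num)]; exact_mod_cast (by linarith)
  unfold BB
  push_cast
  rw [mul_add, Finset.mul_sum]
  have hcast : ((x - 2 : ℕ) : ℝ) ≤ x := by exact_mod_cast Nat.sub_le _ _
  refine add_le_add ?_ (Finset.sum_le_sum fun s hs => ?_)
  · rw [Es, Nat.choose_one_right]
    calc (p : ℝ) * (2 * (2 ^ ((l - 1).choose 2) * ((x - 2 : ℕ) : ℝ) ^ (l - 1)))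
        ≤ (((x + l : ℕ) : ℝ) / 2) * (2 * (2 ^ ((l - 1).choose 2) * (x : ℝ) ^ (l - 1))) := by gcongr
      _ = _ := by ring
  · rw [Es, show l - 1 - 1 - s = l - (s + 2) by omega]
    have h1 : ((x + l : ℕ) : ℝ) * ((x + l - 1).choose (s + 1) : ℝ) = (x + l).choose (s + 2) * (s + 2) := by
      obtain ⟨m, hm⟩ : ∃ m, x + l = m + 1 := ⟨x + l - 1, by omega⟩
      rw [hm]
      have := Nat.add_one_mul_choose_eq m (s + 1)
      simp only [Nat.add_sub_cancel]
      have h2 : (((m + 1) * m.choose (s + 1) : ℕ) : ℝ) = (((m + 1).choose (s + 1 + 1) * (s + 1 + 1) : ℕ) : ℝ) := by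
        exact_mod_cast this
      push_cast at h2 ⊢
      rw [h2]; ring
    have h3 : ((x - 2 + (l - 1)).choose (s + 1) : ℝ) ≤ ((x + l - 1).choose (s + 1) : ℝ) := by
      exact_mod_cast Nat.choose_le_choose _ (by omega)
    calc (p : ℝ) * (((x - 2 + (l - 1)).choose (s + 1) : ℝ) * (2 ^ ((l - (s + 2)).choose 2) * ((x - 2 : ℕ) : ℝ) ^ (l - (s + 2))))
        ≤ (((x + l : ℕ) : ℝ) / 2) * (((x + l - 1).choose (s + 1) : ℝ) * (2 ^ ((l - (s + 2)).choose 2) * (x : ℝ) ^ (l - (s + 2)))) := by gcongr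
      _ = (((x + l : ℕ) : ℝ) * ((x + l - 1).choose (s + 1) : ℝ)) / 2 * (2 ^ ((l - (s + 2)).choose 2) * (x : ℝ) ^ (l - (s + 2))) := by ring
      _ = _ := by rw [h1]; ring

lemma crude3 {x l : ℕ} (hx : 2 ≤ x) (G : ℕ → ℕ) (hG : ∀ f, 2 ≤ f → 3 * G f ≤ (x + l).choose f) :
    (∑ f ∈ Finset.Icc 2 l, (G f * BB (x - 2 + (l - f)) (x - 2) (l - f) : ℝ)) ≤
      ∑ s ∈ Finset.Icc 2 l, (2 / 3 + 2 ^ s / 3) * Es x l s := by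
  have hcast : ((x - 2 : ℕ) : ℝ) ≤ x := by exact_mod_cast Nat.sub_le _ _
  have h1 : ∀ f ∈ Finset.Icc 2 l, (G f * BB (x - 2 + (l - f)) (x - 2) (l - f) : ℝ) ≤
      2 / 3 * Es x l f + ∑ t ∈ Finset.Ico (f + 1) (l + 1), (t.choose f : ℝ) * (Es x l t / 3) := by
    intro f hf
    rw [Finset.mem_Icc] at hf
    have hG' : (G f : ℝ) ≤ ((x + l).choose f : ℝ) / 3 := by
      rw [le_div_iff₀ (by norm_num)]; exact_mod_cast (by linarith [hG f hf.1])
    rw [Finset.sum_Ico_eq_sum_range, show l + 1 - (f + 1) = l - f by omega]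
    unfold BB
    push_cast
    rw [mul_add, Finset.mul_sum]
    refine add_le_add ?_ (Finset.sum_le_sum fun s hs => ?_)
    · rw [Es]
      calc (G f : ℝ) * (2 * (2 ^ ((l - f).choose 2) * ((x - 2 : ℕ) : ℝ) ^ (l - f)))
        ≤ (((x + l).choose f : ℝ) / 3) * (2 * (2 ^ ((l - f).choose 2) * (x : ℝ) ^ (l - f))) := by gcongr
        _ = _ := by ring
    · rw [Finset.mem_range] at hs
      rw [Es, show l - f - 1 - s = l - (f + 1 + s) by omega]
      have h2 : ((x + l).choose f : ℝ) * ((x + l - f).choose (s + 1)) =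
          (x + l).choose (f + 1 + s) * ((f + 1 + s).choose f) := by
        have := Nat.choose_mul (n := x + l) (k := f + 1 + s) (s := f) (by omega)
        rw [show f + 1 + s - f = s + 1 by omega] at this
        exact_mod_cast this.symm
      have h3 : ((x - 2 + (l - f)).choose (s + 1) : ℝ) ≤ ((x + l - f).choose (s + 1) : ℝ) := by
        exact_mod_cast Nat.choose_le_choose _ (by omega)
      calc (G f : ℝ) * (((x - 2 + (l - f)).choose (s + 1) : ℝ) * (2 ^ ((l - (f + 1 + s)).choose 2) * ((x - 2 : ℕ) : ℝ) ^ (l - (f + 1 + s))))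
        ≤ (((x + l).choose f : ℝ) / 3) * (((x + l - f).choose (s + 1) : ℝ) * (2 ^ ((l - (f + 1 + s)).choose 2) * (x : ℝ) ^ (l - (f + 1 + s)))) := by gcongr
        _ = (((x + l).choose f : ℝ) * ((x + l - f).choose (s + 1))) / 3 * (2 ^ ((l - (f + 1 + s)).choose 2) * (x : ℝ) ^ (l - (f + 1 + s))) := by ring
        _ = _ := by rw [h2]; ring
  refine (Finset.sum_le_sum h1).trans ?_
  rw [Finset.sum_add_distrib]
  rw [Finset.sum_comm' (t' := Finset.Icc 2 l) (s' := fun t => Finset.Ico 2 t) (by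
    intro f t; simp only [Finset.mem_Icc, Finset.mem_Ico]; omega)]
  rw [← Finset.sum_add_distrib]
  refine Finset.sum_le_sum fun t ht => ?_
  rw [← Finset.sum_mul]
  have h4 : (∑ f ∈ Finset.Ico 2 t, (t.choose f : ℝ)) ≤ 2 ^ t := by
    have := Nat.sum_range_choose t
    have h5 : (∑ f ∈ Finset.range (t + 1), (t.choose f : ℝ)) = 2 ^ t := by exact_mod_cast this
    rw [← h5]
    refine Finset.sum_le_sum_of_subset_of_nonneg ?_ (fun _ _ _ => by positivity)
    intro f hf
    simp only [Finset.mem_Ico, Finset.mem_range] at *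
    omega
  have h6 := Es_nonneg x l t
  nlinarith [mul_le_mul_of_nonneg_right h4 h6]

lemma wcoef (s : ℕ) (hs : 2 ≤ s) : (1 : ℝ) + s / 2 + (2 / 3 + 2 ^ s / 3) ≤ 2 ^ s := by
  induction s, hs using Nat.le_induction with
  | base => norm_num
  | succ s hs ih =>
    have : (2:ℝ) ≤ s := by exact_mod_cast hs
    push_cast
    rw [pow_succ]
    linarith

lemma sum_range_Icc (l : ℕ) (g : ℕ → ℝ) :
    ∑ s ∈ Finset.range (l - 1), g (s + 2) = ∑ s ∈ Finset.Icc 2 l, g s := by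
  have : Finset.Icc 2 l = Finset.Ico 2 (l + 1) := by ext; simp [Nat.lt_succ_iff]
  rw [this, Finset.sum_Ico_eq_sum_range, show l + 1 - 2 = l - 1 by omega]
  exact Finset.sum_congr rfl fun s _ => by rw [add_comm]

/-- crude bound for the total count -/
lemma crude {x l p D : ℕ} (hl : 1 ≤ l) (hx : 2 ≤ x) (hD : D ≤ x) (hp : 2 * p ≤ x + l)
    (G : ℕ → ℕ) (hG : ∀ f, 2 ≤ f → 3 * G f ≤ (x + l).choose f) :
    (BB (D + l) D l : ℝ) + (p * BB (x - 2 + (l - 1)) (x - 2) (l - 1) : ℝ) +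
      (∑ f ∈ Finset.Icc 2 l, (G f * BB (x - 2 + (l - f)) (x - 2) (l - f) : ℝ)) ≤
    2 * (2 ^ (l.choose 2) * (D : ℝ) ^ l) + 2 * Es x l 1 + ∑ s ∈ Finset.Icc 2 l, 2 ^ s * Es x l s := by
  have h1 := crude1 (l := l) hD
  have h2 := crude2 hl hx hp
  have h3 := crude3 hx G hG
  have e1 : ∑ s ∈ Finset.range l, Es x l (s + 1) = Es x l 1 + ∑ s ∈ Finset.Icc 2 l, Es x l s := by
    rw [← sum_range_Icc]
    obtain ⟨m, rfl⟩ : ∃ m, l = m + 1 := ⟨l - 1, by omega⟩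
    rw [Finset.sum_range_succ', add_comm]
    rfl
  have e2 : ∑ s ∈ Finset.range (l - 1), ((s + 2 : ℝ) / 2) * Es x l (s + 2) =
      ∑ s ∈ Finset.Icc 2 l, ((s : ℝ) / 2) * Es x l s := by
    rw [← sum_range_Icc]
    push_cast; rfl
  rw [e1] at h1
  rw [e2] at h2
  have h4 : ∑ s ∈ Finset.Icc 2 l, Es x l s + ∑ s ∈ Finset.Icc 2 l, ((s : ℝ) / 2) * Es x l s +
      ∑ s ∈ Finset.Icc 2 l, (2 / 3 + 2 ^ s / 3) * Es x l s ≤ ∑ s ∈ Finset.Icc 2 l, 2 ^ s * Es x l s := by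
    rw [← Finset.sum_add_distrib, ← Finset.sum_add_distrib]
    refine Finset.sum_le_sum fun s hs => ?_
    have := wcoef s (Finset.mem_Icc.mp hs).1
    have h5 := mul_le_mul_of_nonneg_right this (Es_nonneg x l s)
    linarith
  linarith

end NumA
end Fewn

open Set Filter Topology

namespace Fewn

section NumB

lemma Es_ratio {x l s : ℕ} (hx : 4 ≤ x) (hl : 5 ≤ l) (hs : 1 ≤ s) (hsl : s < l) :
    4 * Es x l (s + 1) ≤ Es x l s := by
  obtain ⟨t, rfl⟩ : ∃ t, l = s + t + 1 := ⟨l - s - 1, by omega⟩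
  unfold Es
  rw [show s + t + 1 - (s + 1) = t by omega, show s + t + 1 - s = t + 1 by omega]
  have h1 : ((x + (s + t + 1)).choose (s + 1) : ℝ) * (s + 1) = (x + (s + t + 1)).choose s * (x + t + 1) := by
    have := Nat.choose_succ_right_eq (x + (s + t + 1)) s
    rw [show x + (s + t + 1) - s = x + t + 1 by omega] at this
    exact_mod_cast this
  have h2 : (t + 1).choose 2 = t.choose 2 + t := by
    have := Nat.choose_succ_succ t 1
    simp at this
    rw [this]; ring
  have hxr : (4 : ℝ) ≤ x := by exact_mod_cast hx
  have hsr : (1 : ℝ) ≤ s := by exact_mod_cast hs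
  have h3 : 4 * ((x : ℝ) + t + 1) ≤ (s + 1) * (2 ^ t * x) := by
    rcases t with _ | _ | _ | t
    · have : (4 : ℝ) ≤ s := by exact_mod_cast (by omega : 4 ≤ s)
      norm_num; nlinarith
    · have : (3 : ℝ) ≤ s := by exact_mod_cast (by omega : 3 ≤ s)
      norm_num; nlinarith
    · have : (2 : ℝ) ≤ s := by exact_mod_cast (by omega : 2 ≤ s)
      norm_num; nlinarith
    · have h4 : ((t : ℝ) + 8) ≤ 2 ^ (t + 1 + 1 + 1) := by
        have : t + 8 ≤ 2 ^ (t + 1 + 1 + 1) := by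
          have : t + 1 ≤ 2 ^ t := Nat.lt_two_pow_self
          rw [pow_succ, pow_succ, pow_succ]; omega
        exact_mod_cast this
      have h5 : (2 : ℝ) * (((t : ℝ) + 8) * x) ≤ (s + 1) * (2 ^ (t + 1 + 1 + 1) * x) := by
        gcongr; linarith
      push_cast
      have : (0 : ℝ) ≤ t := by positivity
      nlinarith
  rw [h2]
  have hs1 : (0 : ℝ) < s + 1 := by positivity
  refine le_of_mul_le_mul_left ?_ hs1
  have hC : (0 : ℝ) ≤ ((x + (s + t + 1)).choose s : ℝ) * (2 ^ t.choose 2 * (x : ℝ) ^ t) := by positivity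
  calc ((s : ℝ) + 1) * (4 * (((x + (s + t + 1)).choose (s + 1) : ℝ) * (2 ^ t.choose 2 * (x : ℝ) ^ t)))
      = 4 * ((((x + (s + t + 1)).choose (s + 1) : ℝ) * (s + 1)) * (2 ^ t.choose 2 * (x : ℝ) ^ t)) := by ring
    _ = (((x + (s + t + 1)).choose s : ℝ) * (2 ^ t.choose 2 * (x : ℝ) ^ t)) * (4 * ((x : ℝ) + t + 1)) := by
        rw [h1]; ring
    _ ≤ (((x + (s + t + 1)).choose s : ℝ) * (2 ^ t.choose 2 * (x : ℝ) ^ t)) * ((s + 1) * (2 ^ t * x)) := by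
        gcongr
    _ = _ := by rw [pow_add, pow_succ]; ring

lemma Es_geom {x l : ℕ} (hx : 4 ≤ x) (hl : 5 ≤ l) (j : ℕ) (hj : 1 ≤ j) (hjl : j ≤ l) :
    2 * Es x l 1 + ∑ s ∈ Finset.Icc 2 j, 2 ^ s * Es x l s ≤ 2 * (2 * Es x l 1) - 2 ^ j * Es x l j := by
  induction j, hj using Nat.le_induction with
  | base => simp; linarith
  | succ j hj ih =>
    have := ih (by omega)
    have h1 := Es_ratio hx hl hj (by omega)
    rw [Finset.sum_Icc_succ_top (by omega)]
    have h2 : (2 : ℝ) ^ (j + 1) * Es x l (j + 1) * 2 ≤ 2 ^ j * Es x l j := by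
      rw [pow_succ]
      have : (0 : ℝ) ≤ 2 ^ j := by positivity
      nlinarith
    linarith

lemma Es_one {x l : ℕ} (hx : 4 ≤ x) (hl : 5 ≤ l) : 2 * (2 * Es x l 1) ≤ 0.59725 * (2 ^ (l.choose 2) * (x : ℝ) ^ l) := by
  obtain ⟨t, rfl⟩ : ∃ t, l = t + 5 := ⟨l - 5, by omega⟩
  unfold Es
  rw [Nat.choose_one_right, show t + 5 - 1 = t + 4 by omega]
  have h2 : (t + 5).choose 2 = (t + 4).choose 2 + (t + 4) := by
    have := Nat.choose_succ_succ (t + 4) 1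
    simp at this
    rw [this]; ring
  rw [h2]
  have h3 : (16 : ℝ) * (t + 1) ≤ 2 ^ (t + 4) := by
    have : 16 * (t + 1) ≤ 2 ^ (t + 4) := by
      have : t + 1 ≤ 2 ^ t := Nat.lt_two_pow_self
      rw [pow_add]; omega
    exact_mod_cast this
  have hxr : (4 : ℝ) ≤ x := by exact_mod_cast hx
  have ht : (0 : ℝ) ≤ t := by positivity
  have h4 : 4 * ((x : ℝ) + (t + 5)) ≤ 0.59725 * (2 ^ (t + 4) * x) := by
    have : (16 : ℝ) * (t + 1) * x ≤ 2 ^ (t + 4) * x := by gcongr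
    nlinarith
  push_cast
  have hC : (0 : ℝ) ≤ 2 ^ ((t + 4).choose 2) * (x : ℝ) ^ (t + 4) := by positivity
  calc 2 * (2 * (((x : ℝ) + (t + 5)) * (2 ^ ((t + 4).choose 2) * (x : ℝ) ^ (t + 4))))
      = (2 ^ ((t + 4).choose 2) * (x : ℝ) ^ (t + 4)) * (4 * ((x : ℝ) + (t + 5))) := by ring
    _ ≤ (2 ^ ((t + 4).choose 2) * (x : ℝ) ^ (t + 4)) * (0.59725 * (2 ^ (t + 4) * x)) := by gcongr
    _ = _ := by rw [pow_add, pow_succ (x : ℝ)]; ring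

lemma choose3 (m : ℕ) : ((m + 3).choose 3 : ℝ) = (m + 3) * (m + 2) * (m + 1) / 6 := by
  have h := Nat.add_one_mul_choose_eq (m + 2) 2
  have h' := Nat.add_one_mul_choose_eq (m + 1) 1
  have e1 : (((m + 2 + 1) * (m + 2).choose 2 : ℕ) : ℝ) = ((m + 2 + 1).choose (2 + 1) * (2 + 1) : ℕ) := by exact_mod_cast h
  have e2 : (((m + 1 + 1) * (m + 1).choose 1 : ℕ) : ℝ) = ((m + 1 + 1).choose (1 + 1) * (1 + 1) : ℕ) := by exact_mod_cast h'
  rw [Nat.choose_one_right] at e2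
  push_cast at e1 e2
  have e3 : ((m + 2).choose 2 : ℝ) = (m + 2) * (m + 1) / 2 := by
    have : ((m + 1 + 1).choose (1 + 1) : ℝ) = ((m + 2).choose 2 : ℝ) := rfl
    rw [← this]; linarith
  have : ((m + 2 + 1).choose (2 + 1) : ℝ) = ((m + 3).choose 3 : ℝ) := rfl
  rw [← this]
  rw [e3] at e1
  linarith

lemma choose4 (m : ℕ) : ((m + 4).choose 4 : ℝ) = (m + 4) * (m + 3) * (m + 2) * (m + 1) / 24 := by
  have h := Nat.add_one_mul_choose_eq (m + 3) 3
  have e1 : (((m + 3 + 1) * (m + 3).choose 3 : ℕ) : ℝ) = ((m + 3 + 1).choose (3 + 1) * (3 + 1) : ℕ) := by exact_mod_cast h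
  push_cast at e1
  rw [choose3] at e1
  have : ((m + 3 + 1).choose (3 + 1) : ℝ) = ((m + 4).choose 4 : ℝ) := rfl
  rw [← this]
  linarith

lemma choose2 (m : ℕ) : ((m + 2).choose 2 : ℝ) = (m + 2) * (m + 1) / 2 := by
  rw [Nat.cast_choose_two]; push_cast; ring

lemma BB0 (m D : ℕ) : (BB m D 0 : ℝ) = 2 := by simp [BB]
lemma BB1 (D : ℕ) : (BB (D + 1) D 1 : ℝ) = 3 * D + 1 := by
  simp [BB]; ring
lemma BB2 (D : ℕ) : (BB (D + 2) D 2 : ℝ) = 4 * D ^ 2 + (D + 2) * D + (D + 2) * (D + 1) / 2 := by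
  simp only [BB, Finset.sum_range_succ, Finset.sum_range_zero]
  push_cast
  rw [choose2]
  simp
  ring
lemma BB3 (D : ℕ) : (BB (D + 3) D 3 : ℝ) =
    16 * D ^ 3 + (D + 3) * (2 * D ^ 2) + (D + 3) * (D + 2) / 2 * D + (D + 3) * (D + 2) * (D + 1) / 6 := by
  simp only [BB, Finset.sum_range_succ, Finset.sum_range_zero]
  push_cast
  rw [choose3, show D + 3 = (D + 1) + 2 by ring, choose2]
  simp [Nat.choose]
  ring

set_option maxHeartbeats 2000000 in
theorem num {n l p D M : ℕ} (G : ℕ → ℕ) (hn : 2 ≤ n) (hl : 2 ≤ l) (hp : 2 * p ≤ n + 2 + l)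
    (hD : D = max (n + 2 - max p 1) 1) (hG : ∀ f, 2 ≤ f → 3 * G f ≤ (n + 2 + l).choose f)
    (hM : 2 * M ≤ 2 * (n + 2 + l) + BB (D + l) D l + p * BB (n + (l - 1)) n (l - 1) +
      ∑ f ∈ Finset.Icc 2 l, G f * BB (n + (l - f)) n (l - f)) :
    2 * ((M : ℝ) - 1) ≤ (n + 2 + l : ℝ) * (n + 2 + l - 1) +
      2.59725 * 2 ^ (l.choose 2) * ((n : ℝ) + 2) ^ l := by
  have hnr : (2 : ℝ) ≤ n := by exact_mod_cast hn
  have hlr : (2 : ℝ) ≤ l := by exact_mod_cast hl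
  have hM' : 2 * (M : ℝ) ≤ 2 * (n + 2 + l) + BB (D + l) D l + p * BB (n + (l - 1)) n (l - 1) +
      ∑ f ∈ Finset.Icc 2 l, (G f * BB (n + (l - f)) n (l - f) : ℝ) := by exact_mod_cast hM
  have hDn : D ≤ n + 1 := by rw [hD]; omega
  have hDr : (D : ℝ) ≤ n + 1 := by exact_mod_cast hDn
  by_cases hl4 : 4 ≤ l
  · have hcr := crude (x := n + 2) (l := l) (p := p) (D := D) (by omega) (by omega) (by omega) hp G hG
    simp only [Nat.add_sub_cancel] at hcr
    by_cases hl5 : 5 ≤ l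
    · have h1 := Es_geom (x := n + 2) (by omega) hl5 l (by omega) le_rfl
      have h2 := Es_one (x := n + 2) (by omega) hl5
      have h3 : (0:ℝ) ≤ 2 ^ l * Es (n + 2) l l := mul_nonneg (by positivity) (Es_nonneg _ _ _)
      have h4 : (2:ℝ) ^ (l.choose 2) * (D : ℝ) ^ l ≤ 2 ^ (l.choose 2) * ((n : ℝ) + 2) ^ l := by
        gcongr; linarith
      push_cast at h2
      nlinarith
    · obtain rfl : l = 4 := by omega
      have e : ∑ s ∈ Finset.Icc 2 4, (2:ℝ) ^ s * Es (n + 2) 4 s =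
          4 * Es (n + 2) 4 2 + 8 * Es (n + 2) 4 3 + 16 * Es (n + 2) 4 4 := by
        rw [show Finset.Icc 2 4 = {2, 3, 4} by rfl]
        simp; ring
      rw [e] at hcr
      have e1 : Es (n + 2) 4 1 = (n + 6) * (8 * (n + 2) ^ 3) := by
        simp [Es, Nat.choose]; ring
      have e2 : Es (n + 2) 4 2 = (n + 6) * (n + 5) / 2 * (2 * (n + 2) ^ 2) := by
        rw [Es, show n + 2 + 4 = (n + 4) + 2 by ring, choose2, show Nat.choose (4 - 2) 2 = 1 by rfl, show 4 - 2 = 2 by rfl]; push_cast; ring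
      have e3 : Es (n + 2) 4 3 = (n + 6) * (n + 5) * (n + 4) / 6 * (n + 2) := by
        rw [Es, show n + 2 + 4 = (n + 3) + 3 by ring, choose3, show Nat.choose (4 - 3) 2 = 0 by rfl, show 4 - 3 = 1 by rfl]; push_cast; ring
      have e4 : Es (n + 2) 4 4 = (n + 6) * (n + 5) * (n + 4) * (n + 3) / 24 := by
        rw [Es, show n + 2 + 4 = (n + 2) + 4 by ring, choose4]; simp; ring
      rw [e1, e2, e3, e4] at hcr
      have h4 : (2:ℝ) ^ (Nat.choose 4 2) * (D : ℝ) ^ 4 ≤ 64 * ((n : ℝ) + 1) ^ 4 := by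
        rw [show Nat.choose 4 2 = 6 by rfl]
        have : (D : ℝ) ^ 4 ≤ (n + 1) ^ 4 := by gcongr
        linarith
      rw [show Nat.choose 4 2 = 6 by rfl] at *
      obtain ⟨m, rfl⟩ : ∃ m, n = m + 2 := ⟨n - 2, by omega⟩
      push_cast at *
      have hm : (0 : ℝ) ≤ m := by positivity
      have key : 2 * (64 * ((m : ℝ) + 2 + 1) ^ 4) + 2 * ((m + 2 + 6) * (8 * (m + 2 + 2) ^ 3)) + (
          4 * ((m + 2 + 6) * (m + 2 + 5) / 2 * (2 * (m + 2 + 2) ^ 2)) + 8 * ((m + 2 + 6) * (m + 2 + 5) * (m + 2 + 4) / 6 * (m + 2 + 2))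
          + 16 * ((m + 2 + 6) * (m + 2 + 5) * (m + 2 + 4) * (m + 2 + 3) / 24)) ≤
          2.59725 * 2 ^ 6 * ((m : ℝ) + 2 + 2) ^ 4 := by
        rw [← sub_nonneg]
        ring_nf
        positivity
      nlinarith
  · have hDp : (1 ≤ p → (D : ℝ) = n + 2 - p) ∧ (p = 0 → D = n + 1) := by
      constructor
      · intro h
        have : D + p = n + 2 := by rw [hD]; omega
        have : (D : ℝ) + p = n + 2 := by exact_mod_cast this
        linarith
      · intro h; rw [hD]; omega
    have hD0 : (0 : ℝ) ≤ D := by positivity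
    have hsum2 := fun f (hf : 2 ≤ f) => (by exact_mod_cast hG f hf : 3 * (G f : ℝ) ≤ ((n + 2 + l).choose f : ℝ))
    by_cases hl3 : l = 3
    · subst hl3
      have e : ∑ f ∈ Finset.Icc 2 3, (G f * BB (n + (3 - f)) n (3 - f) : ℝ) =
          G 2 * (3 * n + 1) + G 3 * 2 := by
        rw [show Finset.Icc 2 3 = {2, 3} by rfl]
        simp [BB0, BB1]
      rw [e, show 3 - 1 = 2 by rfl, BB3, BB2] at hM'
      have g2 := hsum2 2 (by norm_num)
      have g3 := hsum2 3 (by norm_num)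
      rw [show n + 2 + 3 = (n + 3) + 2 by ring, choose2] at g2
      rw [show n + 2 + 3 = (n + 2) + 3 by ring, choose3] at g3
      push_cast at *
      have hmain : 16 * (D:ℝ) ^ 3 + (D + 3) * (2 * D ^ 2) + (D + 3) * (D + 2) / 2 * D + (D + 3) * (D + 2) * (D + 1) / 6 +
          p * (4 * (n:ℝ) ^ 2 + (n + 2) * n + (n + 2) * (n + 1) / 2) ≤
          16 * ((n:ℝ) + 1) ^ 3 + ((n:ℝ) + 1 + 3) * (2 * (n + 1) ^ 2) + ((n:ℝ) + 1 + 3) * (n + 1 + 2) / 2 * (n + 1) +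
          ((n:ℝ) + 1 + 3) * (n + 1 + 2) * (n + 1 + 1) / 6 + (4 * (n:ℝ) ^ 2 + (n + 2) * n + (n + 2) * (n + 1) / 2) := by
        rcases Nat.eq_zero_or_pos p with h0 | h0
        · rw [hDp.2 h0, h0]; push_cast
          have : (0:ℝ) ≤ 4 * (n:ℝ) ^ 2 + (n + 2) * n + (n + 2) * (n + 1) / 2 := by positivity
          linarith
        · have hpD : (p : ℝ) = n + 2 - D := by linarith [hDp.1 h0]
          rw [hpD]
          set y : ℝ := n + 1 - D with hy
          have hy0 : 0 ≤ y := by linarith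
          have e1 : (D : ℝ) = n + 1 - y := by linarith
          have hd2 : (D : ℝ) ^ 2 ≤ D * (n + 1) := by nlinarith
          have hd3 : (D : ℝ) ^ 3 ≤ D * (n + 1) ^ 2 := by nlinarith [mul_le_mul_of_nonneg_right hd2 hD0]
          have hlin : 0 ≤ y * (10 * (n + 1:ℝ) ^ 2) := by positivity
          have hyn : 0 ≤ y * n := by positivity
          have hyn2 : 0 ≤ y * (n : ℝ) ^ 2 := by positivity
          nlinarith
      obtain ⟨m, rfl⟩ : ∃ m, n = m + 2 := ⟨n - 2, by omega⟩
      rw [show Nat.choose 3 2 = 3 by rfl]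
      push_cast at *
      have hm : (0 : ℝ) ≤ m := by positivity
      have g2' := mul_le_mul_of_nonneg_right g2 (by positivity : (0:ℝ) ≤ 3 * (m + 2) + 1)
      have key : 2 * ((m:ℝ) + 2 + 2 + 3) - 2 + (16 * ((m:ℝ) + 2 + 1) ^ 3 + ((m:ℝ) + 2 + 1 + 3) * (2 * (m + 2 + 1) ^ 2) + ((m:ℝ) + 2 + 1 + 3) * (m + 2 + 1 + 2) / 2 * (m + 2 + 1) +
          ((m:ℝ) + 2 + 1 + 3) * (m + 2 + 1 + 2) * (m + 2 + 1 + 1) / 6 + (4 * ((m:ℝ) + 2) ^ 2 + (m + 2 + 2) * (m + 2) + (m + 2 + 2) * (m + 2 + 1) / 2))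
          + ((m + 2 + 3 + 2) * (m + 2 + 3 + 1) / 2 * (3 * (m + 2) + 1)) / 3 + ((m:ℝ) + 2 + 2 + 3) * (m + 2 + 2 + 2) * (m + 2 + 2 + 1) / 6 * 2 / 3 ≤
          (m + 2 + 2 + 3 : ℝ) * (m + 2 + 2 + 3 - 1) + 2.59725 * 2 ^ 3 * ((m : ℝ) + 2 + 2) ^ 3 := by
        rw [← sub_nonneg]
        ring_nf
        positivity
      linarith
    · obtain rfl : l = 2 := by omega
      have e : ∑ f ∈ Finset.Icc 2 2, (G f * BB (n + (2 - f)) n (2 - f) : ℝ) = G 2 * 2 := by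
        simp [BB0]
      rw [e, show 2 - 1 = 1 by rfl, BB1, BB2] at hM'
      have g2 := hsum2 2 (by norm_num)
      rw [show n + 2 + 2 = (n + 2) + 2 by ring, choose2] at g2
      push_cast at *
      have hmain : 4 * (D:ℝ) ^ 2 + (D + 2) * D + (D + 2) * (D + 1) / 2 +
          p * (3 * n + 1) ≤
          4 * ((n:ℝ) + 1) ^ 2 + ((n:ℝ) + 1 + 2) * (n + 1) + ((n:ℝ) + 1 + 2) * (n + 1 + 1) / 2 + (3 * n + 1) := by
        rcases Nat.eq_zero_or_pos p with h0 | h0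
        · rw [hDp.2 h0, h0]; push_cast
          have : (0:ℝ) ≤ 3 * n + 1 := by positivity
          linarith
        · have hpD : (p : ℝ) = n + 2 - D := by linarith [hDp.1 h0]
          rw [hpD]
          have hd2 : (D : ℝ) ^ 2 ≤ D * (n + 1) := by nlinarith
          nlinarith
      rw [show Nat.choose 2 2 = 1 by rfl]
      nlinarith

end NumB
end Fewn

open Set Filter Topology

namespace Fewn

section CountA

variable {n N : ℕ}

lemma KF_mono (a : Fin N → Fin n → ℝ) {F G : Finset (Fin N)} (h : F ⊆ G) : KF a F ≤ KF a G :=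
  fun z hz => ⟨fun i hi => hz.1 i (fun h' => hi (h h')), hz.2⟩

lemma KF_of_univ (a : Fin N → Fin n → ℝ) {F G : Finset (Fin N)} {z : Fin N → ℝ} (hz : z ∈ KF a G)
    (h : ∀ i ∉ F, z i = 0) : z ∈ KF a F := ⟨h, hz.2⟩

lemma KF_elim (a : Fin N → Fin n → ℝ) {G : Finset (Fin N)} {z w : Fin N → ℝ} {j : Fin N}
    (hz : z ∈ KF a G) (hj : z j ≠ 0) (hw : w ∈ KF a G) : w - (w j / z j) • z ∈ KF a (G.erase j) := by
  have h1 : w - (w j / z j) • z ∈ KF a G := Submodule.sub_mem _ hw (Submodule.smul_mem _ _ hz)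
  refine KF_of_univ a h1 fun i hi => ?_
  by_cases hij : i = j
  · subst hij; simp [hj]
  · exact h1.1 i (fun h => hi (Finset.mem_erase.mpr ⟨hij, h⟩))

lemma KF_drop (a : Fin N → Fin n → ℝ) {G : Finset (Fin N)} {z : Fin N → ℝ} {j : Fin N}
    (hz : z ∈ KF a G) (hj : z j ≠ 0) :
    Module.finrank ℝ (KF a G) = Module.finrank ℝ (KF a (G.erase j)) + 1 := by
  apply le_antisymm
  · have h1 : KF a G ≤ KF a (G.erase j) ⊔ Submodule.span ℝ {z} := by
      intro w hw
      have := Submodule.add_mem_sup (KF_elim a hz hj hw)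
        (Submodule.smul_mem _ (w j / z j) (Submodule.mem_span_singleton_self (R := ℝ) z))
      simpa using this
    refine (Submodule.finrank_mono h1).trans ((Submodule.finrank_add_le_finrank_add_finrank _ _).trans ?_)
    have := finrank_span_singleton (K := ℝ) (v := z) (by rintro rfl; simp at hj)
    rw [this]
  · refine Submodule.finrank_lt_finrank_of_lt (lt_of_le_of_ne (KF_mono a (Finset.erase_subset _ _)) ?_)
    intro h
    rw [← h] at hz
    exact hj (hz.1 j (by simp))

lemma KF_drop_le (a : Fin N → Fin n → ℝ) (G : Finset (Fin N)) (j : Fin N) :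
    Module.finrank ℝ (KF a G) ≤ Module.finrank ℝ (KF a (G.erase j)) + 1 := by
  by_cases h : ∃ z ∈ KF a G, z j ≠ 0
  · obtain ⟨z, hz, hj⟩ := h
    exact (KF_drop a hz hj).le
  · push Not at h
    refine (Submodule.finrank_mono ?_).trans (Nat.le_succ _)
    intro z hz
    refine KF_of_univ a hz fun i hi => ?_
    by_cases hij : i = j
    · subst hij; exact h z hz
    · exact hz.1 i (fun h => hi (Finset.mem_erase.mpr ⟨hij, h⟩))

lemma compl_insert' (I : Finset (Fin N)) (j : Fin N) : (insert j I)ᶜ = Iᶜ.erase j := by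
  ext i; simp

lemma KF_lower (a : Fin N → Fin n → ℝ) (I : Finset (Fin N)) :
    Module.finrank ℝ (KF a Finset.univ) ≤ Module.finrank ℝ (KF a Iᶜ) + I.card := by
  induction I using Finset.induction_on with
  | empty => rw [Finset.compl_empty]; simp
  | insert j I hj ih =>
    rw [Finset.card_insert_of_notMem hj, compl_insert']
    have := KF_drop_le a Iᶜ j
    omega

lemma ex_base (a : Fin N → Fin n → ℝ) {F : Finset (Fin N)} {f : ℕ}
    (hf : Module.finrank ℝ (KF a F) + f = Module.finrank ℝ (KF a Finset.univ)) (m : ℕ) (hm : m ≤ f) :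
    ∃ I : Finset (Fin N), I ⊆ Fᶜ ∧ I.card = m ∧
      Module.finrank ℝ (KF a Iᶜ) + m = Module.finrank ℝ (KF a Finset.univ) := by
  induction m with
  | zero => exact ⟨∅, by simp, rfl, by rw [Finset.compl_empty]; rfl⟩
  | succ m ih =>
    obtain ⟨I, hI, hc, hr⟩ := ih (by omega)
    have : ∃ z ∈ KF a Iᶜ, z ∉ KF a F := by
      by_contra hcon
      push Not at hcon
      have := Submodule.finrank_mono (show KF a Iᶜ ≤ KF a F from hcon)
      omega
    obtain ⟨z, hz, hzF⟩ := this
    have : ∃ j, j ∉ F ∧ z j ≠ 0 := by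
      by_contra hcon
      push Not at hcon
      exact hzF (KF_of_univ a hz hcon)
    obtain ⟨j, hjF, hj⟩ := this
    have hjI : j ∉ I := fun h => hj (hz.1 j (by simpa using h))
    refine ⟨insert j I, ?_, by rw [Finset.card_insert_of_notMem hjI, hc], ?_⟩
    · intro i hi
      rcases Finset.mem_insert.mp hi with rfl | hi
      · simpa using hjF
      · exact hI hi
    · rw [compl_insert']
      have := KF_drop a hz hj
      omega

/-- faces that can carry pieces -/
structure Good (a : Fin N → Fin n → ℝ) (F : Finset (Fin N)) : Prop where
  hc : 2 ≤ F.card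
  hflat : ∀ i ∉ F, ∀ z ∈ KF a (insert i F), z i = 0
  hfull : ∀ i ∈ F, ∃ z ∈ KF a F, z i ≠ 0

lemma Good.eq {a : Fin N → Fin n → ℝ} {F F' : Finset (Fin N)} (h : Good a F) (h' : Good a F')
    (he : KF a F = KF a F') : F = F' := by
  ext i
  constructor
  · intro hi
    obtain ⟨z, hz, hzi⟩ := h.hfull i hi
    by_contra hcon
    rw [he] at hz
    exact hzi (hz.1 i hcon)
  · intro hi
    obtain ⟨z, hz, hzi⟩ := h'.hfull i hi
    by_contra hcon
    rw [← he] at hz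
    exact hzi (hz.1 i hcon)

/-- bases of the complement -/
noncomputable def gens (a : Fin N → Fin n → ℝ) (F : Finset (Fin N)) (f : ℕ) : Finset (Finset (Fin N)) := by
  classical exact Finset.univ.filter fun I => I.card = f ∧ KF a Iᶜ = KF a F

lemma mem_gens {a : Fin N → Fin n → ℝ} {F I : Finset (Fin N)} {f : ℕ} :
    I ∈ gens a F f ↔ I.card = f ∧ KF a Iᶜ = KF a F := by simp [gens]

lemma eq_of_finrank {a : Fin N → Fin n → ℝ} {F G : Finset (Fin N)} (h : F ⊆ G)
    (hr : Module.finrank ℝ (KF a F) = Module.finrank ℝ (KF a G)) : KF a F = KF a G :=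
  Submodule.eq_of_le_of_finrank_eq (KF_mono a h) hr

lemma Good.exch {a : Fin N → Fin n → ℝ} {F : Finset (Fin N)} (hflat : ∀ i ∉ F, ∀ z ∈ KF a (insert i F), z i = 0) {f : ℕ}
    (hf : Module.finrank ℝ (KF a F) + f = Module.finrank ℝ (KF a Finset.univ))
    {I : Finset (Fin N)} (hI : I ⊆ Fᶜ) (hIc : I.card = f) (hIK : KF a Iᶜ = KF a F) (i : Fin N) (hi : i ∈ I) :
    ∃ j, j ∉ F ∧ j ∉ I ∧ insert j (I.erase i) ∈ gens a F f := by
  have hlow := KF_lower a (I.erase i)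
  have hce : (I.erase i).card + 1 = f := by rw [Finset.card_erase_add_one hi, hIc]
  have he : (I.erase i)ᶜ.erase i = Iᶜ := by
    rw [← compl_insert', Finset.insert_erase hi]
  have hex : ∃ z ∈ KF a (I.erase i)ᶜ, z i ≠ 0 := by
    by_contra hcon
    push Not at hcon
    have : KF a (I.erase i)ᶜ ≤ KF a Iᶜ := by
      intro z hz
      refine KF_of_univ a hz fun x hx => ?_
      by_cases hxi : x = i
      · subst hxi; exact hcon z hz
      · exact hz.1 x (by simpa [hxi] using hx)
    have := Submodule.finrank_mono this
    rw [hIK] at this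
    omega
  obtain ⟨z, hz, hzi⟩ := hex
  have hiF : i ∉ F := by have := hI hi; simpa using this
  have hex2 : ∃ j, j ∉ F ∧ j ∉ I ∧ z j ≠ 0 := by
    by_contra hcon
    push Not at hcon
    refine hzi (hflat i hiF z (KF_of_univ a hz fun x hx => ?_))
    rw [Finset.mem_insert, not_or] at hx
    by_cases hxI : x ∈ I
    · exact hz.1 x (by simp [hxI, hx.1])
    · exact hcon x hx.2 hxI
  obtain ⟨j, hjF, hjI, hzj⟩ := hex2
  refine ⟨j, hjF, hjI, mem_gens.mpr ⟨?_, ?_⟩⟩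
  · rw [Finset.card_insert_of_notMem (fun h => hjI (Finset.mem_of_mem_erase h)), hce]
  · symm
    refine eq_of_finrank ?_ ?_
    · intro x hx
      simp only [Finset.mem_compl, Finset.mem_insert, not_or]
      refine ⟨fun h => hjF (h ▸ hx), fun h => ?_⟩
      have := hI (Finset.mem_of_mem_erase h)
      simp at this
      exact this hx
    · rw [compl_insert']
      have h1 := KF_drop a hz hzj
      have h2 := KF_drop a hz hzi
      rw [he, hIK] at h2
      omega

lemma Good.base {a : Fin N → Fin n → ℝ} {F : Finset (Fin N)} {f : ℕ}
    (hf : Module.finrank ℝ (KF a F) + f = Module.finrank ℝ (KF a Finset.univ)) :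
    ∃ I : Finset (Fin N), I ⊆ Fᶜ ∧ I.card = f ∧ KF a Iᶜ = KF a F := by
  obtain ⟨I, hI, hc, hr⟩ := ex_base a hf f le_rfl
  refine ⟨I, hI, hc, ?_⟩
  symm
  refine eq_of_finrank ?_ (by omega)
  rw [Finset.subset_compl_comm]; exact hI

lemma Good.gens_card {a : Fin N → Fin n → ℝ} {F : Finset (Fin N)} (h : Good a F) {f : ℕ}
    (hf : Module.finrank ℝ (KF a F) + f = Module.finrank ℝ (KF a Finset.univ)) :
    f + 1 ≤ (gens a F f).card := by
  classical
  obtain ⟨I, hI, hc, hK⟩ := Good.base hf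
  have := fun i : {i // i ∈ I} => Good.exch h.hflat hf hI hc hK i i.2
  choose j hjF hjI hj using this
  let J : {i // i ∈ I} → Finset (Fin N) := fun i => insert (j i) (I.erase i)
  have hiJ : ∀ i, (i : Fin N) ∉ J i := by
    intro i hi
    rcases Finset.mem_insert.mp hi with h1 | h1
    · exact hjI i (h1 ▸ i.2)
    · simp at h1
  have hinj : Function.Injective J := by
    intro i i' hii
    by_contra hne
    have : (i' : Fin N) ∈ J i := Finset.mem_insert_of_mem
      (Finset.mem_erase.mpr ⟨fun h => hne (Subtype.ext h.symm), i'.2⟩)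
    rw [hii] at this
    exact hiJ i' this
  have hIn : I ∉ Finset.univ.image J := by
    intro h1
    obtain ⟨i, _, hi⟩ := Finset.mem_image.mp h1
    have := hiJ i
    rw [hi] at this
    exact this i.2
  have hsub : insert I (Finset.univ.image J) ⊆ gens a F f := by
    intro x hx
    rcases Finset.mem_insert.mp hx with rfl | hx
    · exact mem_gens.mpr ⟨hc, hK⟩
    · obtain ⟨i, _, rfl⟩ := Finset.mem_image.mp hx
      exact hj i
  have := Finset.card_le_card hsub
  rw [Finset.card_insert_of_notMem hIn, Finset.card_image_of_injective _ hinj] at this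
  simp [hc] at this
  exact this

lemma Good.card_le {a : Fin N → Fin n → ℝ} {F : Finset (Fin N)} (h : Good a F) {f : ℕ} (hf1 : 1 ≤ f)
    (hf : Module.finrank ℝ (KF a F) + f = Module.finrank ℝ (KF a Finset.univ)) :
    F.card + f + 1 ≤ N := by
  classical
  obtain ⟨I, hI, hc, hK⟩ := Good.base hf
  obtain ⟨i, hi⟩ := Finset.card_pos.mp (by omega : 0 < I.card)
  obtain ⟨j, hjF, hjI, _⟩ := Good.exch h.hflat hf hI hc hK i hi
  have hsub : insert j I ⊆ Fᶜ := by
    intro x hx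
    rcases Finset.mem_insert.mp hx with rfl | hx
    · simpa using hjF
    · exact hI hx
  have h1 := Finset.card_le_card hsub
  rw [Finset.card_insert_of_notMem hjI, Finset.card_compl, Fintype.card_fin] at h1
  omega

/-- good faces of codimension f -/
noncomputable def Gf (a : Fin N → Fin n → ℝ) (f : ℕ) : Finset (Finset (Fin N)) := by
  classical exact Finset.univ.filter fun F => Good a F ∧
    Module.finrank ℝ (KF a F) + f = Module.finrank ℝ (KF a Finset.univ)

lemma mem_Gf {a : Fin N → Fin n → ℝ} {f : ℕ} {F : Finset (Fin N)} : F ∈ Gf a f ↔ Good a F ∧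
    Module.finrank ℝ (KF a F) + f = Module.finrank ℝ (KF a Finset.univ) := by simp [Gf]

lemma gens_uniq {a : Fin N → Fin n → ℝ} {f : ℕ} {F F' I : Finset (Fin N)} (hF : Good a F) (hF' : Good a F')
    (h : I ∈ gens a F f) (h' : I ∈ gens a F' f) : F = F' :=
  hF.eq hF' ((mem_gens.mp h).2.symm.trans (mem_gens.mp h').2)

lemma Gf_card (a : Fin N → Fin n → ℝ) (f : ℕ) : (f + 1) * (Gf a f).card ≤ N.choose f := by
  classical
  have h1 : ((Gf a f).biUnion fun F => gens a F f).card = ∑ F ∈ Gf a f, (gens a F f).card := by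
    refine Finset.card_biUnion ?_
    intro F hF F' hF' hne
    change Disjoint (gens a F f) (gens a F' f)
    rw [Finset.disjoint_left]
    intro I hI hI'
    exact hne (gens_uniq (mem_Gf.mp hF).1 (mem_Gf.mp hF').1 hI hI')
  have h2 : ((Gf a f).biUnion fun F => gens a F f) ⊆ Finset.powersetCard f Finset.univ := by
    intro I hI
    obtain ⟨F, _, hF⟩ := Finset.mem_biUnion.mp hI
    exact Finset.mem_powersetCard.mpr ⟨Finset.subset_univ _, (mem_gens.mp hF).1⟩
  have h3 := Finset.card_le_card h2
  rw [h1, Finset.card_powersetCard, Finset.card_univ, Fintype.card_fin] at h3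
  refine le_trans ?_ h3
  rw [mul_comm]
  have := Finset.card_nsmul_le_sum (Gf a f) (fun F => (gens a F f).card) (f + 1)
    (fun F hF => (mem_Gf.mp hF).1.gens_card (mem_Gf.mp hF).2)
  simpa using this

lemma Gf_zero (a : Fin N → Fin n → ℝ) : (Gf a 0).card ≤ 1 := by
  rw [Finset.card_le_one]
  intro F hF F' hF'
  have h1 := mem_Gf.mp hF
  have h2 := mem_Gf.mp hF'
  refine h1.1.eq h2.1 ?_
  rw [eq_of_finrank (Finset.subset_univ F) (by omega), eq_of_finrank (Finset.subset_univ F') (by omega)]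

lemma prop_pair (a : Fin N → Fin n → ℝ) {F : Finset (Fin N)}
    (hf : Module.finrank ℝ (KF a F) + 1 = Module.finrank ℝ (KF a Finset.univ)) {i : Fin N}
    (hi : {i} ∈ gens a F 1) : ∃ z0 ∈ KF a Finset.univ, z0 i ≠ 0 ∧ ∀ i', {i'} ∈ gens a F 1 →
      ∀ z ∈ KF a Finset.univ, z i' = z0 i' / z0 i * z i := by
  have hex : ∃ z0 ∈ KF a Finset.univ, z0 i ≠ 0 := by
    by_contra hcon
    push Not at hcon
    have h1 : KF a Finset.univ ≤ KF a {i}ᶜ := by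
      intro z hz
      refine KF_of_univ a hz fun x hx => ?_
      obtain rfl : x = i := by simpa using hx
      exact hcon z hz
    have := Submodule.finrank_mono h1
    rw [(mem_gens.mp hi).2] at this
    omega
  obtain ⟨z0, hz0, hzi⟩ := hex
  refine ⟨z0, hz0, hzi, fun i' hi' z hz => ?_⟩
  have h1 := KF_elim a hz0 hzi hz
  rw [show Finset.univ.erase i = {i}ᶜ by ext; simp, (mem_gens.mp hi).2, ← (mem_gens.mp hi').2] at h1
  have h2 := h1.1 i' (by simp)
  simp only [Pi.sub_apply, Pi.smul_apply, smul_eq_mul] at h2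
  have : z i' = z i / z0 i * z0 i' := by linarith
  rw [this]; ring

lemma main_reps {a : Fin N → Fin n → ℝ} {F0 : Finset (Fin N)} (h0 : F0 ∈ Gf a 0) :
    ∃ j0 ∈ F0, ∃ R ⊆ F0.erase j0, R.card + max (Gf a 1).card 1 ≤ N ∧
      ∀ i ∈ F0.erase j0, ∃ r ∈ R, ∃ κ : ℝ, ∀ z ∈ KF a F0, z i = κ * z r := by
  classical
  obtain ⟨hg, hr⟩ := mem_Gf.mp h0
  have hK : KF a F0 = KF a Finset.univ := eq_of_finrank (Finset.subset_univ F0) (by omega)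
  have hF0N : F0.card ≤ N := by simpa using Finset.card_le_univ F0
  rcases (Gf a 1).eq_empty_or_nonempty with he | ⟨F1, hF1⟩
  · obtain ⟨j0, hj0⟩ := Finset.card_pos.mp (by have := hg.hc; omega : 0 < F0.card)
    refine ⟨j0, hj0, F0.erase j0, subset_rfl, ?_, fun i hi => ⟨i, hi, 1, fun z _ => by ring⟩⟩
    have := Finset.card_erase_add_one hj0
    rw [he]; simp; omega
  · have hex : ∀ F : {F // F ∈ Gf a 1}, ∃ i i' : Fin N, i ≠ i' ∧ {i} ∈ gens a F.1 1 ∧ {i'} ∈ gens a F.1 1 := by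
      intro F
      obtain ⟨hFg, hFr⟩ := mem_Gf.mp F.2
      have := hFg.gens_card hFr
      obtain ⟨I, hI, I', hI', hne⟩ := Finset.one_lt_card.mp (by omega : 1 < (gens a F.1 1).card)
      obtain ⟨i, rfl⟩ := Finset.card_eq_one.mp (mem_gens.mp hI).1
      obtain ⟨i', rfl⟩ := Finset.card_eq_one.mp (mem_gens.mp hI').1
      exact ⟨i, i', fun h => hne (by rw [h]), hI, hI'⟩
    choose i i' hne hi hi' using hex
    have hmem : ∀ (F : {F // F ∈ Gf a 1}) x, {x} ∈ gens a F.1 1 → x ∈ F0 := by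
      intro F x hx
      obtain ⟨z0, hz0, hzx, _⟩ := prop_pair a (mem_Gf.mp F.2).2 hx
      by_contra hcon
      rw [← hK] at hz0
      exact hzx (hz0.1 x hcon)
    have huniq : ∀ (F F' : {F // F ∈ Gf a 1}) x, {x} ∈ gens a F.1 1 → {x} ∈ gens a F'.1 1 → F = F' :=
      fun F F' x hx hx' => Subtype.ext (gens_uniq (mem_Gf.mp F.2).1 (mem_Gf.mp F'.2).1 hx hx')
    have hinj : Function.Injective i := fun F F' h => huniq F F' (i F) (hi F) (h ▸ hi F')
    let X : Finset (Fin N) := Finset.univ.image i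
    have hX : X.card = (Gf a 1).card := by
      rw [Finset.card_image_of_injective _ hinj]; simp
    have hXF : X ⊆ F0 := by
      intro x hx
      obtain ⟨F, _, rfl⟩ := Finset.mem_image.mp hx
      exact hmem F _ (hi F)
    have hi'X : ∀ F, i' F ∉ X := by
      intro F hx
      obtain ⟨F', _, h⟩ := Finset.mem_image.mp hx
      have : F = F' := huniq F F' (i' F) (hi' F) (h ▸ hi F')
      subst this
      exact hne F h
    have hp : 1 ≤ (Gf a 1).card := Finset.card_pos.mpr ⟨F1, hF1⟩
    refine ⟨i ⟨F1, hF1⟩, hmem _ _ (hi _), F0 \ X, ?_, ?_, ?_⟩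
    · intro x hx
      rw [Finset.mem_sdiff] at hx
      refine Finset.mem_erase.mpr ⟨?_, hx.1⟩
      rintro rfl
      exact hx.2 (Finset.mem_image_of_mem _ (Finset.mem_univ _))
    · have := Finset.card_sdiff_add_card_eq_card hXF
      rw [max_eq_left hp]; omega
    · intro x hx
      by_cases hxX : x ∈ X
      · obtain ⟨F, _, rfl⟩ := Finset.mem_image.mp hxX
        obtain ⟨z0, hz0, hz0i, hz⟩ := prop_pair a (mem_Gf.mp F.2).2 (hi' F)
        refine ⟨i' F, Finset.mem_sdiff.mpr ⟨hmem F _ (hi' F), hi'X F⟩, z0 (i F) / z0 (i' F), ?_⟩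
        rw [hK]
        exact hz (i F) (hi F)
      · exact ⟨x, Finset.mem_sdiff.mpr ⟨Finset.mem_of_mem_erase hx, hxX⟩, 1, fun z _ => by ring⟩

end CountA
end Fewn

open Set Filter Topology

namespace Fewn

section CountB

variable {n N : ℕ}

lemma finrank_KF_univ (a : Fin N → Fin n → ℝ) (hN : 0 < N)
    (ha : ∀ (w : Fin n → ℝ) (b : ℝ), (∀ j, ∑ i, w i * a j i = b) → w = 0) :
    Module.finrank ℝ (KF a Finset.univ) + (n + 1) = N := by
  let φ : (ℝ × (Fin n → ℝ)) →ₗ[ℝ] (Fin N → ℝ) :=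
    { toFun := fun p i => p.1 + ∑ r, p.2 r * a i r
      map_add' := by
        intro p q; funext i
        simp only [Prod.fst_add, Prod.snd_add, Pi.add_apply, add_mul, Finset.sum_add_distrib]; ring
      map_smul' := by
        intro s p; funext i
        simp only [Prod.smul_fst, Prod.smul_snd, Pi.smul_apply, smul_eq_mul, RingHom.id_apply,
          mul_add, Finset.mul_sum, mul_assoc] }
  have hφ : ∀ p i, φ p i = p.1 + ∑ r, p.2 r * a i r := fun p i => rfl
  have hinj : Function.Injective φ := by
    rw [← LinearMap.ker_eq_bot, LinearMap.ker_eq_bot']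
    intro p hp
    have h1 : ∀ i, p.1 + ∑ r, p.2 r * a i r = 0 := fun i => by rw [← hφ, hp]; rfl
    have h2 : p.2 = 0 := ha p.2 (-p.1) fun j => by linarith [h1 j]
    have h3 := h1 ⟨0, hN⟩
    rw [h2] at h3
    refine Prod.ext ?_ h2
    simpa using h3
  have hr : Module.finrank ℝ (LinearMap.range φ) = n + 1 := by
    rw [LinearMap.finrank_range_of_inj hinj]; simp [add_comm]
  have hK : KF a Finset.univ = orth (LinearMap.range φ) := by
    ext z
    rw [mem_orth]
    constructor
    · rintro ⟨-, h0, h1⟩ t ⟨p, rfl⟩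
      have : ∑ i, φ p i * z i = p.1 * ∑ i, z i + ∑ r, p.2 r * ∑ i, z i * a i r := by
        simp only [hφ, add_mul, Finset.sum_add_distrib, Finset.mul_sum, Finset.sum_mul]
        congr 1
        rw [Finset.sum_comm]
        refine Finset.sum_congr rfl fun r _ => Finset.sum_congr rfl fun i _ => by ring
      rw [this, h0]
      simp only [h1]; simp
    · intro h
      refine ⟨by simp, ?_, fun r => ?_⟩
      · have := h _ ⟨(1, 0), rfl⟩
        simpa [hφ] using this
      · have := h _ ⟨(0, Pi.single r 1), rfl⟩
        simp only [hφ, Pi.single_apply, ite_mul, one_mul, zero_mul, Finset.sum_ite_eq',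
          Finset.mem_univ, if_true, zero_add] at this
        rw [← this]
        exact Finset.sum_congr rfl fun i _ => mul_comm _ _
  have := orth_finrank (LinearMap.range φ)
  rw [← hK, hr, Fintype.card_fin] at this
  omega

lemma piece_single {a : Fin N → Fin n → ℝ} {c : Fin N → ℝ} {x : Fin N} {Q : Set (Fin n → ℝ)}
    (h : Piece a c {x} Q) : Q = univ := by
  have hv : ∀ u, hF a c {x} u = c x * Real.exp (dt a x u) := fun u => by simp [hF]
  have hc : c x ≠ 0 := by
    obtain ⟨u, hu⟩ := h.hne
    intro h0
    exact h.hnz u hu (by rw [hv, h0, zero_mul])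
  have hcl : IsClosed Q := by
    refine isClosed_of_closure_subset fun u hu => h.hcl u hu ?_
    rw [hv]; exact mul_ne_zero hc (Real.exp_ne_zero _)
  exact IsClopen.eq_univ ⟨hcl, h.ho⟩ h.hne

theorem total_count {a : Fin N → Fin n → ℝ} {c : Fin N → ℝ} {l M : ℕ} (hN : N = n + 2 + l)
    (hn : 2 ≤ n) (hl : 2 ≤ l)
    (ha : ∀ (w : Fin n → ℝ) (b : ℝ), (∀ j, ∑ i, w i * a j i = b) → w = 0)
    (Fs : Fin M → Finset (Fin N)) (Q : Fin M → Set (Fin n → ℝ))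
    (h1 : ∀ j, (Fs j).Nonempty) (h2 : ∀ j, ∀ i ∉ Fs j, ∀ z ∈ KF a (insert i (Fs j)), z i = 0)
    (h3 : ∀ j, Piece a c (Fs j) (Q j))
    (h4 : ∀ i j, i ≠ j → Fs i = Fs j → Disjoint (Q i) (Q j)) :
    2 * M ≤ 2 * (n + 2 + l) +
      BB (max (n + 2 - max (Gf a 1).card 1) 1 + l) (max (n + 2 - max (Gf a 1).card 1) 1) l +
      (Gf a 1).card * BB (n + (l - 1)) n (l - 1) +
      ∑ f ∈ Finset.Icc 2 l, (Gf a f).card * BB (n + (l - f)) n (l - f) := by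
  classical
  have hK : Module.finrank ℝ (KF a Finset.univ) = l + 1 := by
    have := finrank_KF_univ a (by omega) ha
    omega
  have hgood : ∀ j, 2 ≤ (Fs j).card → Good a (Fs j) := fun j hj =>
    ⟨hj, h2 j, fun i hi => (h3 j).full hj i hi⟩
  have hrk : ∀ j, 2 ≤ (Fs j).card → ∃ f ∈ Finset.range (l + 1), Fs j ∈ Gf a f := by
    intro j hj
    have hle : Module.finrank ℝ (KF a (Fs j)) ≤ l + 1 := by
      rw [← hK]; exact Submodule.finrank_mono (KF_mono a (Finset.subset_univ _))
    obtain ⟨i, hi⟩ := h1 j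
    obtain ⟨z, hz, hzi⟩ := (h3 j).full hj i hi
    have hpos : 0 < Module.finrank ℝ (KF a (Fs j)) := by
      have : Nontrivial (KF a (Fs j)) := ⟨⟨⟨z, hz⟩, 0, fun h => hzi (by
        have := congrArg Subtype.val h
        simp only [ZeroMemClass.coe_zero] at this
        rw [this]; rfl)⟩⟩
      exact Module.finrank_pos
    refine ⟨l + 1 - Module.finrank ℝ (KF a (Fs j)), Finset.mem_range.mpr (by omega), ?_⟩
    rw [mem_Gf]
    exact ⟨hgood j hj, by omega⟩
  have hfib : ∀ (F : Finset (Fin N)) (hF : 2 ≤ F.card) (l' D : ℕ) (hD : 1 ≤ D)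
      (hK : Module.finrank ℝ (KF a F) = l' + 1) (j0 : Fin N) (hj0 : j0 ∈ F) (R : Finset (Fin N))
      (hR : R ⊆ F.erase j0) (hRc : R.card ≤ D + l')
      (hrep : ∀ i ∈ F.erase j0, ∃ r ∈ R, ∃ κ : ℝ, ∀ z ∈ KF a F, z i = κ * z r),
      2 * (Finset.univ.filter fun j => Fs j = F).card ≤ BB (D + l') D l' := by
    intro F hF l' D hD hK j0 hj0 R hR hRc hrep
    have := face_count (a := a) (c := c) hF (J := {j // Fs j = F}) (fun j => Q j.1)
      (fun j => by have := h3 j.1; rwa [j.2] at this)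
      (fun i j hij => h4 i.1 j.1 (fun h => hij (Subtype.ext h)) (i.2.trans j.2.symm))
      hD hK j0 hj0 R hR hRc hrep
    rwa [Fintype.card_subtype] at this
  -- per codimension
  have hcod : ∀ f (B : ℕ), (∀ F ∈ Gf a f, 2 * (Finset.univ.filter fun j => Fs j = F).card ≤ B) →
      2 * (Finset.univ.filter fun j => Fs j ∈ Gf a f).card ≤ (Gf a f).card * B := by
    intro f B hB
    have h := Finset.card_eq_sum_card_fiberwise (f := Fs)
      (s := Finset.univ.filter fun j => Fs j ∈ Gf a f) (t := Gf a f)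
      (fun j hj => by simpa using hj)
    rw [h, Finset.mul_sum, ← smul_eq_mul (a := (Gf a f).card)]
    refine Finset.sum_le_card_nsmul _ _ _ fun F hF => le_trans ?_ (hB F hF)
    gcongr
    exact Finset.subset_univ _
  have hcod1 : ∀ f, 1 ≤ f → f ≤ l → 2 * (Finset.univ.filter fun j => Fs j ∈ Gf a f).card ≤
      (Gf a f).card * BB (n + (l - f)) n (l - f) := by
    intro f hf hfl
    refine hcod f _ fun F hF => ?_
    obtain ⟨hg, hr⟩ := mem_Gf.mp hF
    have hcard := hg.card_le hf hr
    obtain ⟨j0, hj0⟩ : F.Nonempty := Finset.card_pos.mp (by have := hg.hc; omega)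
    refine hfib F hg.hc (l - f) n (by omega) (by omega) j0 hj0 (F.erase j0) subset_rfl ?_
      fun i hi => ⟨i, hi, 1, fun z _ => by ring⟩
    rw [Finset.card_erase_of_mem hj0]
    omega
  have hcod0 : 2 * (Finset.univ.filter fun j => Fs j ∈ Gf a 0).card ≤
      BB (max (n + 2 - max (Gf a 1).card 1) 1 + l) (max (n + 2 - max (Gf a 1).card 1) 1) l := by
    refine (hcod 0 _ fun F hF => ?_).trans ((Nat.mul_le_mul_right _ (Gf_zero a)).trans (by rw [one_mul]))
    obtain ⟨j0, hj0, R, hR, hRc, hrep⟩ := main_reps hF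
    obtain ⟨hg, hr⟩ := mem_Gf.mp hF
    exact hfib F hg.hc l _ (le_max_right _ _) (by omega) j0 hj0 R hR (by omega) hrep
  -- singletons
  have hS1 : (Finset.univ.filter fun j => (Fs j).card = 1).card ≤ N := by
    have : (Finset.univ.filter fun j => (Fs j).card = 1).card ≤
        (Finset.powersetCard 1 (Finset.univ : Finset (Fin N))).card := by
      refine Finset.card_le_card_of_injOn Fs ?_ ?_
      · intro j hj
        simpa [Finset.mem_powersetCard] using hj
      · intro i hi j hj hij
        by_contra hne
        have hd := h4 i j hne hij
        simp only [Finset.coe_filter, Finset.mem_univ, true_and, Set.mem_setOf_eq] at hi hj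
        obtain ⟨x, hx⟩ := Finset.card_eq_one.mp hi
        have e1 : Q i = univ := piece_single (x := x) (by rw [← hx]; exact h3 i)
        obtain ⟨u, hu⟩ := (h3 j).hne
        exact Set.disjoint_left.mp hd (e1 ▸ mem_univ u) hu
    rw [Finset.card_powersetCard, Finset.card_univ, Fintype.card_fin, Nat.choose_one_right] at this
    exact this
  -- total
  have hcov : (Finset.univ : Finset (Fin M)) ⊆ (Finset.univ.filter fun j => (Fs j).card = 1) ∪
      (Finset.range (l + 1)).biUnion fun f => Finset.univ.filter fun j => Fs j ∈ Gf a f := by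
    intro j _
    rw [Finset.mem_union]
    have := Finset.card_pos.mpr (h1 j)
    by_cases hj : (Fs j).card = 1
    · left; simpa using hj
    · right
      obtain ⟨f, hf, hF⟩ := hrk j (by omega)
      exact Finset.mem_biUnion.mpr ⟨f, hf, by simpa using hF⟩
  have htot := (Finset.card_le_card hcov).trans ((Finset.card_union_le _ _).trans
    (Nat.add_le_add hS1 Finset.card_biUnion_le))
  rw [Finset.card_univ, Fintype.card_fin] at htot
  have hsplit : Finset.range (l + 1) = insert 0 (insert 1 (Finset.Icc 2 l)) := by
    ext x; simp; omega
  rw [hsplit, Finset.sum_insert (by simp), Finset.sum_insert (by simp)] at htot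
  have hsum : 2 * ∑ f ∈ Finset.Icc 2 l, (Finset.univ.filter fun j => Fs j ∈ Gf a f).card ≤
      ∑ f ∈ Finset.Icc 2 l, (Gf a f).card * BB (n + (l - f)) n (l - f) := by
    rw [Finset.mul_sum]
    refine Finset.sum_le_sum fun f hf => ?_
    rw [Finset.mem_Icc] at hf
    exact hcod1 f (by omega) hf.2
  have hone := hcod1 1 le_rfl (by omega)
  omega

end CountB
end Fewn

open Set Filter Topology

namespace Fewn

section Fin1

variable {n N : ℕ}

lemma hF_shift [NeZero N] (a : Fin N → Fin n → ℝ) (c : Fin N → ℝ) (w y : Fin n → ℝ) (τ : ℝ) :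
    hF a c Finset.univ (y + τ • w) =
      (∑ j, Real.exp (dt a j y)) * ∑ i, c i * Pm a y i * Real.exp (τ * dt a i w) := by
  have := (den1_pos a y).ne'
  rw [hF, Finset.mul_sum]
  refine Finset.sum_congr rfl fun i _ => ?_
  rw [dt_add, dt_smul, Real.exp_add]
  simp only [Pm, act, one_mul]
  field_simp

lemma zero_closure_aux [NeZero N] {a : Fin N → Fin n → ℝ} {c : Fin N → ℝ} (hc : c ∉ Bad a)
    (z : Fin n → ℝ) (hz : hF a c Finset.univ z = 0) (σ : ℝ) (hσ : σ ≠ 0) :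
    z ∈ closure {y | 0 < σ * hF a c Finset.univ y} := by
  have hl : lc c (Pm a z) = 0 := by
    rw [hF_Pm] at hz
    exact (mul_eq_zero.mp hz).resolve_left (den1_pos a z).ne'
  obtain ⟨w, hw⟩ := nondeg_dir hc (subset_closure ⟨z, rfl⟩) hl σ hσ
  have hd := (deriv_path a c (Pm a z) w 0).const_mul σ
  simp only [zero_mul, Real.exp_zero, mul_one] at hd
  have hev := hasDerivAt_iff_tendsto_slope_zero.mp hd
  have hp : ∀ᶠ τ : ℝ in 𝓝[>] 0, 0 < σ * hF a c Finset.univ (z + τ • w) := by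
    have h1 := (hev.mono_left (nhdsGT_le_nhdsNE 0)).eventually (lt_mem_nhds hw)
    filter_upwards [h1, self_mem_nhdsWithin] with τ h2 h3
    have h3 : 0 < τ := h3
    rw [hF_shift]
    have e0 : ∑ i, c i * Pm a z i = 0 := hl
    simp only [zero_add, zero_mul, Real.exp_zero, mul_one, smul_eq_mul, e0, mul_zero, sub_zero] at h2
    have h4 : 0 < σ * ∑ i, c i * Pm a z i * Real.exp (τ * dt a i w) := by
      have := mul_pos h3 h2
      rwa [mul_inv_cancel_left₀ h3.ne'] at this
    have := mul_pos (den1_pos a z) h4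
    linarith
  have ht : Tendsto (fun τ : ℝ => z + τ • w) (𝓝[>] 0) (𝓝 z) := by
    have : Continuous fun τ : ℝ => z + τ • w := by fun_prop
    have h := this.tendsto 0
    simp only [zero_smul, add_zero] at h
    exact h.mono_left nhdsWithin_le_nhds
  exact mem_closure_of_tendsto ht hp

lemma zero_closure [NeZero N] {a : Fin N → Fin n → ℝ} {c : Fin N → ℝ} (hc : c ∉ Bad a)
    (z : Fin n → ℝ) (hz : hF a c Finset.univ z = 0) :
    z ∈ closure {y | 0 < hF a c Finset.univ y} ∧ z ∈ closure {y | hF a c Finset.univ y < 0} := by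
  constructor
  · have := zero_closure_aux hc z hz 1 one_ne_zero
    simpa using this
  · have := zero_closure_aux hc z hz (-1) (by norm_num)
    simpa using this

theorem zero_comps [NeZero N] {a : Fin N → Fin n → ℝ} {c : Fin N → ℝ} {l : ℕ} (hN : N = n + 2 + l)
    (hn : 2 ≤ n) (hl : 2 ≤ l)
    (ha : ∀ (w : Fin n → ℝ) (b : ℝ), (∀ j, ∑ i, w i * a j i = b) → w = 0) (hc : c ∉ Bad a) :
    Finite (ConnectedComponents {y : Fin n → ℝ // hF a c Finset.univ y = 0}) ∧
    2 * (Nat.card (ConnectedComponents {y : Fin n → ℝ // hF a c Finset.univ y = 0}) : ℝ) ≤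
      (n + 2 + l : ℝ) * (n + 2 + l - 1) + 2.59725 * 2 ^ (l.choose 2) * ((n : ℝ) + 2) ^ l := by
  set g := hF a c Finset.univ with hg
  have hgc : Continuous g := hF_cont a c _
  obtain ⟨B, hB⟩ : ∃ B, B = 2 * (n + 2 + l) +
      BB (max (n + 2 - max (Gf a 1).card 1) 1 + l) (max (n + 2 - max (Gf a 1).card 1) 1) l +
      (Gf a 1).card * BB (n + (l - 1)) n (l - 1) +
      ∑ f ∈ Finset.Icc 2 l, (Gf a f).card * BB (n + (l - f)) n (l - f) := ⟨_, rfl⟩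
  have hX : ∀ M (f : {y // g y ≠ 0} → Fin M), Continuous f → Function.Surjective f → M ≤ B / 2 := by
    intro M f hf hs
    have hopen : IsOpen {y | g y ≠ 0} := isOpen_ne_fun hgc continuous_const
    let Ω : Fin M → Set (Fin n → ℝ) := fun j => Subtype.val '' (f ⁻¹' {j})
    have hR : Regs a c Ω := by
      refine ⟨fun j => ?_, ?_, ?_⟩
      · exact hopen.isOpenMap_subtype_val _ ((isOpen_discrete {j}).preimage hf)
      · rintro i j _ ⟨y, hy, rfl⟩ ⟨y', hy', h⟩
        have : y' = y := Subtype.ext h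
        subst this
        exact hy.symm.trans hy'
      · intro y
        constructor
        · intro hy
          exact ⟨f ⟨y, hy⟩, ⟨y, hy⟩, rfl, rfl⟩
        · rintro ⟨j, y, _, rfl⟩
          exact y.2
    obtain ⟨Fs, Q, h1, h2, h3, h4⟩ := hR.pieces hc fun j => by
      obtain ⟨y, hy⟩ := hs j
      exact ⟨y.1, y, hy, rfl⟩
    have := total_count hN hn hl ha Fs Q h1 h2 h3 h4
    rw [← hB] at this
    omega
  obtain ⟨hfin, hcard⟩ := comps_bound hX
  have hz : ∀ z, g z = 0 → z ∈ closure {y | 0 < g y} ∧ z ∈ closure {y | g y < 0} :=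
    fun z h => zero_closure hc z h
  have hne : ∃ y, g y ≠ 0 := by
    by_contra hcon
    push Not at hcon
    obtain ⟨y, hy⟩ := closure_nonempty_iff.mp ⟨_, (hz 0 (hcon 0)).1⟩
    exact (ne_of_gt hy) (hcon y)
  obtain ⟨hfin', hcard'⟩ := comps_bound (Z := {y // g y = 0})
    (R := Nat.card (ConnectedComponents {y // g y ≠ 0}) - 1) (fun M f hf hs => by
      have := comps_lt hgc hz hne hfin f hf hs
      omega)
  refine ⟨hfin', ?_⟩
  have hpos : 1 ≤ Nat.card (ConnectedComponents {y // g y ≠ 0}) := by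
    obtain ⟨y, hy⟩ := hne
    have : Nonempty (ConnectedComponents {y // g y ≠ 0}) := ⟨ConnectedComponents.mk ⟨y, hy⟩⟩
    exact Nat.card_pos
  have hG1 := Gf_card a 1
  rw [Nat.choose_one_right] at hG1
  have hnum := num (M := Nat.card (ConnectedComponents {y // g y ≠ 0})) (fun f => (Gf a f).card) hn hl
    (p := (Gf a 1).card) (by omega) rfl (fun f hf => by
      have := Gf_card a f
      have hch : N.choose f = (n + 2 + l).choose f := congrArg (fun x => Nat.choose x f) hN
      rw [hch] at this
      refine le_trans (Nat.mul_le_mul_right _ (by omega)) this) (by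
      rw [← hB]; omega)
  refine le_trans ?_ hnum
  have : ((Nat.card (ConnectedComponents {y // g y = 0}) : ℕ) : ℝ) + 1 ≤
      (Nat.card (ConnectedComponents {y // g y ≠ 0}) : ℝ) := by
    exact_mod_cast (by omega : Nat.card (ConnectedComponents {y // g y = 0}) + 1 ≤ _)
  linarith

end Fin1
end Fewn

theorem stmt3 (n k : ℕ) (hn : 2 ≤ n) (hk : 4 ≤ k)
    (a : Fin (n + k) → Fin n → ℝ)
    (ha : NotAllInAffineHyperplane a) :
    ∃ U : Set (Fin (n + k) → ℝ), IsOpen U ∧ Dense U ∧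
      ∀ c ∈ U,
        Finite (ConnectedComponents {y : Fin n → ℝ // expSum a c y = 0}) ∧
        (Nat.card (ConnectedComponents {y : Fin n → ℝ // expSum a c y = 0}) : ℤ)
          ≤ ((n + k) * (n + k - 1) / 2 : ℕ) +
            ⌊(S (n + 2) (k - 2) + S (n + 1) (k - 4)) / 2⌋ := by
  have : NeZero (n + k) := ⟨by omega⟩
  refine ⟨Fewn.UU a, Fewn.UU_open a, Fewn.UU_dense a, fun c hc => ?_⟩
  obtain ⟨l, rfl⟩ : ∃ l, k = l + 2 := ⟨k - 2, by omega⟩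
  have ha' : ∀ (w : Fin n → ℝ) (b : ℝ), (∀ j, ∑ i, w i * a j i = b) → w = 0 := by
    intro w b h
    by_contra hw
    exact ha ⟨w, b, hw, h⟩
  obtain ⟨h1, h2⟩ := Fewn.zero_comps (a := a) (c := c) (l := l) (by omega) hn (by omega) ha' hc.2
  change Finite (ConnectedComponents {y : Fin n → ℝ // expSum a c y = 0}) at h1
  change 2 * (Nat.card (ConnectedComponents {y : Fin n → ℝ // expSum a c y = 0}) : ℝ) ≤ _ at h2
  refine ⟨h1, ?_⟩
  set m := Nat.card (ConnectedComponents {y : Fin n → ℝ // expSum a c y = 0}) with hm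
  have hS2 : 0 ≤ S (n + 1) (l + 2 - 4) := by
    unfold S
    split_ifs <;> positivity
  have hS1 : 2.59725 * 2 ^ (l.choose 2) * ((n : ℝ) + 2) ^ l ≤ S (n + 2) (l + 2 - 2) := by
    rw [Nat.add_sub_cancel, S, if_neg (by omega), if_neg (by omega), Nat.choose_two_right]
    push_cast
    have he : (2.59725 : ℝ) ≤ (Real.exp 1 ^ 2 + 3) / 4 := by
      have := Real.exp_one_gt_d9
      nlinarith
    gcongr
  obtain ⟨q, hq⟩ : ∃ q, (n + (l + 2)) * (n + (l + 2) - 1) = 2 * q := by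
    have := Nat.even_mul_pred_self (n + (l + 2))
    obtain ⟨q, hq⟩ := this
    exact ⟨q, by omega⟩
  have hq' : (n + 2 + l : ℝ) * (n + 2 + l - 1) = 2 * q := by
    have h : (((n + (l + 2)) * (n + (l + 2) - 1) : ℕ) : ℝ) = ((2 * q : ℕ) : ℝ) := by rw [hq]
    rw [Nat.cast_mul, Nat.cast_sub (by omega)] at h
    push_cast at h
    linarith
  rw [hq, Nat.mul_div_cancel_left _ (by norm_num : 0 < 2)]
  have hfl : (m : ℤ) - (q : ℤ) ≤ ⌊(S (n + 2) (l + 2 - 2) + S (n + 1) (l + 2 - 4)) / 2⌋ := by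
    rw [Int.le_floor]
    simp only [Int.cast_sub, Int.cast_natCast]
    rw [hq'] at h2
    linarith
  linarith
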